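/- arXiv:1105.6266 — 5 statements merged into one kernel-verified Lean document; each statement's English description precedes it below -/
import Mathlib

section
/- Let N ≥ 1 and m ≥ 1, let f₁, …, f_m : ℝ^N → ℝ be polynomial functions, and let y ∈ ℝ^N. If ξ ∈ ℝ^N satisfies fᵢ(ξ) = 0 for all i and ξ is a local minimizer of the distance function d_y(x) = ‖x − y‖² on the set {x ∈ ℝ^N : f₁(x) = ⋯ = f_m(x) = 0}, then there exist real numbers λ₀, λ₁, …, λ_m, not all zero, such that λ₀(ξ − y) + λ₁∇f₁(ξ) + ⋯ + λ_m∇f_m(ξ) = 0 (the Fritz John necessary optimality conditions). -/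
open MvPolynomial

theorem poly_hasStrictFDerivAt {N : ℕ} (p : MvPolynomial (Fin N) ℝ)
    (x : EuclideanSpace ℝ (Fin N)) :
    HasStrictFDerivAt (fun x : EuclideanSpace ℝ (Fin N) => eval (fun j => x j) p)
      (∑ j, eval (fun j' => x j') (pderiv j p) •
        (EuclideanSpace.proj j : EuclideanSpace ℝ (Fin N) →L[ℝ] ℝ)) x := by
  induction p using MvPolynomial.induction_on with
  | C a => simpa using hasStrictFDerivAt_const a x
  | add p q hp hq =>
    simp only [map_add, add_smul, Finset.sum_add_distrib]
    exact hp.add hq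
  | mul_X p i hp =>
    have hX : HasStrictFDerivAt (fun x : EuclideanSpace ℝ (Fin N) => x i)
        (EuclideanSpace.proj i : EuclideanSpace ℝ (Fin N) →L[ℝ] ℝ) x :=
      (EuclideanSpace.proj i : EuclideanSpace ℝ (Fin N) →L[ℝ] ℝ).hasStrictFDerivAt
    have h := hp.mul hX
    simp only [map_mul, eval_X]
    refine h.congr_fderiv ?_
    ext v
    simp [pderiv_X, Pi.single_apply, add_mul, Finset.sum_add_distrib, Finset.mul_sum,
      apply_ite]
    refine Finset.sum_congr rfl fun j _ => ?_
    ring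

/-- **Fritz John necessary optimality conditions** for minimizing the squared
distance `d_y(x) = ‖x - y‖²` over the real algebraic set
`{x ∈ ℝ^N : f₁(x) = ⋯ = f_m(x) = 0}`: a local minimizer `ξ` admits multipliers
`λ₀, …, λ_m`, not all zero, with
`λ₀(ξ - y) + λ₁∇f₁(ξ) + ⋯ + λ_m∇f_m(ξ) = 0`. -/
theorem fritz_john_distance (N m : ℕ) (hN : 1 ≤ N) (hm : 1 ≤ m)
    (f : Fin m → MvPolynomial (Fin N) ℝ)
    (y ξ : EuclideanSpace ℝ (Fin N))
    (hξ : ∀ i : Fin m, eval (fun j => ξ j) (f i) = 0)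
    (hmin : IsLocalMinOn (fun x : EuclideanSpace ℝ (Fin N) => ‖x - y‖ ^ 2)
      {x : EuclideanSpace ℝ (Fin N) | ∀ i : Fin m, eval (fun j => x j) (f i) = 0} ξ) :
    ∃ lam : Fin (m + 1) → ℝ, lam ≠ 0 ∧
      ∀ j : Fin N,
        lam 0 * (ξ j - y j)
          + ∑ i : Fin m, lam i.succ * eval (fun j' => ξ j') (pderiv j (f i)) = 0 := by
  have hφ : HasStrictFDerivAt (fun x : EuclideanSpace ℝ (Fin N) => ‖x - y‖ ^ 2)
      (2 • (innerSL ℝ (ξ - y))) ξ := by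
    have h := (hasStrictFDerivAt_norm_sq (ξ - y)).comp ξ
      ((hasStrictFDerivAt_id ξ).sub_const y)
    simpa using h
  have hext : IsLocalExtrOn (fun x : EuclideanSpace ℝ (Fin N) => ‖x - y‖ ^ 2)
      {x : EuclideanSpace ℝ (Fin N) | ∀ i : Fin m,
        (fun (i : Fin m) (x : EuclideanSpace ℝ (Fin N)) => eval (fun j => x j) (f i)) i x
        = (fun (i : Fin m) (x : EuclideanSpace ℝ (Fin N)) => eval (fun j => x j) (f i)) i ξ}
      ξ := by
    simp only [hξ]
    exact Or.inl hmin
  obtain ⟨L, L0, hne, hL⟩ := hext.exists_multipliers_of_hasStrictFDerivAt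
    (fun i => poly_hasStrictFDerivAt (f i) ξ) hφ
  refine ⟨Fin.cons (2 * L0) L, ?_, fun j => ?_⟩
  · intro h
    apply hne
    have h0 := congrFun h 0
    have h1 : L = 0 := funext fun i => by simpa using congrFun h i.succ
    simp at h0
    simp [h0, h1]
  · have h := congrArg (fun T => T (EuclideanSpace.single j (1 : ℝ))) hL
    simp [Pi.single_apply, EuclideanSpace.inner_single_right] at h
    simp only [Fin.cons_zero, Fin.cons_succ]
    linarith
end

section
/- Let N ≥ 1 and m ≥ 1, let f₁, …, f_m : ℝ^N → ℝ be polynomial functions, and let y ∈ ℝ^N. Then every nonempty connected component C of the real algebraic set {x ∈ ℝ^N : f₁(x) = ⋯ = f_m(x) = 0} contains a point ξ that minimizes ‖x − y‖ over C, and moreover at this point there exist real numbers λ₀, λ₁, …, λ_m, not all zero, with λ₀(ξ − y) + λ₁∇f₁(ξ) + ⋯ + λ_m∇f_m(ξ) = 0. In particular, every connected component of the real algebraic set contains a critical point of the distance function to y. -/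
open MvPolynomial

open Topology in
lemma eventually_mem_component {E F : Type*} [NormedAddCommGroup E] [NormedSpace ℝ E]
    [CompleteSpace E] [NormedAddCommGroup F] [NormedSpace ℝ F] [FiniteDimensional ℝ F]
    {f : E → F} {f' : E →L[ℝ] F} {a : E} (hf : HasStrictFDerivAt f f' a) (hf' : f'.range = ⊤) :
    ∀ᶠ x in 𝓝 a, f x = f a → x ∈ connectedComponentIn {x | f x = f a} a := by
  set e := hf.implicitToOpenPartialHomeomorph f f' hf' with he
  have hs : a ∈ e.source := hf.mem_implicitToOpenPartialHomeomorph_source hf'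
  have ha : e a = (f a, 0) := hf.implicitToOpenPartialHomeomorph_self hf'
  have hfst : ∀ x, (e x).1 = f x := fun x => hf.implicitToOpenPartialHomeomorph_fst hf' x
  have ht : e.target ∈ 𝓝 (e a) := e.open_target.mem_nhds (e.map_source hs)
  obtain ⟨ε, hε, hball⟩ := Metric.mem_nhds_iff.1 ht
  have hsub : ∀ v ∈ Metric.ball (0 : f'.ker) ε, (f a, v) ∈ e.target := by
    intro v hv
    apply hball
    rw [ha, Metric.mem_ball, Prod.dist_eq]
    refine max_lt (by simpa using hε) hv
  set S : Set E := (fun v : f'.ker => e.symm (f a, v)) '' Metric.ball 0 ε with hS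
  have hSc : IsPreconnected S := by
    apply (convex_ball (0 : f'.ker) ε).isPreconnected.image
    exact e.continuousOn_symm.comp (by fun_prop) hsub
  have hSV : S ⊆ {x | f x = f a} := by
    rintro _ ⟨v, hv, rfl⟩
    change f (e.symm (f a, v)) = f a
    rw [← hfst, e.right_inv (hsub v hv)]
  have haS : a ∈ S := ⟨0, Metric.mem_ball_self hε, by
    change e.symm (f a, 0) = a
    rw [← ha, e.left_inv hs]⟩
  have h1 : ∀ᶠ x in 𝓝 a, x ∈ e.source := e.open_source.mem_nhds hs
  have h2 : ∀ᶠ x in 𝓝 a, e x ∈ Metric.ball (e a) ε :=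
    (e.continuousAt hs).eventually (Metric.ball_mem_nhds _ hε)
  filter_upwards [h1, h2] with x hx1 hx2 hx
  refine hSc.subset_connectedComponentIn haS hSV ⟨(e x).2, ?_, ?_⟩
  · rw [ha, Metric.mem_ball, Prod.dist_eq] at hx2
    exact (max_lt_iff.1 hx2).2
  · change e.symm (f a, (e x).2) = x
    rw [← hx, ← hfst x]
    exact e.left_inv hx1

lemma mvPoly_hasStrictFDerivAt {N : ℕ} (p : MvPolynomial (Fin N) ℝ)
    (x : EuclideanSpace ℝ (Fin N)) :
    ∃ p' : EuclideanSpace ℝ (Fin N) →L[ℝ] ℝ,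
      HasStrictFDerivAt (fun x : EuclideanSpace ℝ (Fin N) => eval (fun j => x j) p) p' x ∧
      ∀ j, p' (EuclideanSpace.single j 1) = eval (fun j => x j) (pderiv j p) := by
  induction p using MvPolynomial.induction_on with
  | C a => exact ⟨0, by simpa using hasStrictFDerivAt_const a x, by simp⟩
  | add p q hp hq =>
    obtain ⟨p', hp, hp'⟩ := hp
    obtain ⟨q', hq, hq'⟩ := hq
    exact ⟨p' + q', by simp only [map_add]; exact hp.add hq, fun j => by simp [hp', hq']⟩
  | mul_X p i hp =>
    obtain ⟨p', hp, hp'⟩ := hp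
    have hi : HasStrictFDerivAt (fun x : EuclideanSpace ℝ (Fin N) => x i)
      (EuclideanSpace.proj i : EuclideanSpace ℝ (Fin N) →L[ℝ] ℝ) x :=
      (EuclideanSpace.proj i : EuclideanSpace ℝ (Fin N) →L[ℝ] ℝ).hasStrictFDerivAt
    refine ⟨_, by simp only [map_mul, eval_X]; exact hp.mul hi, fun j => ?_⟩
    simp only [Derivation.leibniz, pderiv_X]
    by_cases h : i = j
    · subst h
      simp [hp']
    · simp [hp', h]

/-- Every nonempty connected component of the real algebraic set
`Var_ℝ(f) = {x ∈ ℝ^N : f₁(x) = ⋯ = f_m(x) = 0}` (expressed as the connected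
component in `Var_ℝ(f)` of an arbitrary point `x₀ ∈ Var_ℝ(f)`) contains a point `ξ`
minimizing the distance `‖x - y‖` over the component, and at `ξ` the Fritz John
conditions hold: there are `λ₀, …, λ_m`, not all zero, with
`λ₀(ξ - y) + λ₁∇f₁(ξ) + ⋯ + λ_m∇f_m(ξ) = 0`.  In particular every connected
component contains a critical point of the distance function to `y`. -/
theorem component_contains_critical_point (N m : ℕ) (hN : 1 ≤ N) (hm : 1 ≤ m)
    (f : Fin m → MvPolynomial (Fin N) ℝ) (y : EuclideanSpace ℝ (Fin N))
    (x₀ : EuclideanSpace ℝ (Fin N))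
    (hx₀ : x₀ ∈ {x : EuclideanSpace ℝ (Fin N) | ∀ i : Fin m, eval (fun j => x j) (f i) = 0}) :
    ∃ ξ ∈ connectedComponentIn
        {x : EuclideanSpace ℝ (Fin N) | ∀ i : Fin m, eval (fun j => x j) (f i) = 0} x₀,
      (∀ x ∈ connectedComponentIn
          {x : EuclideanSpace ℝ (Fin N) | ∀ i : Fin m, eval (fun j => x j) (f i) = 0} x₀,
        ‖ξ - y‖ ≤ ‖x - y‖) ∧
      ∃ lam : Fin (m + 1) → ℝ, lam ≠ 0 ∧
        ∀ j : Fin N,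
          lam 0 * (ξ j - y j)
            + ∑ i : Fin m, lam i.succ * eval (fun j' => ξ j') (pderiv j (f i)) = 0 := by
  classical
  set V : Set (EuclideanSpace ℝ (Fin N)) :=
    {x : EuclideanSpace ℝ (Fin N) | ∀ i : Fin m, eval (fun j => x j) (f i) = 0} with hV
  have hcont : ∀ i, Continuous
      (fun x : EuclideanSpace ℝ (Fin N) => eval (fun j => x j) (f i)) := fun i =>
    continuous_iff_continuousAt.2 fun x => by
      obtain ⟨p', hp, -⟩ := mvPoly_hasStrictFDerivAt (f i) x
      exact hp.continuousAt
  have hVc : IsClosed V := by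
    rw [hV, Set.ofPred_forall]
    exact isClosed_iInter fun i => isClosed_eq (hcont i) continuous_const
  have hx₀C : x₀ ∈ connectedComponentIn V x₀ := mem_connectedComponentIn hx₀
  have hCc : IsClosed (connectedComponentIn V x₀) := by
    apply isClosed_of_closure_subset
    exact isPreconnected_connectedComponentIn.closure.subset_connectedComponentIn
      (subset_closure hx₀C)
      (closure_minimal (connectedComponentIn_subset V x₀) hVc)
  obtain ⟨ξ, hξC, hξ⟩ := hCc.exists_infDist_eq_dist ⟨x₀, hx₀C⟩ y
  have hmin : ∀ x ∈ connectedComponentIn V x₀, ‖ξ - y‖ ≤ ‖x - y‖ := by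
    intro x hx
    have := Metric.infDist_le_dist_of_mem (x := y) hx
    rw [hξ, dist_comm, dist_eq_norm, dist_comm, dist_eq_norm] at this
    exact this
  refine ⟨ξ, hξC, hmin, ?_⟩
  have hξV : ξ ∈ V := connectedComponentIn_subset V x₀ hξC
  choose g' hg hg' using fun i => mvPoly_hasStrictFDerivAt (f i) ξ
  set F : EuclideanSpace ℝ (Fin N) → (Fin m → ℝ) :=
    fun x i => eval (fun j => x j) (f i) with hF
  have hFξ : F ξ = 0 := funext hξV
  have hFd : HasStrictFDerivAt F (ContinuousLinearMap.pi g') ξ :=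
    hasStrictFDerivAt_pi.2 hg
  by_cases hr : (ContinuousLinearMap.pi g').range = ⊤
  · have hev := eventually_mem_component hFd hr
    have hVF : {x | F x = F ξ} = V := by
      ext x
      rw [hFξ]
      simp [hF, hV, funext_iff]
    rw [hVF, ← connectedComponentIn_eq hξC] at hev
    have hφ : HasStrictFDerivAt (fun x : EuclideanSpace ℝ (Fin N) => ‖x - y‖ ^ 2) _ ξ :=
      (hasStrictFDerivAt_norm_sq (ξ - y)).comp ξ ((hasStrictFDerivAt_id ξ).sub_const y)
    have hloc : IsLocalExtrOn (fun x : EuclideanSpace ℝ (Fin N) => ‖x - y‖ ^ 2)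
        {x | ∀ i, eval (fun j => x j) (f i) = eval (fun j => ξ j) (f i)} ξ := by
      left
      refine eventually_nhdsWithin_iff.2 ?_
      filter_upwards [hev] with x hx hx'
      have := hmin x (hx (funext hx'))
      gcongr
    obtain ⟨Λ, Λ₀, hΛ, h⟩ := hloc.exists_multipliers_of_hasStrictFDerivAt hg hφ
    refine ⟨Fin.cons (2 * Λ₀) Λ, ?_, fun j => ?_⟩
    · intro h0
      apply hΛ
      have h1 : Λ₀ = 0 := by simpa using congrFun h0 0
      have h2 : Λ = 0 := funext fun i => by simpa using congrFun h0 i.succ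
      rw [h1, h2]; rfl
    · have := congrArg (fun L => L (EuclideanSpace.single j (1 : ℝ))) h
      simp [hg', EuclideanSpace.inner_single_right] at this
      simp only [Fin.cons_zero, Fin.cons_succ]
      linarith
  · obtain ⟨L, hL, hLr⟩ := Submodule.exists_le_ker_of_lt_top _ (lt_top_iff_ne_top.2 hr)
    have hLs : ∀ v : Fin m → ℝ, L v = ∑ i, L (Pi.single i 1) * v i := by
      intro v
      rw [LinearMap.pi_apply_eq_sum_univ L v]
      refine Finset.sum_congr rfl fun i _ => ?_
      rw [smul_eq_mul, mul_comm]
      congr 2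
      ext k
      simp [Pi.single_apply, eq_comm]
    refine ⟨Fin.cons 0 (fun i => L (Pi.single i 1)), ?_, fun j => ?_⟩
    · intro h0
      apply hL
      ext i
      simpa using congrFun h0 i.succ
    · have : L (ContinuousLinearMap.pi g' (EuclideanSpace.single j 1)) = 0 :=
        hLr ⟨_, rfl⟩
      rw [hLs] at this
      simpa [hg'] using this
end

section
/- Let N ≥ 1, k ≥ 1, and let f : ℝ^N → ℝ be a polynomial of total degree 2k. Then the real algebraic set {x ∈ ℝ^N : f(x) = 0} has at most K(N, 2k) := N · 2k · (2k − 1)^{N−1} connected components. -/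
open MvPolynomial

namespace CC

/-- A linearly independent finite family stays independent under all but finitely many
perturbations along a line. -/
lemma linInd_perturb {ι Y : Type*} [Fintype ι] [AddCommGroup Y] [Module ℝ Y]
    (g0 g1 : ι → Y) (h : LinearIndependent ℝ g0) :
    {t : ℝ | ¬ LinearIndependent ℝ (fun i => g0 i + t • g1 i)}.Finite := by
  classical
  obtain ⟨B, hB⟩ := LinearMap.exists_leftInverse_of_injective
    (Fintype.linearCombination ℝ g0) (by
      rw [LinearMap.ker_eq_bot]
      exact h.fintypeLinearCombination_injective)
  have hB' : ∀ i, B (g0 i) = Pi.single i 1 := by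
    intro i
    have := LinearMap.congr_fun hB (Pi.single i 1)
    simpa [Fintype.linearCombination_apply_single] using this
  let A : Matrix ι ι ℝ := fun i k => B (g1 i) k
  let p : Polynomial ℝ := (1 + (Polynomial.X : Polynomial ℝ) • A.map Polynomial.C).det
  have hpe : ∀ t, p.eval t = (1 + t • A).det := by
    intro t
    have : p.eval t = Polynomial.evalRingHom t p := rfl
    rw [this, RingHom.map_det]
    congr 1
    ext i k
    simp [Matrix.one_apply, apply_ite]
    ring
  have hp : p ≠ 0 := by
    intro h0
    have := hpe 0
    simp [h0] at this
  refine (p.rootSet_finite ℝ).subset ?_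
  intro t ht
  rw [Polynomial.mem_rootSet]
  refine ⟨hp, ?_⟩
  by_contra hne
  apply ht
  have hdet : (1 + t • A).det ≠ 0 := by
    rw [← hpe]; simpa using hne
  have hrow : LinearIndependent ℝ (fun i => (1 + t • A) i) :=
    Matrix.linearIndependent_rows_of_det_ne_zero hdet
  refine LinearIndependent.of_comp B ?_
  have he : (B ∘ fun i => g0 i + t • g1 i) = fun i => (1 + t • A) i := by
    funext i
    funext k
    have : (1 + t • A) i k = (1 : Matrix ι ι ℝ) i k + t * B (g1 i) k := rfl
    rw [this]
    simp [hB', Matrix.one_apply, Pi.single_apply, eq_comm]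
  rw [he]
  exact hrow

/-- Exponents of monomials in `x_1, …, x_n` (indices `some j`) and `lambda` (index `none`). -/
abbrev Ex (n : ℕ) := Option (Fin n) →₀ ℕ

/-- weights : `x_j` has weight one, `lambda` has weight `q`. -/
def wv (n q : ℕ) : Option (Fin n) → ℕ := fun o => o.elim q (fun _ => 1)

noncomputable def wt (n q : ℕ) : Ex n →+ ℕ := Finsupp.weight (wv n q)

lemma wt_eq (n q : ℕ) (u : Ex n) : wt n q u = u none * q + ∑ j, u (some j) := by
  simp [wt, Finsupp.weight_eq_sum, Fintype.sum_option, wv]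

lemma wt_finite (n q : ℕ) (hq : q ≠ 0) (W : ℕ) : {u : Ex n | wt n q u ≤ W}.Finite := by
  apply Finsupp.finite_of_nat_weight_le
  rintro (_ | j) <;> simp [wv, hq]

/-- the reduced exponents -/
def Red (n q : ℕ) (u : Ex n) : Prop := ∀ j, u (some j) ≤ q

/-- the normal form of an exponent, for the relations `x_j ^ (q+1) = lambda * x_j` -/
noncomputable def nf (n q : ℕ) (u : Ex n) : Ex n :=
  Finsupp.equivFunOnFinite.symm (fun o => o.elim
    (u none + ∑ j, (u (some j) - 1) / q)
    (fun j => if u (some j) = 0 then 0 else (u (some j) - 1) % q + 1))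

lemma nf_none (n q : ℕ) (u : Ex n) : nf n q u none = u none + ∑ j, (u (some j) - 1) / q := rfl
lemma nf_some (n q : ℕ) (u : Ex n) (j : Fin n) : nf n q u (some j) =
  if u (some j) = 0 then 0 else (u (some j) - 1) % q + 1 := rfl

lemma nf_of_red (n q : ℕ) (hq : q ≠ 0) (u : Ex n) (hu : Red n q u) : nf n q u = u := by
  ext o
  rcases o with _ | j
  · rw [nf_none]
    have : ∑ j, (u (some j) - 1) / q = 0 := by
      apply Finset.sum_eq_zero
      intro j _
      apply Nat.div_eq_of_lt
      have := hu j
      omega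
    omega
  · rw [nf_some]
    have := hu j
    split_ifs with h
    · exact h.symm
    · rw [Nat.mod_eq_of_lt (by omega)]; omega

lemma nf_step (n q : ℕ) (hq : q ≠ 0) (u : Ex n) (j : Fin n) :
    nf n q (u + Finsupp.single (some j) (q + 1)) =
      nf n q (u + Finsupp.single (some j) 1 + Finsupp.single none 1) := by
  have key : ∀ a : ℕ, (a + (q + 1) - 1) / q = (a + 1 - 1) / q + 1 := by
    intro a
    have : a + (q + 1) - 1 = a + q := by omega
    rw [this, Nat.add_div_right _ (Nat.pos_of_ne_zero hq)]; simp
  ext o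
  rcases o with _ | k
  · rw [nf_none, nf_none]
    simp only [Finsupp.add_apply, Finsupp.single_apply]
    have : ∀ k, (u (some k) + (if some j = some k then q + 1 else 0) - 1) / q =
        (u (some k) + (if some j = some k then 1 else 0) + (if none = some k then 1 else 0) - 1) / q
          + if k = j then 1 else 0 := by
      intro k
      by_cases h : j = k
      · subst h; simp; simpa using key (u (some j))
      · simp [h, Ne.symm h]
    rw [Finset.sum_congr rfl (fun k _ => this k), Finset.sum_add_distrib]
    simp
    ring
  · rw [nf_some, nf_some]
    by_cases h : j = k
    · subst h
      simp
    · simp [h]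

lemma nf_none_lt (n q : ℕ) (hq : q ≠ 0) (u : Ex n) (j : Fin n) (m : ℕ) (hm : q + 1 ≤ m) :
    u none < nf n q (u + Finsupp.single (some j) m) none := by
  rw [nf_none]
  have h1 : 1 ≤ ((u + Finsupp.single (some j) m) (some j) - 1) / q := by
    rw [Nat.one_le_div_iff (Nat.pos_of_ne_zero hq)]
    simp; omega
  have h2 := Finset.single_le_sum (f := fun k => ((u + Finsupp.single (some j) m) (some k) - 1) / q)
    (fun _ _ => Nat.zero_le _) (Finset.mem_univ j)
  simp only [Finsupp.add_apply, Finsupp.single_apply] at *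
  simp at *
  omega

/-- normal form of polynomials -/
noncomputable def rho (n q : ℕ) :
    MvPolynomial (Option (Fin n)) ℝ →ₗ[ℝ] MvPolynomial (Option (Fin n)) ℝ :=
  (basisMonomials (Option (Fin n)) ℝ).constr ℝ (fun u => monomial (nf n q u) 1)

lemma rho_monomial (n q : ℕ) (u : Ex n) (c : ℝ) :
    rho n q (monomial u c) = monomial (nf n q u) c := by
  have h1 : rho n q (monomial u 1) = monomial (nf n q u) 1 := by
    have := (basisMonomials (Option (Fin n)) ℝ).constr_basis ℝ
      (fun u => (monomial (nf n q u) 1 : MvPolynomial (Option (Fin n)) ℝ)) u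
    simpa [rho] using this
  have h2 : (monomial u c : MvPolynomial (Option (Fin n)) ℝ) = c • monomial u 1 := by
    simp [smul_monomial]
  rw [h2, map_smul, h1, smul_monomial]; simp

/-- the polynomial `∑ x_j^(q+2) - 1` -/
noncomputable def GG (n q : ℕ) : MvPolynomial (Fin n) ℝ := ∑ j, X j ^ (q + 2) - 1

lemma rename_GG_mul (n q : ℕ) (v : Ex n) :
    monomial v (1 : ℝ) * rename some (GG n q) =
      ∑ j, monomial (v + Finsupp.single (some j) (q + 2)) 1 - monomial v 1 := by
  simp only [GG, map_sub, map_sum, map_pow, rename_X, map_one, mul_sub, Finset.mul_sum, mul_one]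
  congr 1
  refine Finset.sum_congr rfl fun j _ => ?_
  rw [X_pow_eq_monomial, monomial_mul]; simp

/-- key injectivity -/
lemma rho_GG_inj (n q : ℕ) (hq : q ≠ 0) {ι : Type*} [Fintype ι] (e : ι → Ex n)
    (he : Function.Injective e) (hS : ∀ i, Red n q (e i)) (c : ι → ℝ)
    (h : rho n q (∑ i, c i • (monomial (e i) (1 : ℝ) * rename some (GG n q))) = 0) :
    ∀ i, c i = 0 := by
  classical
  by_contra hcon
  push Not at hcon
  obtain ⟨v0, hc0⟩ := hcon
  obtain ⟨u, hu, hmin⟩ := (Finset.univ.filter (fun v => c v ≠ 0)).exists_min_image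
    (fun v => e v none) ⟨v0, by simp [hc0]⟩
  simp only [Finset.mem_filter, Finset.mem_univ, true_and] at hu hmin
  have hco := congrArg (coeff (e u)) h
  simp only [rename_GG_mul, map_sum, map_smul, map_sub, rho_monomial, coeff_sum, coeff_smul,
    coeff_sub, coeff_monomial, coeff_zero] at hco
  rw [Finset.sum_eq_single u] at hco
  · have h1 : ∀ j : Fin n, ¬ (nf n q (e u + Finsupp.single (some j) (q + 2)) = e u) := by
      intro j hj
      have := nf_none_lt n q hq (e u) j (q + 2) (by omega)
      rw [hj] at this
      exact lt_irrefl _ this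
    simp [h1, nf_of_red n q hq (e u) (hS u), -Finsupp.single_add] at hco
    exact hu hco
  · intro v _ hvu
    by_cases hcv : c v = 0
    · simp [hcv]
    · have h1 : ∀ j : Fin n, ¬ (nf n q (e v + Finsupp.single (some j) (q + 2)) = e u) := by
        intro j hj
        have := nf_none_lt n q hq (e v) j (q + 2) (by omega)
        rw [hj] at this
        have := hmin v hcv
        omega
      simp [h1, nf_of_red n q hq (e v) (hS v), he.ne hvu, -Finsupp.single_add]
  · intro hn; exact absurd (Finset.mem_univ _) hn

/-- triangularity of the other part -/
lemma tri_inj (n q : ℕ) (hq : q ≠ 0) {ι : Type*} [Fintype ι] (e e' : ι → Ex n)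
    (he : Function.Injective e) (h' : ∀ i, e i none < e' i none) (c : ι → ℝ)
    (h : ∑ i, c i • (monomial (e i) (1 : ℝ) - monomial (e' i) (1 : ℝ)) = 0) :
    ∀ i, c i = 0 := by
  classical
  by_contra hcon
  push Not at hcon
  obtain ⟨v0, hc0⟩ := hcon
  obtain ⟨u, hu, hmin⟩ := (Finset.univ.filter (fun v => c v ≠ 0)).exists_min_image
    (fun v => e v none) ⟨v0, by simp [hc0]⟩
  simp only [Finset.mem_filter, Finset.mem_univ, true_and] at hu hmin
  have hco := congrArg (coeff (e u)) h
  simp only [coeff_sum, coeff_smul, coeff_sub, coeff_monomial, coeff_zero] at hco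
  rw [Finset.sum_eq_single u] at hco
  · have h1 : ¬ (e' u = e u) := by
      intro hj
      have := h' u
      rw [hj] at this
      exact lt_irrefl _ this
    simp [h1] at hco
    exact hu hco
  · intro v _ hvu
    by_cases hcv : c v = 0
    · simp [hcv]
    · have h1 : ¬ (e' v = e u) := by
        intro hj
        have := h' v
        rw [hj] at this
        have := hmin v hcv
        omega
      simp [h1, he.ne hvu]
  · intro hn; exact absurd (Finset.mem_univ _) hn

noncomputable def Mon (n q : ℕ) (hq : q ≠ 0) (W : ℕ) : Finset (Ex n) := (wt_finite n q hq W).toFinset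

lemma mem_Mon {n q : ℕ} {hq : q ≠ 0} {W : ℕ} {u : Ex n} : u ∈ Mon n q hq W ↔ wt n q u ≤ W := by
  simp [Mon]

/-- index of the non-reduced monomials -/
abbrev NR (n q W : ℕ) := {u : Ex n // wt n q u ≤ W ∧ ¬ Red n q u}
/-- index of the reduced monomials -/
abbrev RD (n q W : ℕ) := {u : Ex n // wt n q u ≤ W ∧ Red n q u}

lemma NR_ex {n q W : ℕ} (u : NR n q W) : ∃ j, q < u.1 (some j) := by
  have := u.2.2
  unfold Red at this
  push Not at this
  exact this

noncomputable def jj {n q W : ℕ} (u : NR n q W) : Fin n := (NR_ex u).choose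

lemma jj_spec {n q W : ℕ} (u : NR n q W) : q < u.1 (some (jj u)) := (NR_ex u).choose_spec

noncomputable def base {n q W : ℕ} (u : NR n q W) : Ex n :=
  u.1 - Finsupp.single (some (jj u)) (q + 1)

lemma base_add {n q W : ℕ} (u : NR n q W) :
    base u + Finsupp.single (some (jj u)) (q + 1) = u.1 := by
  apply tsub_add_cancel_of_le
  rw [Finsupp.single_le_iff]
  exact jj_spec u

lemma wt_base {n q W : ℕ} (u : NR n q W) : wt n q (base u) + (q + 1) ≤ W := by
  have h1 := congrArg (wt n q) (base_add u)
  have h2 : wt n q (Finsupp.single (some (jj u)) (q + 1)) = q + 1 := by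
    simp [wt, Finsupp.weight_single, wv]
  rw [map_add, h2] at h1
  rw [h1]; exact u.2.1

/-- unperturbed generators -/
noncomputable def g0 (n q W W' : ℕ) : NR n q W ⊕ RD n q W' → MvPolynomial (Option (Fin n)) ℝ :=
  Sum.elim
    (fun u => monomial (base u) 1 * (C ((q : ℝ) + 2) * (X (some (jj u)) ^ (q + 1)
      - X none * X (some (jj u)))))
    (fun v => monomial v.1 1 * rename some (GG n q))

/-- perturbation of the generators -/
noncomputable def g1 (n q W W' : ℕ) (φ : MvPolynomial (Fin n) ℝ) :
    NR n q W ⊕ RD n q W' → MvPolynomial (Option (Fin n)) ℝ :=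
  Sum.elim
    (fun u => monomial (base u) 1 * rename some (pderiv (jj u) φ))
    (fun v => monomial v.1 1 * rename some φ)

lemma g0_inl (n q W W' : ℕ) (u : NR n q W) : g0 n q W W' (Sum.inl u) =
    ((q : ℝ) + 2) • (monomial u.1 (1 : ℝ) -
      monomial (base u + Finsupp.single (some (jj u)) 1 + Finsupp.single none 1) (1 : ℝ)) := by
  have h1 : (monomial u.1 (1 : ℝ)) = monomial (base u) 1 * X (some (jj u)) ^ (q + 1) := by
    rw [X_pow_eq_monomial, monomial_mul, base_add]; simp
  have h2 : monomial (base u + Finsupp.single (some (jj u)) 1 + Finsupp.single none 1) (1 : ℝ) =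
      monomial (base u) 1 * (X (some (jj u)) * X none) := by
    rw [X, X, monomial_mul, monomial_mul]; simp [add_assoc]
  rw [h1, h2, smul_eq_C_mul]
  simp only [g0, Sum.elim_inl]
  ring

noncomputable instance (n q W : ℕ) [h : NeZero q] : Fintype (NR n q W) :=
  ((wt_finite n q h.out W).subset (fun _ hu => hu.1)).fintype
noncomputable instance (n q W : ℕ) [h : NeZero q] : Fintype (RD n q W) :=
  ((wt_finite n q h.out W).subset (fun _ hu => hu.1)).fintype

lemma g0_linInd (n q W W' : ℕ) [hq : NeZero q] : LinearIndependent ℝ (g0 n q W W') := by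
  rw [Fintype.linearIndependent_iff]
  intro c hc
  rw [Fintype.sum_sum_type] at hc
  have hr : ∀ i, c (Sum.inr i) = 0 := by
    have h1 := congrArg (rho n q) hc
    rw [map_add, map_zero] at h1
    have h2 : rho n q (∑ u, c (Sum.inl u) • g0 n q W W' (Sum.inl u)) = 0 := by
      rw [map_sum]
      apply Finset.sum_eq_zero
      intro u _
      rw [map_smul, g0_inl, map_smul, map_sub, rho_monomial, rho_monomial,
        ← nf_step n q hq.out, base_add]
      simp
    rw [h2, zero_add] at h1
    exact rho_GG_inj n q hq.out (fun v : RD n q W' => v.1) Subtype.val_injective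
      (fun v => v.2.2) (fun v => c (Sum.inr v)) h1
  have hl : ∀ i, c (Sum.inl i) = 0 := by
    simp only [hr, zero_smul, Finset.sum_const_zero, add_zero, g0_inl, smul_smul] at hc
    have := tri_inj n q hq.out (fun u : NR n q W => u.1) (fun u => base u + Finsupp.single (some (jj u)) 1 + Finsupp.single none 1) Subtype.val_injective (by
        intro u
        have := congrArg (fun f => f none) (base_add u)
        simp at this
        simp [this]) _ hc
    intro i
    have h3 := this i
    have : (q : ℝ) + 2 ≠ 0 := by positivity
    simpa [this] using h3
  rintro (u | v)
  · exact hl u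
  · exact hr v

end CC
open MvPolynomial

namespace CC

lemma count_exists (n q W0 : ℕ) [hq : NeZero q] (hW0 : q + 2 ≤ W0) (s : ℕ)
    (hs : (q + 2) * (q + 1) ^ n < q * s) :
    ∃ W, W0 ≤ W ∧ Fintype.card (RD n q W) < Fintype.card (RD n q (W - (q + 2))) + s := by
  classical
  by_contra! hcon
  have hSfin : ∀ r : ℕ, {u : Ex n | (wt n q u ≤ W0 + r ∧ Red n q u) ∧
      ¬ wt n q u ≤ W0 + r - (q + 2)}.Finite := fun r =>
    (wt_finite n q hq.out (W0 + r)).subset (fun u hu => hu.1.1)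
  let S : ℕ → Finset (Ex n) := fun r => (hSfin r).toFinset
  have hS : ∀ r, s ≤ (S r).card := by
    intro r
    have h1 := hcon (W0 + r) (by omega)
    have h2 : Fintype.card (RD n q (W0 + r)) ≤
        Fintype.card (RD n q (W0 + r - (q + 2)) ⊕ S r) := by
      apply Fintype.card_le_of_injective (fun u : RD n q (W0 + r) =>
        if h : wt n q u.1 ≤ W0 + r - (q + 2) then
          (Sum.inl ⟨u.1, h, u.2.2⟩ : RD n q (W0 + r - (q + 2)) ⊕ S r)
        else Sum.inr ⟨u.1, by simp only [S, Set.Finite.mem_toFinset]; exact ⟨u.2, h⟩⟩)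
      intro u v huv
      dsimp only at huv
      split_ifs at huv
      · simpa [Subtype.ext_iff] using huv
      · simpa [Subtype.ext_iff] using huv
    rw [Fintype.card_sum, Fintype.card_coe] at h2
    omega
  have h3 : q * s ≤ Fintype.card (Σ r : Fin q, S r) := by
    rw [Fintype.card_sigma]
    calc q * s = ∑ _r : Fin q, s := by simp
      _ ≤ _ := Finset.sum_le_sum (fun r _ => by simpa using hS r)
  have hmem : ∀ (r : ℕ) (u : S r), (wt n q u.1 ≤ W0 + r ∧ Red n q u.1) ∧
      ¬ wt n q u.1 ≤ W0 + r - (q + 2) := by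
    intro r u
    have := u.2
    simp only [S, Set.Finite.mem_toFinset] at this
    exact this
  have h4 : Fintype.card (Σ r : Fin q, S r) ≤
      Fintype.card ((Fin n → Fin (q + 1)) × Fin (q + 2)) := by
    apply Fintype.card_le_of_injective (fun ru =>
      ((fun j => ⟨ru.2.1 (some j), Nat.lt_succ_of_le ((hmem _ ru.2).1.2 j)⟩),
        ⟨W0 + ru.1 - wt n q ru.2.1, by have := hmem _ ru.2; omega⟩))
    rintro ⟨r, u⟩ ⟨r', u'⟩ h
    simp only [Prod.mk.injEq, Fin.mk.injEq, _root_.funext_iff] at h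
    obtain ⟨ha, hb⟩ := h
    have hu := hmem _ u
    have hu' := hmem _ u'
    have e1 := wt_eq n q u.1
    have e2 := wt_eq n q u'.1
    have e3 : ∑ j, u.1 (some j) = ∑ j, u'.1 (some j) := Finset.sum_congr rfl (fun j _ => ha j)
    have h5 : (r : ℕ) + u'.1 none * q = r' + u.1 none * q := by omega
    have h6 : (r : ℕ) = r' := by
      have := congrArg (· % q) h5
      simp only [Nat.add_mul_mod_self_right] at this
      rwa [Nat.mod_eq_of_lt r.2, Nat.mod_eq_of_lt r'.2] at this
    have h7 : u'.1 none = u.1 none := by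
      have : u'.1 none * q = u.1 none * q := by omega
      exact Nat.eq_of_mul_eq_mul_right (Nat.pos_of_ne_zero hq.out) this
    have h8 : r = r' := Fin.ext h6
    subst h8
    have : u = u' := by
      apply Subtype.ext
      ext o
      rcases o with _ | j
      · exact h7.symm
      · exact ha j
    rw [this]
  have h5 : Fintype.card ((Fin n → Fin (q + 1)) × Fin (q + 2)) = (q + 1) ^ n * (q + 2) := by
    simp
  rw [h5] at h4
  have : (q + 1) ^ n * (q + 2) = (q + 2) * (q + 1) ^ n := mul_comm _ _
  omega

/-- polynomials of weighted degree at most `W` -/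
noncomputable def PW (n q W : ℕ) : Submodule ℝ (MvPolynomial (Option (Fin n)) ℝ) :=
  restrictSupport ℝ {u | wt n q u ≤ W}

lemma mem_PW {n q W : ℕ} {p : MvPolynomial (Option (Fin n)) ℝ} :
    p ∈ PW n q W ↔ ∀ u ∈ p.support, wt n q u ≤ W := by
  rw [PW, mem_restrictSupport_iff]
  rfl

lemma PW_mul {n q a b : ℕ} {p r : MvPolynomial (Option (Fin n)) ℝ} (hp : p ∈ PW n q a)
    (hr : r ∈ PW n q b) : p * r ∈ PW n q (a + b) := by
  classical
  rw [mem_PW] at *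
  intro u hu
  have := support_mul p r hu
  rw [Finset.mem_add] at this
  obtain ⟨v, hv, w, hw, rfl⟩ := this
  rw [map_add]
  exact add_le_add (hp v hv) (hr w hw)

lemma PW_mono {n q a b : ℕ} (h : a ≤ b) {p : MvPolynomial (Option (Fin n)) ℝ}
    (hp : p ∈ PW n q a) : p ∈ PW n q b := by
  rw [mem_PW] at *
  intro u hu
  exact (hp u hu).trans h

lemma PW_monomial {n q a : ℕ} (u : Ex n) (c : ℝ) (h : wt n q u ≤ a) :
    monomial u c ∈ PW n q a := by
  classical
  rw [mem_PW]
  intro v hv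
  have := support_monomial_subset hv
  rw [Finset.mem_singleton] at this
  rw [this]; exact h

lemma PW_C {n q a : ℕ} (c : ℝ) : C c ∈ PW n q a := by
  apply PW_monomial; simp

lemma PW_Xs {n q : ℕ} (j : Fin n) : X (some j) ∈ PW n q 1 := by
  apply PW_monomial; simp [wt, Finsupp.weight_single, wv]

lemma PW_Xn {n q : ℕ} : X none ∈ PW n q q := by
  apply PW_monomial; simp [wt, Finsupp.weight_single, wv]

lemma PW_pow {n q a : ℕ} {p : MvPolynomial (Option (Fin n)) ℝ} (hp : p ∈ PW n q a) (k : ℕ) :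
    p ^ k ∈ PW n q (k * a) := by
  induction k with
  | zero => rw [pow_zero]; exact PW_C 1
  | succ k ih => rw [pow_succ, Nat.succ_mul]; exact PW_mul ih hp

lemma PW_rename {n q a : ℕ} {p : MvPolynomial (Fin n) ℝ} (hp : p.totalDegree ≤ a) :
    rename some p ∈ PW n q a := by
  classical
  rw [mem_PW]
  intro u hu
  rw [support_rename_of_injective (Option.some_injective _), Finset.mem_image] at hu
  obtain ⟨v, hv, rfl⟩ := hu
  refine le_trans ?_ hp
  refine le_trans ?_ (le_totalDegree hv)
  rw [wt_eq]
  have h1 : (Finsupp.mapDomain some v) (none : Option (Fin n)) = 0 := by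
    apply Finsupp.mapDomain_of_notMem_range; simp
  have h2 : ∀ j, (Finsupp.mapDomain some v) (some j : Option (Fin n)) = v j := fun j =>
    Finsupp.mapDomain_apply (Option.some_injective _) _ _
  rw [h1]
  simp only [h2]
  rw [Finsupp.sum_fintype _ _ (by simp)]
  simp

lemma totalDegree_pderiv_le {n a : ℕ} (p : MvPolynomial (Fin n) ℝ) (hp : p.totalDegree ≤ a + 1)
    (j : Fin n) : (pderiv j p).totalDegree ≤ a := by
  classical
  rw [p.as_sum, map_sum]
  refine totalDegree_finsetSum_le ?_
  intro u hu
  rw [pderiv_monomial]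
  by_cases h0 : u j = 0
  · simp [h0]
  refine (totalDegree_monomial_le _ _).trans ?_
  have h1 := (le_totalDegree hu).trans hp
  have h2 : u = (u - Finsupp.single j 1) + Finsupp.single j 1 := by
    rw [tsub_add_cancel_of_le]
    rw [Finsupp.single_le_iff]; omega
  rw [h2, Finsupp.sum_add_index' (by simp) (by simp)] at h1
  rw [Finsupp.sum_single_index rfl] at h1
  have h3 : ((u - Finsupp.single j 1).sum fun _ => id) =
    ((u - Finsupp.single j 1).sum fun _ e => e) := rfl
  rw [h3]
  omega

lemma finrank_PW (n q W : ℕ) [hq : NeZero q] :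
    Module.finrank ℝ (PW n q W) = Fintype.card (NR n q W) + Fintype.card (RD n q W) := by
  classical
  have : Fintype {u : Ex n // wt n q u ≤ W} := (wt_finite n q hq.out W).fintype
  have h1 : Module.finrank ℝ (PW n q W) = Fintype.card {u : Ex n // wt n q u ≤ W} :=
    Module.finrank_eq_card_basis (basisRestrictSupport ℝ {u | wt n q u ≤ W})
  rw [h1, ← Fintype.card_sum]
  refine Fintype.card_congr ⟨fun u => if h : Red n q u.1 then Sum.inr ⟨u.1, u.2, h⟩
    else Sum.inl ⟨u.1, u.2, h⟩, fun v => v.elim (fun a => ⟨a.1, a.2.1⟩) (fun a => ⟨a.1, a.2.1⟩), ?_, ?_⟩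
  · intro u
    dsimp only
    split_ifs <;> rfl
  · rintro (v | v)
    · have := v.2.2; simp [this]
    · have := v.2.2; simp [this]

instance PW_fin (n q W : ℕ) [hq : NeZero q] : Module.Finite ℝ (PW n q W) := by
  have : Finite ↑{u : Ex n | wt n q u ≤ W} := (wt_finite n q hq.out W)
  exact Module.Finite.of_basis (basisRestrictSupport ℝ {u | wt n q u ≤ W})

lemma lagrange_mem {n q : ℕ} (Xs : Finset (Fin n → ℝ)) (x : Fin n → ℝ) :
    x ∉ Xs → ∃ L ∈ PW n q Xs.card, ∀ z : Option (Fin n) → ℝ,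
      ((fun j => z (some j)) = x → eval z L = 1) ∧ ((fun j => z (some j)) ∈ Xs → eval z L = 0) := by
  classical
  induction Xs using Finset.induction_on with
  | empty => intro _; exact ⟨1, PW_C 1, fun z => by simp⟩
  | insert y Ys hy ih =>
    intro hx
    rw [Finset.mem_insert, not_or] at hx
    obtain ⟨L, hL, hz⟩ := ih hx.2
    obtain ⟨j, hj⟩ := Function.ne_iff.1 hx.1
    refine ⟨L * (C (1 / (x j - y j)) * (X (some j) - C (y j))), ?_, ?_⟩
    · rw [Finset.card_insert_of_notMem hy]
      apply PW_mul hL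
      rw [← zero_add 1]
      exact PW_mul (PW_C _) (Submodule.sub_mem _ (PW_Xs j) (PW_C _))
    · intro z
      refine ⟨fun h => ?_, fun h => ?_⟩
      · have h1 := (hz z).1 h
        have h2 : z (some j) = x j := congrFun h j
        simp only [map_mul, map_sub, eval_C, eval_X, h1, h2]
        field_simp [sub_ne_zero.2 hj]
      · rw [Finset.mem_insert] at h
        rcases h with h | h
        · have h2 : z (some j) = y j := congrFun h j
          simp [h2]
        · simp [(hz z).2 h]


/-- critical points of `sum x_j^2` on `F = 0` -/
def Crit {n : ℕ} (F : MvPolynomial (Fin n) ℝ) (x : Fin n → ℝ) : Prop :=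
  eval x F = 0 ∧ ∃ l : ℝ, ∀ j, eval x (pderiv j F) = l * x j

lemma totalDegree_GG (n q : ℕ) : (GG n q).totalDegree ≤ q + 2 := by
  unfold GG
  refine (totalDegree_sub _ _).trans ?_
  apply max_le
  · refine totalDegree_finsetSum_le ?_
    intro j _
    rw [totalDegree_X_pow]
  · simp

lemma pderiv_GG (n q : ℕ) (j : Fin n) : pderiv j (GG n q) = C ((q : ℝ) + 2) * X j ^ (q + 1) := by
  classical
  unfold GG
  rw [map_sub, map_sum, Finset.sum_eq_single j]
  · rw [pderiv_pow, pderiv_X_self]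
    have : (C ((q : ℝ) + 2) : MvPolynomial (Fin n) ℝ) = ((q + 2 : ℕ) : MvPolynomial (Fin n) ℝ) := by
      rw [← map_natCast (C : ℝ →+* MvPolynomial (Fin n) ℝ)]; simp
    rw [this]
    simp
  · intro i _ hij
    rw [pderiv_pow, pderiv_X_of_ne hij]; simp
  · simp

lemma alg_bound (n q : ℕ) [hq : NeZero q] (φ : MvPolynomial (Fin n) ℝ)
    (hφ : φ.totalDegree ≤ q + 2) :
    {η : ℝ | ∃ Xs : Finset (Fin n → ℝ), (∀ x ∈ Xs, Crit (φ + C η * GG n q) x) ∧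
      (q + 2) * (q + 1) ^ n < q * Xs.card}.Finite := by
  classical
  have hqpos : 0 < q := Nat.pos_of_ne_zero hq.out
  set D := (q + 2) * (q + 1) ^ n with hD
  set s := D / q + 1 with hs
  have hDs : D < q * s := Nat.lt_mul_div_succ D hqpos
  obtain ⟨W, hW0, hW⟩ := count_exists n q (s + q + 2) (by linarith [Nat.zero_le s]) s hDs
  set W' := W - (q + 2) with hW'
  have hfin := linInd_perturb (g0 n q W W') (g1 n q W W' φ) (g0_linInd n q W W')
  refine ((hfin.image (fun t => t⁻¹)).insert 0).subset ?_
  rintro η ⟨Xs, hX, hcard⟩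
  rw [Set.mem_insert_iff, or_iff_not_imp_left]
  intro hη
  refine ⟨η⁻¹, ?_, inv_inv η⟩
  intro hli
  have hsX : s ≤ Xs.card := by
    rw [hs]
    exact (Nat.div_lt_iff_lt_mul hqpos).2 (by rwa [mul_comm])
  obtain ⟨Y, hYX, hYs⟩ := Finset.exists_subset_card_eq hsX
  have hY : ∀ x : Y, ∃ l : ℝ, ∀ j, eval x.1 (pderiv j (φ + C η * GG n q)) = l * x.1 j :=
    fun x => (hX x.1 (hYX x.2)).2
  choose l hl using hY
  let z : Y → Option (Fin n) → ℝ := fun x o => o.elim (l x * ((q + 2) * η)⁻¹) x.1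
  have hz : ∀ x : Y, (z x) ∘ some = x.1 := fun x => rfl
  have hzn : ∀ x : Y, (z x) none = l x * ((q + 2) * η)⁻¹ := fun x => rfl
  have hzs : ∀ (x : Y) j, (z x) (some j) = x.1 j := fun x j => rfl
  let ev : MvPolynomial (Option (Fin n)) ℝ →ₗ[ℝ] (Y → ℝ) :=
    LinearMap.pi (fun x => (aeval (z x)).toLinearMap)
  have hev : ∀ p x, ev p x = eval (z x) p := by
    intro p x
    simp [ev, aeval_eq_eval]
  have hq2 : (q : ℝ) + 2 ≠ 0 := by positivity
  -- the generators lie in `PW`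
  have hmem : ∀ i, g0 n q W W' i + η⁻¹ • g1 n q W W' φ i ∈ PW n q W := by
    rintro (u | v)
    · have hb := wt_base u
      have e1 : W = (W - (q + 1)) + (q + 1) := by omega
      apply Submodule.add_mem
      · simp only [g0, Sum.elim_inl]
        refine PW_mono e1.ge (PW_mul (PW_monomial _ _ (by omega)) ?_)
        refine PW_mono (zero_add (q + 1)).le (PW_mul (PW_C _) (Submodule.sub_mem _ ?_ ?_))
        · have := PW_pow (q := q) (PW_Xs (jj u)) (q + 1)
          rwa [mul_one] at this
        · exact PW_mul PW_Xn (PW_Xs (jj u))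
      · apply Submodule.smul_mem
        simp only [g1, Sum.elim_inl]
        refine PW_mono e1.ge (PW_mul (PW_monomial _ _ (by omega)) (PW_rename ?_))
        exact totalDegree_pderiv_le _ hφ _
    · have e1 : W = W' + (q + 2) := by omega
      apply Submodule.add_mem
      · simp only [g0, Sum.elim_inr]
        rw [e1]
        exact PW_mul (PW_monomial _ _ v.2.1) (PW_rename (totalDegree_GG n q))
      · apply Submodule.smul_mem
        simp only [g1, Sum.elim_inr]
        rw [e1]
        exact PW_mul (PW_monomial _ _ v.2.1) (PW_rename hφ)
  -- the generators vanish
  have hvan : ∀ i x, eval (z x) (g0 n q W W' i + η⁻¹ • g1 n q W W' φ i) = 0 := by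
    rintro (u | v) x
    · have h1 := hl x (jj u)
      simp only [map_add, pderiv_C_mul, pderiv_GG, smul_eq_C_mul, map_mul, eval_C, map_pow, eval_X] at h1
      simp only [g0, g1, Sum.elim_inl, smul_eq_C_mul, map_add, map_mul, eval_C, map_sub, map_pow,
        eval_X, eval_rename, hz, hzn, hzs]
      have h2 : eval x.1 (pderiv (jj u) φ) = l x * x.1 (jj u) -
        η * ((q + 2) * x.1 (jj u) ^ (q + 1)) := by linarith
      rw [h2]
      field_simp
      ring
    · have h1 := (hX x.1 (hYX x.2)).1
      simp only [map_add, map_mul, eval_C] at h1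
      simp only [g0, g1, Sum.elim_inr, smul_eq_C_mul, map_add, map_mul, eval_C, eval_rename, hz]
      have h2 : eval x.1 φ = - (η * eval x.1 (GG n q)) := by linarith
      rw [h2]
      field_simp
      ring
  let E : PW n q W →ₗ[ℝ] (Y → ℝ) := ev.comp (PW n q W).subtype
  have hsurj : Function.Surjective E := by
    intro w
    have hL : ∀ x : Y, ∃ L ∈ PW n q W, ∀ y : Y, eval (z y) L = if y = x then 1 else 0 := by
      intro x
      obtain ⟨L, hL, hLz⟩ := lagrange_mem (q := q) (Y.erase x.1) x.1 (by simp)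
      refine ⟨L, PW_mono ?_ hL, ?_⟩
      · have := Finset.card_erase_le (s := Y) (a := x.1); omega
      · intro y
        split_ifs with h
        · subst h
          exact (hLz (z y)).1 rfl
        · refine (hLz (z y)).2 ?_
          rw [Finset.mem_erase]
          exact ⟨fun h' => h (Subtype.ext h'), y.2⟩
    choose L hL1 hL2 using hL
    refine ⟨∑ x, w x • ⟨L x, hL1 x⟩, ?_⟩
    funext y
    have h1 : E (∑ x, w x • ⟨L x, hL1 x⟩) y = ∑ x, w x * ev (L x) y := by
      rw [map_sum, Finset.sum_apply]
      refine Finset.sum_congr rfl (fun x _ => ?_)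
      rw [map_smul]
      rfl
    rw [h1]
    simp only [hev, hL2]
    simp
  let gen : NR n q W ⊕ RD n q W' → LinearMap.ker E := fun i => ⟨⟨_, hmem i⟩, by
    rw [LinearMap.mem_ker]
    funext x
    simp only [E, LinearMap.comp_apply, hev, Submodule.subtype_apply]
    exact hvan i x⟩
  have hgen : LinearIndependent ℝ gen := by
    refine LinearIndependent.of_comp ((PW n q W).subtype.comp (LinearMap.ker E).subtype) ?_
    exact hli
  have hc := hgen.fintype_card_le_finrank
  have hrk := LinearMap.finrank_range_add_finrank_ker E
  rw [LinearMap.range_eq_top.2 hsurj, finrank_top, finrank_PW, Module.finrank_fintype_fun_eq_card,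
    Fintype.card_coe, hYs] at hrk
  rw [Fintype.card_sum] at hc
  omega

end CC
open MvPolynomial

namespace CC

lemma hasStrictFDerivAt_eval {N : ℕ} (p : MvPolynomial (Fin N) ℝ) (x : Fin N → ℝ) :
    HasStrictFDerivAt (fun y : Fin N → ℝ => eval y p)
      (∑ j, eval x (pderiv j p) • (ContinuousLinearMap.proj j : (Fin N → ℝ) →L[ℝ] ℝ)) x := by
  classical
  induction p using MvPolynomial.induction_on with
  | C a =>
    simp only [eval_C, pderiv_C, map_zero, zero_smul, Finset.sum_const_zero]
    exact hasStrictFDerivAt_const a x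
  | add p q hp hq =>
    simp only [map_add, add_smul, Finset.sum_add_distrib]
    exact hp.add hq
  | mul_X p i hp =>
    have h1 := hp.mul (hasStrictFDerivAt_apply (𝕜 := ℝ) (F' := fun _ : Fin N => ℝ) i x)
    simp only [map_mul, eval_X]
    refine h1.congr_fderiv ?_
    ext v
    simp only [Derivation.leibniz, pderiv_X, smul_eq_mul, map_add, map_mul, eval_X]
    simp [Pi.single_apply, apply_ite, add_mul, Finset.sum_add_distrib, Finset.mul_sum]
    refine Finset.sum_congr rfl (fun j _ => by ring)

/-- squared Euclidean norm -/
def hh {N : ℕ} (x : Fin N → ℝ) : ℝ := ∑ j, x j ^ 2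

noncomputable def hp (N : ℕ) : MvPolynomial (Fin N) ℝ := ∑ j, X j ^ 2

lemma eval_hp {N : ℕ} (x : Fin N → ℝ) : eval x (hp N) = hh x := by
  simp [hp, hh]

lemma pderiv_hp {N : ℕ} (j : Fin N) : pderiv j (hp N) = C 2 * X j := by
  classical
  unfold hp
  rw [map_sum, Finset.sum_eq_single j]
  · rw [pderiv_pow, pderiv_X_self]
    have : (C 2 : MvPolynomial (Fin N) ℝ) = 2 := by
      rw [← map_ofNat (C : ℝ →+* MvPolynomial (Fin N) ℝ) 2]
    rw [this]; simp
  · intro i _ hij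
    rw [pderiv_pow, pderiv_X_of_ne hij]; simp
  · simp

lemma continuous_hh {N : ℕ} : Continuous (hh : (Fin N → ℝ) → ℝ) := by
  unfold hh; fun_prop

lemma hh_nonneg {N : ℕ} (x : Fin N → ℝ) : 0 ≤ hh x := Finset.sum_nonneg (fun _ _ => sq_nonneg _)

lemma isCompact_ball {N : ℕ} (R : ℝ) : IsCompact {x : Fin N → ℝ | hh x ≤ R} := by
  refine Metric.isCompact_of_isClosed_isBounded (isClosed_le continuous_hh continuous_const) ?_
  rw [Metric.isBounded_iff_subset_closedBall 0]
  refine ⟨1 + R, ?_⟩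
  intro x hx
  rw [mem_closedBall_zero_iff]
  have hx' : hh x ≤ R := hx
  have h0 := hh_nonneg x
  rw [pi_norm_le_iff_of_nonneg (by linarith)]
  intro j
  have h1 : x j ^ 2 ≤ hh x :=
    Finset.single_le_sum (f := fun j => x j ^ 2) (fun _ _ => sq_nonneg _) (Finset.mem_univ j)
  rw [Real.norm_eq_abs, abs_le]
  constructor <;> nlinarith [sq_nonneg (x j - 1), sq_nonneg (x j + 1)]

lemma crit_of_extr {N : ℕ} (F : MvPolynomial (Fin N) ℝ) (x : Fin N → ℝ) (hx0 : x ≠ 0)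
    (hFx : eval x F = 0) (hext : IsLocalExtrOn hh {y | eval y F = eval x F} x) : Crit F x := by
  have h2 := hasStrictFDerivAt_eval (hp N) x
  simp only [eval_hp] at h2
  obtain ⟨a, b, hab, h3⟩ := IsLocalExtrOn.exists_multipliers_of_hasStrictFDerivAt_1d
    (f := fun y => eval y F) hext (hasStrictFDerivAt_eval F x) h2
  have h4 : ∀ j, a * eval x (pderiv j F) + b * (2 * x j) = 0 := by
    intro j
    have := DFunLike.congr_fun h3 (Pi.single j 1)
    simpa [Pi.single_apply, pderiv_hp] using this
  have ha : a ≠ 0 := by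
    rintro rfl
    have hb : b ≠ 0 := by
      rintro rfl; exact hab rfl
    apply hx0
    funext j
    have := h4 j
    simpa [hb] using this
  refine ⟨hFx, -(2 * b / a), fun j => ?_⟩
  have := h4 j
  field_simp
  linarith

lemma extr_aux {N : ℕ} (F : MvPolynomial (Fin N) ℝ) (R : ℝ) (U : Set (Fin N → ℝ)) (hU : IsOpen U)
    (h0 : eval 0 F ≠ 0) (x : Fin N → ℝ) (hxR : hh x < R) (hxU : x ∈ U) (hFx : eval x F = 0)
    (hext : (∀ y ∈ U, eval y F = 0 → hh y ≤ R → hh x ≤ hh y) ∨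
      (∀ y ∈ U, eval y F = 0 → hh y ≤ R → hh y ≤ hh x)) : Crit F x := by
  apply crit_of_extr F x _ hFx
  · have hnh : U ∩ {y | hh y < R} ∈ nhds x :=
      (hU.inter (isOpen_lt continuous_hh continuous_const)).mem_nhds ⟨hxU, hxR⟩
    rcases hext with h | h
    · left
      refine Filter.mem_of_superset (inter_mem_nhdsWithin _ hnh) ?_
      rintro y ⟨hy, hyU, hyR⟩
      exact h y hyU (by rw [← hFx]; exact hy) (le_of_lt hyR)
    · right
      refine Filter.mem_of_superset (inter_mem_nhdsWithin _ hnh) ?_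
      rintro y ⟨hy, hyU, hyR⟩
      exact h y hyU (by rw [← hFx]; exact hy) (le_of_lt hyR)
  · rintro rfl
    exact h0 hFx

lemma one_crit {N : ℕ} (F : MvPolynomial (Fin N) ℝ) (R : ℝ) (U : Set (Fin N → ℝ)) (hU : IsOpen U)
    (h0 : eval 0 F ≠ 0) (hA : IsCompact {y | eval y F = 0 ∧ hh y ≤ R ∧ y ∈ U})
    (x : Fin N → ℝ) (hxR : hh x < R) (hxU : x ∈ U) (hFx : eval x F = 0) :
    ∃ y ∈ U, Crit F y := by
  obtain ⟨y, hy, hmin⟩ := hA.exists_isMinOn ⟨x, hFx, hxR.le, hxU⟩ continuous_hh.continuousOn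
  refine ⟨y, hy.2.2, extr_aux F R U hU h0 y ?_ hy.2.2 hy.1 (Or.inl ?_)⟩
  · exact lt_of_le_of_lt (hmin ⟨hFx, hxR.le, hxU⟩) hxR
  · intro z hzU hz hzR
    exact hmin ⟨hz, hzR, hzU⟩

lemma two_crit {N : ℕ} (F : MvPolynomial (Fin N) ℝ) (R : ℝ) (U : Set (Fin N → ℝ)) (hU : IsOpen U)
    (h0 : eval 0 F ≠ 0) (hA : IsCompact {y | eval y F = 0 ∧ hh y ≤ R ∧ y ∈ U})
    (hUR : ∀ y ∈ U, hh y < R)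
    (x x' : Fin N → ℝ) (hxU : x ∈ U) (hFx : eval x F = 0) (hxU' : x' ∈ U) (hFx' : eval x' F = 0)
    (hne : x ≠ x') :
    ∃ y ∈ U, ∃ y' ∈ U, y ≠ y' ∧ Crit F y ∧ Crit F y' := by
  have hxA : x ∈ {y | eval y F = 0 ∧ hh y ≤ R ∧ y ∈ U} := ⟨hFx, (hUR x hxU).le, hxU⟩
  have hxA' : x' ∈ {y | eval y F = 0 ∧ hh y ≤ R ∧ y ∈ U} := ⟨hFx', (hUR x' hxU').le, hxU'⟩
  obtain ⟨y, hy, hmin⟩ := hA.exists_isMinOn ⟨x, hxA⟩ continuous_hh.continuousOn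
  obtain ⟨z, hz, hmax⟩ := hA.exists_isMaxOn ⟨x, hxA⟩ continuous_hh.continuousOn
  by_cases hyz : y = z
  · subst hyz
    have hc : ∀ w ∈ {y | eval y F = 0 ∧ hh y ≤ R ∧ y ∈ U}, hh w = hh y := fun w hw =>
      le_antisymm (hmax hw) (hmin hw)
    refine ⟨x, hxU, x', hxU', hne, ?_, ?_⟩
    · refine extr_aux F R U hU h0 x (hUR x hxU) hxU hFx (Or.inl ?_)
      intro w hwU hw hwR
      rw [hc x hxA, hc w ⟨hw, hwR, hwU⟩]
    · refine extr_aux F R U hU h0 x' (hUR x' hxU') hxU' hFx' (Or.inl ?_)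
      intro w hwU hw hwR
      rw [hc x' hxA', hc w ⟨hw, hwR, hwU⟩]
  · refine ⟨y, hy.2.2, z, hz.2.2, hyz, ?_, ?_⟩
    · exact extr_aux F R U hU h0 y (hUR y hy.2.2) hy.2.2 hy.1
        (Or.inl fun w hwU hw hwR => hmin ⟨hw, hwR, hwU⟩)
    · exact extr_aux F R U hU h0 z (hUR z hz.2.2) hz.2.2 hz.1
        (Or.inr fun w hwU hw hwR => hmax ⟨hw, hwR, hwU⟩)

lemma eq_zero_of_open {N : ℕ} (p : MvPolynomial (Fin N) ℝ) (x : Fin N → ℝ)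
    (h : ∀ᶠ y in nhds x, eval y p = 0) : p = 0 := by
  obtain ⟨r, hr, hb⟩ := Metric.eventually_nhds_iff_ball.1 h
  refine MvPolynomial.funext_set (fun j => Metric.ball (x j) r) (fun j => ?_) ?_
  · rw [Real.ball_eq_Ioo]
    exact Set.Ioo_infinite (by linarith)
  · intro y hy
    rw [map_zero]
    apply hb
    rw [ball_pi _ hr]
    simpa using hy

lemma totalDegree_hp (N : ℕ) : (hp N).totalDegree ≤ 2 := by
  refine totalDegree_finsetSum_le ?_
  intro j _
  rw [totalDegree_X_pow]

end CC
open MvPolynomial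

namespace CC

lemma preconn_bdry {α : Type*} [TopologicalSpace α] {s W : Set α} (hs : IsPreconnected s)
    (hW : IsOpen W) {a b : α} (ha : a ∈ s) (haW : a ∈ W) (hb : b ∈ s) (hbW : b ∉ W) :
    ∃ x ∈ s, x ∈ closure W ∧ x ∉ W := by
  by_contra! hcon
  have h1 : s ⊆ W ∪ (closure W)ᶜ := by
    intro x hx
    by_cases h : x ∈ closure W
    · exact Or.inl (hcon x hx h)
    · exact Or.inr h
  obtain ⟨x, _, hx1, hx2⟩ := hs W (closure W)ᶜ hW isClosed_closure.isOpen_compl h1 ⟨a, ha, haW⟩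
    ⟨b, hb, fun h => hbW (hcon b hb h)⟩
  exact hx2 (subset_closure hx1)

lemma ray_point {N : ℕ} (F : MvPolynomial (Fin N) ℝ) (U : Set (Fin N → ℝ)) (hU : IsOpen U)
    (hbd : ∀ y ∈ closure U, y ∉ U → 0 < eval y F) (p v : Fin N → ℝ) (hpU : p ∈ U)
    (hFp : eval p F < 0) (hv : ∃ s : ℝ, 0 ≤ s ∧ p + s • v ∉ U) :
    ∃ s : ℝ, 0 < s ∧ p + s • v ∈ U ∧ eval (p + s • v) F = 0 := by
  obtain ⟨s1, hs1, hs1U⟩ := hv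
  let γ : ℝ → (Fin N → ℝ) := fun s => p + s • v
  have hγ : Continuous γ := by fun_prop
  have hcF : Continuous (fun y => eval y F) := MvPolynomial.continuous_eval F
  have hW : IsOpen (U ∩ {y | eval y F < 0}) := hU.inter (isOpen_lt hcF continuous_const)
  obtain ⟨x, ⟨s, hs, rfl⟩, hx1, hx2⟩ := preconn_bdry (s := γ '' Set.Ici 0)
    ((isPreconnected_Ici).image γ hγ.continuousOn) hW
    (a := p) (b := p + s1 • v) ⟨0, by simp, by simp [γ]⟩ ⟨hpU, hFp⟩ ⟨s1, hs1, rfl⟩ (fun h => hs1U h.1)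
  have hs' : (0 : ℝ) ≤ s := hs
  have hc1 : γ s ∈ closure U := closure_mono Set.inter_subset_left hx1
  have hc2 : eval (γ s) F ≤ 0 := by
    have h1 : closure (U ∩ {y | eval y F < 0}) ⊆ {y | eval y F ≤ 0} := by
      apply closure_minimal _ (isClosed_le hcF continuous_const)
      rintro y ⟨_, hy⟩
      have hy' : eval y F < 0 := hy
      exact hy'.le
    exact h1 hx1
  have hsU : γ s ∈ U := by
    by_contra h
    linarith [hbd _ hc1 h]
  have hs0 : eval (γ s) F = 0 := by
    by_contra h
    exact hx2 ⟨hsU, lt_of_le_of_ne hc2 h⟩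
  refine ⟨s, ?_, hsU, hs0⟩
  rcases hs'.eq_or_lt with h | h
  · subst h
    simp [γ] at hs0
    linarith
  · exact h

lemma two_points {N : ℕ} (j0 : Fin N) (F : MvPolynomial (Fin N) ℝ) (U : Set (Fin N → ℝ))
    (hU : IsOpen U) (R : ℝ) (hUR : ∀ y ∈ U, hh y < R)
    (hbd : ∀ y ∈ closure U, y ∉ U → 0 < eval y F) (p : Fin N → ℝ) (hpU : p ∈ U)
    (hFp : eval p F < 0) :
    ∃ x x', x ∈ U ∧ x' ∈ U ∧ eval x F = 0 ∧ eval x' F = 0 ∧ x ≠ x' := by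
  have hR : 0 < R := lt_of_le_of_lt (hh_nonneg p) (hUR p hpU)
  have key : ∀ e : ℝ, e = 1 ∨ e = -1 → ∃ s : ℝ, 0 ≤ s ∧ p + s • (fun _ => e) ∉ U := by
    intro e he
    refine ⟨|p j0| + R + 1, by positivity, fun h => ?_⟩
    have h1 := hUR _ h
    set w : Fin N → ℝ := p + (|p j0| + R + 1) • (fun _ => e) with hw
    have h2 : w j0 ^ 2 ≤ hh w :=
      Finset.single_le_sum (f := fun j => w j ^ 2)
        (fun _ _ => sq_nonneg _) (Finset.mem_univ j0)
    have h5 : w j0 = p j0 + (|p j0| + R + 1) * e := by simp [hw]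
    rw [h5] at h2
    have h3 := le_abs_self (p j0)
    have h4 := neg_abs_le (p j0)
    rcases he with rfl | rfl <;> nlinarith
  obtain ⟨s, hs, h1, h2⟩ := ray_point F U hU hbd p (fun _ => 1) hpU hFp (key 1 (Or.inl rfl))
  obtain ⟨s', hs', h1', h2'⟩ := ray_point F U hU hbd p (fun _ => -1) hpU hFp (key (-1) (Or.inr rfl))
  refine ⟨_, _, h1, h1', h2, h2', fun h => ?_⟩
  have := congrFun h j0
  simp only [Pi.add_apply, Pi.smul_apply, smul_eq_mul] at this
  linarith

def Adh {N : ℕ} (g : MvPolynomial (Fin N) ℝ) (Z : Set (Fin N → ℝ)) (R : ℝ) : Prop :=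
  ∃ p ∈ Z, hh p < R ∧ p ∈ closure {x | 0 < eval x g}

open Classical in
noncomputable def cc {N : ℕ} {ι : Type} (g : MvPolynomial (Fin N) ℝ) (Z : ι → Set (Fin N → ℝ)) (R : ℝ)
    (T : Finset ι) (i : ι) : ℕ :=
  if ¬ Adh g (Z i) R then 0 else if i ∈ T ∧ ¬ Adh (-g) (Z i) R then 2 else 1

lemma sep_nhds {N : ℕ} {ι : Type} [Fintype ι] (Z : ι → Set (Fin N → ℝ)) (hcl : ∀ i, IsClosed (Z i))
    (hne : ∀ i, (Z i).Nonempty) (hdis : ∀ i j, i ≠ j → Disjoint (Z i) (Z j)) :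
    ∃ V : ι → Set (Fin N → ℝ), (∀ i, IsOpen (V i)) ∧ (∀ i, Z i ⊆ V i) ∧
      ∀ i j, i ≠ j → Disjoint (V i) (V j) := by
  refine ⟨fun i => {x | ∀ j, j ≠ i → Metric.infDist x (Z i) < Metric.infDist x (Z j)}, ?_, ?_, ?_⟩
  · intro i
    simp only [Set.ofPred_forall]
    refine isOpen_iInter_of_finite (fun j => isOpen_iInter_of_finite (fun _ => ?_))
    exact isOpen_lt (Metric.continuous_infDist_pt _) (Metric.continuous_infDist_pt _)
  · intro i x hx j hj
    rw [Metric.infDist_zero_of_mem hx]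
    rw [← (hcl j).notMem_iff_infDist_pos (hne j)]
    exact fun h => Set.disjoint_left.1 (hdis j i hj) h hx
  · intro i j hij
    rw [Set.disjoint_left]
    intro x hx hx'
    exact lt_asymm (hx j hij.symm) (hx' i hij)

lemma lens_one {N : ℕ} (j0 : Fin N) (q : ℕ) [hq : NeZero q] (g : MvPolynomial (Fin N) ℝ)
    (hdeg : g.totalDegree ≤ q + 2) {ι : Type} [Fintype ι] (Z : ι → Set (Fin N → ℝ))
    (hcl : ∀ i, IsClosed (Z i)) (hne : ∀ i, (Z i).Nonempty)
    (hdis : ∀ i j, i ≠ j → Disjoint (Z i) (Z j))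
    (hZ : ∀ x, eval x g = 0 ↔ ∃ i, x ∈ Z i) (R : ℝ) (hR : 0 < R) (T : Finset ι)
    (hT : ∀ i ∈ T, ∀ x ∈ Z i, hh x ≠ R) :
    q * ∑ i, cc g Z R T i ≤ (q + 2) * (q + 1) ^ N := by
  classical
  have hcg : Continuous (fun y => eval y g) := MvPolynomial.continuous_eval g
  obtain ⟨V, hVo, hZV, hVd⟩ := sep_nhds Z hcl hne hdis
  -- the special indices
  let P : ι → Prop := fun i => i ∈ T ∧ ¬ Adh (-g) (Z i) R
  let O : ι → Set (Fin N → ℝ) := fun i =>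
    if P i then {y | hh y < R} ∩ (closure {x | 0 < eval x (-g)})ᶜ else Set.univ
  have hO1 : ∀ i, P i → O i = {y | hh y < R} ∩ (closure {x | 0 < eval x (-g)})ᶜ := by
    intro i hi; simp only [O, if_pos hi]
  have hOo : ∀ i, IsOpen (O i) := by
    intro i
    simp only [O]
    split_ifs
    · exact (isOpen_lt continuous_hh continuous_const).inter isClosed_closure.isOpen_compl
    · exact isOpen_univ
  let U : ι → Set (Fin N → ℝ) := fun i => V i ∩ O i
  have hUo : ∀ i, IsOpen (U i) := fun i => (hVo i).inter (hOo i)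
  have hUd : ∀ i j, i ≠ j → Disjoint (U i) (U j) := fun i j hij =>
    (hVd i j hij).mono Set.inter_subset_left Set.inter_subset_left
  have hZU : ∀ i, ∀ x ∈ Z i, hh x ≤ R → x ∈ U i := by
    intro i x hx hxR
    refine ⟨hZV i hx, ?_⟩
    simp only [O]
    split_ifs with hP
    · have hlt : hh x < R := lt_of_le_of_ne hxR (hT i hP.1 x hx)
      exact ⟨hlt, fun h => hP.2 ⟨x, hx, hlt, h⟩⟩
    · trivial
  have hUR : ∀ i, P i → ∀ y ∈ U i, hh y < R := by
    intro i hP y hy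
    have := hy.2
    rw [hO1 i hP] at this
    exact this.1
  have hUg : ∀ i, P i → ∀ y ∈ U i, 0 ≤ eval y g := by
    intro i hP y hy
    have := hy.2
    rw [hO1 i hP] at this
    by_contra h
    refine this.2 (subset_closure ?_)
    simp only [Set.mem_ofPred_eq, map_neg]
    linarith
  -- lower bound off the neighbourhoods
  have hBc : IsCompact {x : Fin N → ℝ | hh x ≤ R} := isCompact_ball R
  have hoff : IsCompact ({x : Fin N → ℝ | hh x ≤ R} \ ⋃ i, U i) :=
    hBc.diff (isOpen_iUnion hUo)
  obtain ⟨μ, hμ, hμb⟩ := hoff.exists_forall_le' (f := fun y => |eval y g|) hcg.abs.continuousOn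
    (a := 0) (by
      intro b hb
      rw [abs_pos]
      intro h
      obtain ⟨i, hi⟩ := (hZ b).1 h
      exact hb.2 (Set.mem_iUnion.2 ⟨i, hZU i b hi hb.1⟩))
  -- witnesses
  have hwit : ∀ i, Adh g (Z i) R → ∃ p p' : Fin N → ℝ, p ∈ Z i ∧ hh p < R ∧
      segment ℝ p p' ⊆ U i ∩ {y | hh y < R} ∧ 0 < eval p' g := by
    rintro i ⟨p, hp, hpR, hpc⟩
    have hop : IsOpen (U i ∩ {y | hh y < R}) :=
      (hUo i).inter (isOpen_lt continuous_hh continuous_const)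
    obtain ⟨r, hr, hb⟩ := Metric.isOpen_iff.1 hop p ⟨hZU i p hp hpR.le, hpR⟩
    obtain ⟨p', hp', hpd⟩ := Metric.mem_closure_iff.1 hpc r hr
    refine ⟨p, p', hp, hpR, ?_, hp'⟩
    refine Set.Subset.trans ?_ hb
    exact (convex_ball p r).segment_subset (Metric.mem_ball_self hr)
      (by rw [Metric.mem_ball, dist_comm]; exact hpd)
  choose! p p' hpZ hpR hseg hp' using hwit
  -- choose `eps`
  obtain ⟨M, hM⟩ := hBc.exists_bound_of_continuousOn
    (f := fun y => eval y (GG N q)) (MvPolynomial.continuous_eval _).continuousOn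
  have hex : ∀ᶠ ε in nhdsWithin (0 : ℝ) (Set.Ioi 0), 0 < ε ∧ 2 * ε < μ ∧
      ∀ i, Adh g (Z i) R → 2 * ε < eval (p' i) g := by
    have hlim : Filter.Tendsto (fun ε : ℝ => 2 * ε) (nhdsWithin (0 : ℝ) (Set.Ioi 0)) (nhds 0) := by
      have : Filter.Tendsto (fun ε : ℝ => 2 * ε) (nhds 0) (nhds (2 * 0)) :=
        (continuous_const.mul continuous_id).tendsto 0
      rw [mul_zero] at this
      exact this.mono_left nhdsWithin_le_nhds
    have hpos0 : ∀ᶠ t in nhdsWithin (0 : ℝ) (Set.Ioi 0), 0 < t := self_mem_nhdsWithin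
    refine hpos0.and ((hlim.eventually_lt_const hμ).and ?_)
    rw [Filter.eventually_all]
    intro i
    by_cases h : Adh g (Z i) R
    · filter_upwards [hlim.eventually_lt_const (hp' i h)] with ε hε _
      exact hε
    · filter_upwards with ε hε
      exact absurd hε h
  obtain ⟨ε, hε, hεμ, hεp⟩ := hex.exists
  set φ : MvPolynomial (Fin N) ℝ := g - C ε * (1 - C R⁻¹ * hp N) with hφ
  have hφd : φ.totalDegree ≤ q + 2 := by
    refine (totalDegree_sub _ _).trans (max_le hdeg ?_)
    refine (totalDegree_mul _ _).trans ?_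
    rw [totalDegree_C, zero_add]
    refine (totalDegree_sub _ _).trans (max_le (by simp) ?_)
    refine (totalDegree_mul _ _).trans ?_
    rw [totalDegree_C, zero_add]
    have := totalDegree_hp N
    omega
  have hbad := alg_bound N q φ hφd
  have hey : ∀ᶠ η in nhdsWithin (0 : ℝ) (Set.Ioi 0), 0 < η ∧ η * M < ε ∧
      (∀ i, Adh g (Z i) R → η * M < ε * (1 - R⁻¹ * hh (p i))) ∧
      η ∉ ({η : ℝ | ∃ Xs : Finset (Fin N → ℝ), (∀ x ∈ Xs, Crit (φ + C η * GG N q) x) ∧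
        (q + 2) * (q + 1) ^ N < q * Xs.card} ∪ {eval 0 φ / (- eval 0 (GG N q))}) := by
    have hlim : Filter.Tendsto (fun η : ℝ => η * M) (nhdsWithin (0 : ℝ) (Set.Ioi 0)) (nhds 0) := by
      have : Filter.Tendsto (fun η : ℝ => η * M) (nhds 0) (nhds (0 * M)) :=
        (continuous_id.mul continuous_const).tendsto 0
      rw [zero_mul] at this
      exact this.mono_left nhdsWithin_le_nhds
    have hpos0 : ∀ᶠ t in nhdsWithin (0 : ℝ) (Set.Ioi 0), 0 < t := self_mem_nhdsWithin
    refine hpos0.and ((hlim.eventually_lt_const hε).and (.and ?_ ?_))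
    · rw [Filter.eventually_all]
      intro i
      by_cases h : Adh g (Z i) R
      · have hpos : 0 < ε * (1 - R⁻¹ * hh (p i)) := by
          apply mul_pos hε
          have := hpR i h
          rw [sub_pos, inv_mul_lt_one₀ hR]
          exact this
        filter_upwards [hlim.eventually_lt_const hpos] with η hη _
        exact hη
      · filter_upwards with η hη
        exact absurd hη h
    · have hf := (hbad.union (Set.finite_singleton (eval 0 φ / (- eval 0 (GG N q)))))
      have h1 := (hf.subset (Set.sdiff_subset (t := {0}))).isClosed.isOpen_compl.mem_nhds
        (x := (0 : ℝ)) (by simp)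
      filter_upwards [self_mem_nhdsWithin, mem_nhdsWithin_of_mem_nhds h1] with η hη h2 h3
      exact h2 ⟨h3, ne_of_gt hη⟩
  obtain ⟨η, hη, hηM, hηp, hηbad⟩ := hey.exists
  rw [Set.mem_union, not_or] at hηbad
  set F := φ + C η * GG N q with hF
  have hFe : ∀ y, eval y F = eval y g - ε * (1 - R⁻¹ * hh y) + η * eval y (GG N q) := by
    intro y
    simp [hF, hφ, eval_hp]
  have hF0 : eval 0 F ≠ 0 := by
    intro h
    apply hηbad.2
    have h1 : eval 0 (GG N q) = -1 := by simp [GG]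
    rw [hF, map_add, map_mul, eval_C, h1] at h
    rw [Set.mem_singleton_iff, h1]
    linarith
  have hFg : ∀ y, hh y ≤ R → |eval y F - eval y g| < 2 * ε := by
    intro y hy
    have h1 := hM y hy
    rw [Real.norm_eq_abs] at h1
    have h2 : 0 ≤ R⁻¹ * hh y := mul_nonneg (inv_nonneg.2 hR.le) (hh_nonneg y)
    have h3 : R⁻¹ * hh y ≤ 1 := by rw [inv_mul_le_one₀ hR]; exact hy
    have h4 : |η * eval y (GG N q)| ≤ η * M := by
      rw [abs_mul, abs_of_pos hη]; exact mul_le_mul_of_nonneg_left h1 hη.le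
    rw [hFe, abs_lt]
    rw [abs_le] at h4
    constructor <;> nlinarith
  have hcF : Continuous (fun y => eval y F) := MvPolynomial.continuous_eval F
  have hFU : ∀ y, hh y ≤ R → eval y F = 0 → ∃ i, y ∈ U i := by
    intro y hy h0
    by_contra hcon
    have h1 := hμb y ⟨hy, fun h => hcon (Set.mem_iUnion.1 h)⟩
    have h2 := hFg y hy
    rw [h0, zero_sub, abs_neg] at h2
    linarith
  have hA : ∀ i, IsCompact {y | eval y F = 0 ∧ hh y ≤ R ∧ y ∈ U i} := by
    intro i
    have : {y | eval y F = 0 ∧ hh y ≤ R ∧ y ∈ U i} =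
        {y | hh y ≤ R} ∩ ({y | eval y F = 0} ∩ (⋃ j, ⋃ (_ : j ≠ i), U j)ᶜ) := by
      ext y
      simp only [Set.mem_ofPred_eq, Set.mem_inter_iff, Set.mem_compl_iff, Set.mem_iUnion, not_exists]
      constructor
      · rintro ⟨h1, h2, h3⟩
        exact ⟨h2, h1, fun j hj h4 => Set.disjoint_left.1 (hUd j i hj) h4 h3⟩
      · rintro ⟨h1, h2, h3⟩
        obtain ⟨j, hj⟩ := hFU y h1 h2
        refine ⟨h2, h1, ?_⟩
        by_cases hji : j = i
        · rwa [← hji]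
        · exact absurd hj (h3 j hji)
    rw [this]
    refine hBc.inter_right ((isClosed_eq hcF continuous_const).inter ?_)
    exact (isOpen_iUnion fun j => isOpen_iUnion fun _ => hUo j).isClosed_compl
  have hFp : ∀ i, Adh g (Z i) R → eval (p i) F < 0 := by
    intro i hi
    have h1 := hM (p i) (hpR i hi).le
    rw [Real.norm_eq_abs] at h1
    have h2 : eval (p i) g = 0 := (hZ _).2 ⟨i, hpZ i hi⟩
    have h3 := hηp i hi
    rw [hFe, h2]
    have := mul_le_mul_of_nonneg_left ((le_abs_self _).trans h1) hη.le
    linarith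
  have hY : ∀ i, ∃ Y : Finset (Fin N → ℝ), (∀ y ∈ Y, y ∈ U i ∧ Crit F y) ∧ Y.card = cc g Z R T i := by
    intro i
    by_cases hi : Adh g (Z i) R
    · have hcc : cc g Z R T i = if i ∈ T ∧ ¬ Adh (-g) (Z i) R then 2 else 1 := by
        simp only [cc, hi, not_true, if_false]
      by_cases hP : P i
      · rw [if_pos hP] at hcc
        have hpU : p i ∈ U i := hZU i _ (hpZ i hi) (hpR i hi).le
        have hbd : ∀ y ∈ closure (U i), y ∉ U i → 0 < eval y F := by
          intro y hy hyU
          have hg0 : 0 ≤ eval y g := by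
            have : closure (U i) ⊆ {y | 0 ≤ eval y g} :=
              closure_minimal (hUg i hP) (isClosed_le continuous_const hcg)
            exact this hy
          have hyR : hh y ≤ R := by
            have : closure (U i) ⊆ {y | hh y ≤ R} :=
              closure_minimal (fun z hz => (hUR i hP z hz).le) (isClosed_le continuous_hh continuous_const)
            exact this hy
          have hyn : y ∉ ⋃ j, U j := by
            rw [Set.mem_iUnion]
            rintro ⟨j, hj⟩
            have hji : j ≠ i := by rintro rfl; exact hyU hj
            obtain ⟨z, hz1, hz2⟩ := mem_closure_iff.1 hy (U j) (hUo j) hj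
            exact Set.disjoint_left.1 (hUd j i hji) hz1 hz2
          have h1 := hμb y ⟨hyR, hyn⟩
          have h2 := hFg y hyR
          simp only [abs_of_nonneg hg0] at h1
          rw [abs_lt] at h2
          linarith
        obtain ⟨x, x', hx, hx', hFx, hFx', hxx⟩ :=
          two_points j0 F (U i) (hUo i) R (hUR i hP) hbd (p i) hpU (hFp i hi)
        obtain ⟨y, hy, y', hy', hyy, hc, hc'⟩ :=
          two_crit F R (U i) (hUo i) hF0 (hA i) (hUR i hP) x x' hx hFx hx' hFx' hxx
        refine ⟨{y, y'}, ?_, ?_⟩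
        · intro z hz
          rw [Finset.mem_insert, Finset.mem_singleton] at hz
          rcases hz with rfl | rfl
          · exact ⟨hy, hc⟩
          · exact ⟨hy', hc'⟩
        · rw [hcc, Finset.card_pair hyy]
      · rw [if_neg hP] at hcc
        have hFp' : 0 < eval (p' i) F := by
          have h1 := hFg (p' i) (hseg i hi (right_mem_segment ℝ _ _)).2.le
          have h2 := hεp i hi
          rw [abs_lt] at h1
          linarith
        obtain ⟨x, hx, hFx⟩ := (convex_segment (𝕜 := ℝ) (p i) (p' i)).isPreconnected.intermediate_value₂
          (left_mem_segment ℝ _ _) (right_mem_segment ℝ _ _) hcF.continuousOn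
          (continuousOn_const (c := (0 : ℝ))) (hFp i hi).le hFp'.le
        have hxs := hseg i hi hx
        obtain ⟨y, hy, hc⟩ := one_crit F R (U i) (hUo i) hF0 (hA i) x hxs.2 hxs.1 hFx
        refine ⟨{y}, ?_, ?_⟩
        · intro z hz
          rw [Finset.mem_singleton] at hz
          subst hz
          exact ⟨hy, hc⟩
        · rw [hcc, Finset.card_singleton]
    · exact ⟨∅, by simp, by simp [cc, hi]⟩
  choose Y hY1 hY2 using hY
  have hcard : (Finset.univ.biUnion Y).card = ∑ i, cc g Z R T i := by
    rw [Finset.card_biUnion]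
    · exact Finset.sum_congr rfl (fun i _ => hY2 i)
    · intro i _ j _ hij
      rw [Function.onFun, Finset.disjoint_left]
      intro y hy hy'
      exact Set.disjoint_left.1 (hUd i j hij) (hY1 i y hy).1 (hY1 j y hy').1
  have hfinal := hηbad.1
  simp only [Set.mem_ofPred_eq, not_exists, not_and, not_lt] at hfinal
  rw [← hcard]
  apply hfinal
  intro y hy
  rw [Finset.mem_biUnion] at hy
  obtain ⟨i, _, hi⟩ := hy
  exact (hY1 i y hi).2

lemma lens {N : ℕ} (j0 : Fin N) (q : ℕ) [hq : NeZero q] (f : MvPolynomial (Fin N) ℝ) (hf : f ≠ 0)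
    (hdeg : f.totalDegree ≤ q + 2) {ι : Type} [Fintype ι] (Z : ι → Set (Fin N → ℝ))
    (hcl : ∀ i, IsClosed (Z i))
    (hdis : ∀ i j, i ≠ j → Disjoint (Z i) (Z j))
    (hZ : ∀ x, eval x f = 0 ↔ ∃ i, x ∈ Z i) (R : ℝ) (hR : 0 < R)
    (hne : ∀ i, ∃ p ∈ Z i, hh p < R) (T : Finset ι)
    (hT : ∀ i ∈ T, ∀ x ∈ Z i, hh x ≠ R) :
    q * (Fintype.card ι + T.card) ≤ 2 * ((q + 2) * (q + 1) ^ N) := by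
  classical
  have hne' : ∀ i, (Z i).Nonempty := fun i => ⟨_, (hne i).choose_spec.1⟩
  have h1 := lens_one j0 q f hdeg Z hcl hne' hdis hZ R hR T hT
  have h2 := lens_one j0 q (-f) (by rwa [totalDegree_neg]) Z hcl hne' hdis
    (by intro x; rw [map_neg, neg_eq_zero]; exact hZ x) R hR T hT
  have h3 : Fintype.card ι + T.card ≤ ∑ i, cc f Z R T i + ∑ i, cc (-f) Z R T i := by
    rw [← Finset.sum_add_distrib]
    have : Fintype.card ι + T.card = ∑ i, (1 + if i ∈ T then 1 else 0) := by
      rw [Finset.sum_add_distrib]; simp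
    rw [this]
    apply Finset.sum_le_sum
    intro i _
    have hor : Adh f (Z i) R ∨ Adh (-f) (Z i) R := by
      obtain ⟨p, hp, hpR⟩ := hne i
      by_contra hcon
      rw [not_or] at hcon
      apply hf
      apply eq_zero_of_open f p
      have ha : p ∉ closure {x | 0 < eval x f} := fun h => hcon.1 ⟨p, hp, hpR, h⟩
      have hb : p ∉ closure {x | 0 < eval x (-f)} := fun h => hcon.2 ⟨p, hp, hpR, h⟩
      filter_upwards [isClosed_closure.isOpen_compl.mem_nhds ha,
        isClosed_closure.isOpen_compl.mem_nhds hb] with y hy1 hy2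
      have hy1' : ¬ 0 < eval y f := fun h => hy1 (subset_closure h)
      have hy2' : ¬ 0 < eval y (-f) := fun h => hy2 (subset_closure h)
      rw [map_neg] at hy2'
      linarith
    simp only [cc, neg_neg]
    by_cases hA : Adh f (Z i) R <;> by_cases hB : Adh (-f) (Z i) R <;> by_cases hC : i ∈ T <;>
      simp_all
  have := Nat.mul_le_mul_left q h3
  rw [mul_add q (∑ i, cc f Z R T i)] at this
  omega

end CC
open MvPolynomial

namespace CC

lemma topo_split {X : Type*} [TopologicalSpace X] (n : ℕ)
    (h : ¬ (Finite (ConnectedComponents X) ∧ Nat.card (ConnectedComponents X) ≤ n)) :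
    ∃ g : X → Fin (n + 1), Continuous g ∧ Function.Surjective g := by
  classical
  have hX : Nonempty X := by
    by_contra hne
    rw [not_nonempty_iff] at hne
    have : IsEmpty (ConnectedComponents X) := by
      constructor
      intro c
      obtain ⟨x, _⟩ := ConnectedComponents.surjective_coe c
      exact hne.elim x
    exact h ⟨inferInstance, by simp⟩
  have key : ∀ m, m ≤ n → ∃ g : X → Fin (m + 1), Continuous g ∧ Function.Surjective g := by
    intro m
    induction m with
    | zero =>
      intro _
      refine ⟨fun _ => 0, continuous_const, fun i => ⟨hX.some, by apply Fin.ext; omega⟩⟩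
    | succ m ih =>
      intro hm
      obtain ⟨g, hg, hgs⟩ := ih (by omega)
      by_cases hall : ∀ i, IsPreconnected (g ⁻¹' {i})
      · exfalso
        apply h
        choose s hs using hgs
        have hsurj : Function.Surjective (fun i => (s i : ConnectedComponents X)) := by
          intro c
          obtain ⟨x, rfl⟩ := ConnectedComponents.surjective_coe c
          refine ⟨g x, ?_⟩
          rw [ConnectedComponents.coe_eq_coe']
          exact (hall (g x)).subset_connectedComponent (x := x) rfl (hs (g x))
        have hfin : Finite (ConnectedComponents X) := Finite.of_surjective _ hsurj
        refine ⟨hfin, ?_⟩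
        have := Nat.card_le_card_of_surjective _ hsurj
        rw [Nat.card_fin] at this
        omega
      · push Not at hall
        obtain ⟨i0, hi0⟩ := hall
        set S := g ⁻¹' {i0} with hS
        have hSo : IsOpen S := (isOpen_discrete {i0}).preimage hg
        have hSc : IsClosed S := (isClosed_discrete {i0}).preimage hg
        unfold IsPreconnected at hi0
        push Not at hi0
        obtain ⟨u, v, hu, hv, hSuv, ⟨x, hxS, hxu⟩, ⟨y, hyS, hyv⟩, hemp⟩ := hi0
        have hemp' : ∀ z ∈ S, z ∈ u → z ∈ v → False := by
          intro z h1 h2 h3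
          have : z ∈ S ∩ (u ∩ v) := ⟨h1, h2, h3⟩
          rw [hemp] at this
          exact this
        have hC : IsClopen (S ∩ v) := by
          refine ⟨?_, hSo.inter hv⟩
          rw [← isOpen_compl_iff]
          have : (S ∩ v)ᶜ = Sᶜ ∪ (S ∩ u) := by
            ext z
            simp only [Set.mem_compl_iff, Set.mem_inter_iff, Set.mem_union]
            constructor
            · intro hz
              by_cases hzS : z ∈ S
              · right
                rcases hSuv hzS with h1 | h1
                · exact ⟨hzS, h1⟩
                · exact absurd ⟨hzS, h1⟩ hz
              · exact Or.inl hzS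
            · rintro (hz | hz) hz'
              · exact hz hz'.1
              · exact hemp' z hz.1 hz.2 hz'.2
          rw [this]
          exact hSc.isOpen_compl.union (hSo.inter hu)
        refine ⟨fun z => if z ∈ S ∩ v then Fin.last (m + 1) else (g z).castSucc, ?_, ?_⟩
        · refine Continuous.if ?_ continuous_const ?_
          · intro a ha
            have : frontier {z | z ∈ S ∩ v} = ∅ := hC.frontier_eq
            rw [this] at ha
            exact ha.elim
          · exact (continuous_of_discreteTopology (f := Fin.castSucc)).comp hg
        · intro i
          induction i using Fin.lastCases with
          | last => exact ⟨y, if_pos ⟨hyS, hyv⟩⟩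
          | cast i =>
            by_cases hi : i = i0
            · refine ⟨x, ?_⟩
              have hxg : g x = i0 := hxS
              dsimp only
              rw [if_neg (fun hx => hemp' x hxS hxu hx.2), hxg, hi]
            · obtain ⟨z, hz⟩ := hgs i
              refine ⟨z, ?_⟩
              dsimp only
              rw [if_neg, hz]
              rintro ⟨h1, _⟩
              apply hi
              have : g z = i0 := h1
              rw [← hz, this]
  exact key n le_rfl

lemma path_const {N m : ℕ} {f : MvPolynomial (Fin N) ℝ}
    (g : {x : Fin N → ℝ // eval x f = 0} → Fin m) (hg : Continuous g)
    (γ : ℝ → (Fin N → ℝ)) (hγ : ContinuousOn γ (Set.Icc 0 1))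
    (hz : ∀ s ∈ Set.Icc (0 : ℝ) 1, eval (γ s) f = 0)
    (x y : {x : Fin N → ℝ // eval x f = 0}) (hx : x.1 = γ 0) (hy : y.1 = γ 1) : g x = g y := by
  let c : Set.Icc (0 : ℝ) 1 → {x : Fin N → ℝ // eval x f = 0} := fun s => ⟨γ s.1, hz s.1 s.2⟩
  have hc : Continuous c := by
    apply Continuous.subtype_mk
    exact hγ.domRestrict
  have h1 : (g ∘ c) ⟨0, by simp⟩ = (g ∘ c) ⟨1, by simp⟩ :=
    PreconnectedSpace.constant inferInstance (hg.comp hc)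
  have hx' : x = c ⟨0, by simp⟩ := Subtype.ext hx
  have hy' : y = c ⟨1, by simp⟩ := Subtype.ext hy
  rw [hx', hy']
  exact h1

/-- the restriction of a quadric to the plane through three of its points -/
def QF {N : ℕ} (f : MvPolynomial (Fin N) ℝ) (P Q S : Fin N → ℝ) (α β γ : ℝ) : Prop :=
  ∀ u v w : ℝ, u + v + w = 1 → eval (u • P + v • Q + w • S) f =
    u ^ 2 * eval P f + v ^ 2 * eval Q f + w ^ 2 * eval S f + α * (v * w) + β * (u * w) + γ * (u * v)

lemma quad_formula {N : ℕ} (f : MvPolynomial (Fin N) ℝ) (hf : f.totalDegree ≤ 2)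
    (P Q S : Fin N → ℝ) : ∃ α β γ, QF f P Q S α β γ := by
  classical
  -- affine functions
  let Aff : MvPolynomial (Fin N) ℝ → Prop := fun L => ∀ u v w : ℝ, u + v + w = 1 →
    eval (u • P + v • Q + w • S) L = u * eval P L + v * eval Q L + w * eval S L
  have hA1 : ∀ c, Aff (C c) := by
    intro c u v w h
    simp only [eval_C]
    linear_combination (-c) * h
  have hAX : ∀ j, Aff (X j) := by
    intro j u v w h
    simp
  have hmul : ∀ L L', Aff L → Aff L' → ∃ α β γ, QF (L * L') P Q S α β γ := by
    intro L L' h h'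
    refine ⟨eval Q L * eval S L' + eval S L * eval Q L', eval P L * eval S L' + eval S L * eval P L',
      eval P L * eval Q L' + eval Q L * eval P L', ?_⟩
    intro u v w hu
    rw [map_mul, map_mul, map_mul, map_mul, h u v w hu, h' u v w hu]
    ring
  have hdec : ∀ (u : Fin N →₀ ℕ), u ≠ 0 → ∃ j u', u = u' + Finsupp.single j 1 := by
    intro u hu
    obtain ⟨j, hj⟩ := Finsupp.ne_iff.1 hu
    refine ⟨j, u - Finsupp.single j 1, ?_⟩
    rw [tsub_add_cancel_of_le]
    rw [Finsupp.single_le_iff]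
    simp at hj
    omega
  have hmono : ∀ (u : Fin N →₀ ℕ) (c : ℝ), (u.degree ≤ 2) → ∃ α β γ, QF (monomial u c) P Q S α β γ := by
    intro u c hu
    by_cases h0 : u = 0
    · subst h0
      have := hmul (C c) (C 1) (hA1 _) (hA1 _)
      simpa [← C_mul] using this
    obtain ⟨j, u', rfl⟩ := hdec u h0
    rw [map_add, Finsupp.degree_single] at hu
    by_cases h1 : u' = 0
    · subst h1
      have := hmul (C c) (X j) (hA1 _) (hAX _)
      rwa [C_mul_X_eq_monomial, ← zero_add (Finsupp.single j 1)] at this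
    obtain ⟨i, u'', rfl⟩ := hdec u' h1
    rw [map_add, Finsupp.degree_single] at hu
    have h2 : u'' = 0 := by
      rw [← Finsupp.degree_eq_zero_iff]; omega
    subst h2
    have hX : Aff (C c * X i) := by
      intro u v w h
      simp
      ring
    have := hmul (C c * X i) (X j) hX (hAX _)
    rw [C_mul_X_eq_monomial, X, monomial_mul, mul_one] at this
    rwa [zero_add]
  have hsum : ∀ (s : Finset (Fin N →₀ ℕ)) (F : (Fin N →₀ ℕ) → MvPolynomial (Fin N) ℝ),
      (∀ u ∈ s, ∃ α β γ, QF (F u) P Q S α β γ) → ∃ α β γ, QF (∑ u ∈ s, F u) P Q S α β γ := by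
    intro s F
    induction s using Finset.induction_on with
    | empty => intro _; exact ⟨0, 0, 0, by intro u v w _; simp⟩
    | insert a s ha ih =>
      intro h
      obtain ⟨α, β, γ, h1⟩ := ih (fun u hu => h u (Finset.mem_insert_of_mem hu))
      obtain ⟨α', β', γ', h2⟩ := h a (Finset.mem_insert_self _ _)
      refine ⟨α + α', β + β', γ + γ', ?_⟩
      intro u v w huv
      rw [Finset.sum_insert ha, map_add, map_add, map_add, map_add, h1 u v w huv, h2 u v w huv]
      ring
  rw [f.as_sum]
  apply hsum
  intro u hu
  apply hmono
  exact (le_totalDegree hu).trans hf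

lemma quad_zero {N m : ℕ} {f : MvPolynomial (Fin N) ℝ}
    (g : {x : Fin N → ℝ // eval x f = 0} → Fin m) (hg : Continuous g)
    (P Q S : {x : Fin N → ℝ // eval x f = 0}) (α β : ℝ) (h : QF f P.1 Q.1 S.1 α β 0) : g P = g Q := by
  refine path_const g hg (fun s => (1 - s) • P.1 + s • Q.1 + (0 : ℝ) • S.1)
    (by fun_prop) ?_ P Q (by simp) (by simp)
  intro s _
  rw [h _ _ _ (by ring), P.2, Q.2, S.2]
  ring

lemma quad_pos {N m : ℕ} {f : MvPolynomial (Fin N) ℝ}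
    (g : {x : Fin N → ℝ // eval x f = 0} → Fin m) (hg : Continuous g)
    (P Q S : {x : Fin N → ℝ // eval x f = 0}) (α β γ : ℝ) (h : QF f P.1 Q.1 S.1 α β γ)
    (hab : 0 < α * β) : g P = g Q := by
  obtain ⟨e, he, heb⟩ : ∃ e : ℝ, e ^ 2 = 1 ∧ 0 ≤ e * (α + β - γ) * β := by
    by_cases h0 : 0 ≤ (α + β - γ) * β
    · exact ⟨1, by norm_num, by linarith⟩
    · exact ⟨-1, by norm_num, by linarith⟩
  have hb : β ≠ 0 := by rintro rfl; simp at hab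
  have ha : α ≠ 0 := by rintro rfl; simp at hab
  let D : ℝ → ℝ := fun s => (1 - s) ^ 2 * β + s ^ 2 * α + (1 - s) * s * e * (α + β - γ)
  have hD : ∀ s ∈ Set.Icc (0 : ℝ) 1, D s ≠ 0 := by
    rintro s ⟨hs0, hs1⟩ h0
    have h1 : D s * β = (1 - s) ^ 2 * β ^ 2 + s ^ 2 * (α * β)
      + ((1 - s) * s) * (e * (α + β - γ) * β) := by simp only [D]; ring
    rw [h0, zero_mul] at h1
    have h2 : 0 ≤ ((1 - s) * s) * (e * (α + β - γ) * β) :=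
      mul_nonneg (mul_nonneg (by linarith) hs0) heb
    have h3 : 0 < β ^ 2 := by positivity
    rcases hs0.eq_or_lt with h4 | h4
    · subst h4; simp at h1; linarith
    · have : 0 < s ^ 2 * (α * β) := by positivity
      have : 0 ≤ (1 - s) ^ 2 * β ^ 2 := by positivity
      linarith
  have hDc : Continuous D := by simp only [D]; fun_prop
  refine path_const g hg (fun s =>
    (((1 - s) * ((1 - s) * β + s * e * α)) / D s) • P.1 +
    ((s * e * ((1 - s) * β + s * e * α)) / D s) • Q.1 +
    ((- (γ * s * (1 - s) * e)) / D s) • S.1) ?_ ?_ P Q ?_ ?_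
  · have hc := hDc.continuousOn (s := Set.Icc (0 : ℝ) 1)
    refine ContinuousOn.add (ContinuousOn.add ?_ ?_) ?_
    all_goals
      refine ContinuousOn.smul (ContinuousOn.div (by fun_prop) hc hD) continuousOn_const
  · intro s hs
    have h0 := hD s hs
    rw [h, P.2, Q.2, S.2]
    · field_simp
      linear_combination (-γ * s * (1 - s) * e * 0) * he
    · rw [← add_div, ← add_div, div_eq_one_iff_eq h0]
      simp only [D]
      linear_combination (s ^ 2 * α) * he
  · simp [D, hb]
  · have : e * (e * α) / α = 1 := by
      field_simp
      linarith
    simp [D, this]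

lemma QF_rot {N : ℕ} {f : MvPolynomial (Fin N) ℝ} {P Q S : Fin N → ℝ} {α β γ : ℝ}
    (h : QF f P Q S α β γ) : QF f Q S P β γ α := by
  intro u v w huv
  have := h w u v (by linarith)
  have e : u • Q + v • S + w • P = w • P + u • Q + v • S := by abel
  rw [e, this]
  ring

lemma quad_case {N m : ℕ} {f : MvPolynomial (Fin N) ℝ} (hf : f.totalDegree ≤ 2)
    (g : {x : Fin N → ℝ // eval x f = 0} → Fin m) (hg : Continuous g) (hs : Function.Surjective g) :
    m ≤ 2 := by
  by_contra hm
  push Not at hm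
  obtain ⟨P, hP⟩ := hs ⟨0, by omega⟩
  obtain ⟨Q, hQ⟩ := hs ⟨1, by omega⟩
  obtain ⟨S, hS⟩ := hs ⟨2, by omega⟩
  have hPQ : g P ≠ g Q := by rw [hP, hQ]; simp
  have hQS : g Q ≠ g S := by rw [hQ, hS]; simp
  have hSP : g S ≠ g P := by rw [hP, hS]; simp
  obtain ⟨α, β, γ, h⟩ := quad_formula f hf P.1 Q.1 S.1
  have h' := QF_rot h
  have h'' := QF_rot h'
  have hγ : γ ≠ 0 := by rintro rfl; exact hPQ (quad_zero g hg P Q S _ _ h)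
  have hα : α ≠ 0 := by rintro rfl; exact hQS (quad_zero g hg Q S P _ _ h')
  have hβ : β ≠ 0 := by rintro rfl; exact hSP (quad_zero g hg S P Q _ _ h'')
  have h1 : ¬ 0 < α * β := fun hh => hPQ (quad_pos g hg P Q S _ _ _ h hh)
  have h2 : ¬ 0 < β * γ := fun hh => hQS (quad_pos g hg Q S P _ _ _ h' hh)
  have h3 : ¬ 0 < γ * α := fun hh => hSP (quad_pos g hg S P Q _ _ _ h'' hh)
  have k1 : α * β < 0 := lt_of_le_of_ne (not_lt.1 h1) (mul_ne_zero hα hβ)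
  have k2 : β * γ < 0 := lt_of_le_of_ne (not_lt.1 h2) (mul_ne_zero hβ hγ)
  have k3 := mul_pos_of_neg_of_neg k1 k2
  have : 0 < β ^ 2 := by positivity
  have k4 : α * β * (β * γ) = β ^ 2 * (γ * α) := by ring
  rw [k4] at k3
  exact h3 ((mul_pos_iff_of_pos_left this).1 k3)

end CC
open MvPolynomial

namespace CC

lemma eval_aeval_poly {N : ℕ} (f : MvPolynomial (Fin N) ℝ) (F : Fin N → Polynomial ℝ) (t : ℝ) :
    Polynomial.eval t (aeval F f) = eval (fun j => Polynomial.eval t (F j)) f := by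
  induction f using MvPolynomial.induction_on with
  | C a => simp
  | add p q hp hq => simp [hp, hq]
  | mul_X p i hp => simp [hp]

lemma line_case {m d : ℕ} {f : MvPolynomial (Fin 1) ℝ} (hf0 : f ≠ 0) (hf : f.totalDegree ≤ d)
    (g : {x : Fin 1 → ℝ // eval x f = 0} → Fin m) (hs : Function.Surjective g) :
    m ≤ d := by
  classical
  set p : Polynomial ℝ := aeval (fun _ => Polynomial.X) f with hp
  have hpe : ∀ x : Fin 1 → ℝ, Polynomial.eval (x 0) p = eval x f := by
    intro x
    rw [hp, eval_aeval_poly]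
    congr 1
    congr 1
    funext j
    rw [Polynomial.eval_X, Subsingleton.elim j 0]
  have hp0 : p ≠ 0 := by
    intro h
    apply hf0
    apply MvPolynomial.funext
    intro x
    rw [← hpe x, h]; simp
  have hdeg : p.natDegree ≤ d := by
    have := aeval_natDegree_le (n := 1) f hf (fun _ => (Polynomial.X : Polynomial ℝ)) (by simp)
    rwa [mul_one] at this
  choose s hsg using hs
  have hc : (Finset.univ : Finset (Fin m)).card ≤ p.roots.toFinset.card := by
    apply Finset.card_le_card_of_injOn (fun i => (s i).1 0)
    · intro i _
      simp only [Finset.mem_coe, Multiset.mem_toFinset, Polynomial.mem_roots hp0, Polynomial.IsRoot.def]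
      rw [hpe]
      exact (s i).2
    · intro i _ j _ hij
      have : s i = s j := by
        apply Subtype.ext
        funext l
        rw [Subsingleton.elim l 0]
        exact hij
      rw [← hsg i, ← hsg j, this]
  rw [Finset.card_fin] at hc
  exact hc.trans ((Multiset.toFinset_card_le _).trans ((Polynomial.card_roots' p).trans hdeg))

/-- pull-back of `f` under the rational parametrization of the circle, denominators cleared -/
noncomputable def circP (f : MvPolynomial (Fin 2) ℝ) (d : ℕ) (R : ℝ) : Polynomial ℝ :=
  ∑ u ∈ f.support, Polynomial.C (coeff u f) *
    ((Polynomial.C R * (1 - Polynomial.X ^ 2)) ^ (u 0) * (Polynomial.C (2 * R) * Polynomial.X) ^ (u 1)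
      * (1 + Polynomial.X ^ 2) ^ (d - (u 0 + u 1)))

lemma supp_le {f : MvPolynomial (Fin 2) ℝ} {d : ℕ} (hf : f.totalDegree ≤ d) {u : Fin 2 →₀ ℕ}
    (hu : u ∈ f.support) : u 0 + u 1 ≤ d := by
  have := (le_totalDegree hu).trans hf
  rw [Finsupp.sum_fintype _ _ (by simp), Fin.sum_univ_two] at this
  exact this

lemma circP_deg (f : MvPolynomial (Fin 2) ℝ) (d : ℕ) (R : ℝ) (hf : f.totalDegree ≤ d) :
    (circP f d R).natDegree ≤ 2 * d := by
  unfold circP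
  apply Polynomial.natDegree_sum_le_of_forall_le
  intro u hu
  have h := supp_le hf hu
  have h1 : (Polynomial.C R * (1 - Polynomial.X ^ 2) : Polynomial ℝ).natDegree ≤ 2 := by
    compute_degree
  have h2 : (Polynomial.C (2 * R) * Polynomial.X : Polynomial ℝ).natDegree ≤ 1 := by
    compute_degree
  have h3 : (1 + Polynomial.X ^ 2 : Polynomial ℝ).natDegree ≤ 2 := by
    compute_degree
  refine (Polynomial.natDegree_C_mul_le _ _).trans ?_
  refine (Polynomial.natDegree_mul_le_of_le (Polynomial.natDegree_mul_le_of_le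
    (Polynomial.natDegree_pow_le_of_le (u 0) h1) (Polynomial.natDegree_pow_le_of_le (u 1) h2))
    (Polynomial.natDegree_pow_le_of_le (d - (u 0 + u 1)) h3)).trans ?_
  omega

lemma circP_eval (f : MvPolynomial (Fin 2) ℝ) (d : ℕ) (R : ℝ) (hf : f.totalDegree ≤ d) (t : ℝ)
    (x : Fin 2 → ℝ) (h0 : x 0 * (1 + t ^ 2) = R * (1 - t ^ 2)) (h1 : x 1 * (1 + t ^ 2) = 2 * R * t) :
    (circP f d R).eval t = (1 + t ^ 2) ^ d * eval x f := by
  unfold circP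
  rw [Polynomial.eval_finsetSum, eval_eq', Finset.mul_sum]
  refine Finset.sum_congr rfl (fun u hu => ?_)
  have h := supp_le hf hu
  simp only [Polynomial.eval_mul, Polynomial.eval_C, Polynomial.eval_pow, Polynomial.eval_sub,
    Polynomial.eval_one, Polynomial.eval_X, Polynomial.eval_add, Fin.prod_univ_two]
  rw [← h0, ← h1]
  have h2 : (1 + t ^ 2) ^ d = (1 + t ^ 2) ^ (u 0) * (1 + t ^ 2) ^ (u 1) *
      (1 + t ^ 2) ^ (d - (u 0 + u 1)) := by
    rw [← pow_add, ← pow_add]; congr 1; omega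
  rw [h2, mul_pow, mul_pow]
  ring

lemma circ_param {R : ℝ} (hR : 0 < R) (x : Fin 2 → ℝ) (hx : hh x = R ^ 2) (h : x 0 ≠ -R) :
    x 0 * (1 + (x 1 / (R + x 0)) ^ 2) = R * (1 - (x 1 / (R + x 0)) ^ 2) ∧
    x 1 * (1 + (x 1 / (R + x 0)) ^ 2) = 2 * R * (x 1 / (R + x 0)) := by
  have h0 : R + x 0 ≠ 0 := fun h' => h (by linarith)
  have h1 : x 0 ^ 2 + x 1 ^ 2 = R ^ 2 := by rw [← hx, hh, Fin.sum_univ_two]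
  constructor
  · field_simp
    linear_combination (x 0 + R) * h1
  · field_simp
    linear_combination (x 1) * h1

lemma circle_count (f : MvPolynomial (Fin 2) ℝ) (d : ℕ) (R : ℝ) (hf : f.totalDegree ≤ d)
    (hR : 0 < R) (z : Fin 2 → ℝ) (hz : hh z = R ^ 2) (hz0 : z 0 ≠ -R) (hfz : eval z f ≠ 0)
    (Y : Finset (Fin 2 → ℝ)) (hY : ∀ y ∈ Y, hh y = R ^ 2 ∧ eval y f = 0) : Y.card ≤ 2 * d + 1 := by
  classical
  have hP0 : circP f d R ≠ 0 := by
    intro h0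
    obtain ⟨e1, e2⟩ := circ_param hR z hz hz0
    have := circP_eval f d R hf _ z e1 e2
    rw [h0, Polynomial.eval_zero] at this
    have h2 : (1 + (z 1 / (R + z 0)) ^ 2) ^ d ≠ 0 := by positivity
    exact (mul_ne_zero h2 hfz) this.symm
  have hc : (Y.erase ![-R, 0]).card ≤ (circP f d R).roots.toFinset.card := by
    have hne : ∀ y ∈ Y.erase ![-R, 0], y 0 ≠ -R := by
      intro y hy h
      rw [Finset.mem_erase] at hy
      apply hy.1
      have h1 := (hY y hy.2).1
      rw [hh, Fin.sum_univ_two, h] at h1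
      have h2 : y 1 = 0 := by
        have : y 1 ^ 2 = 0 := by linarith [neg_sq R]
        exact pow_eq_zero_iff (two_ne_zero) |>.1 this
      funext j
      fin_cases j
      · exact h
      · exact h2
    apply Finset.card_le_card_of_injOn (fun y => y 1 / (R + y 0))
    · intro y hy
      have hy' := hY y (Finset.mem_of_mem_erase hy)
      obtain ⟨e1, e2⟩ := circ_param hR y hy'.1 (hne y hy)
      simp only [Finset.mem_coe, Multiset.mem_toFinset, Polynomial.mem_roots hP0, Polynomial.IsRoot.def]
      rw [circP_eval f d R hf _ y e1 e2, hy'.2, mul_zero]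
    · intro y hy w hw hyw
      have hy' := hY y (Finset.mem_of_mem_erase hy)
      obtain ⟨e1, e2⟩ := circ_param hR y hy'.1 (hne y hy)
      have hw' := hY w (Finset.mem_of_mem_erase hw)
      obtain ⟨e3, e4⟩ := circ_param hR w hw'.1 (hne w hw)
      dsimp only at hyw
      rw [← hyw] at e3 e4
      have h2 : (1 + (y 1 / (R + y 0)) ^ 2) ≠ 0 := by positivity
      funext j
      fin_cases j
      · exact mul_right_cancel₀ h2 (e1.trans e3.symm)
      · exact mul_right_cancel₀ h2 (e2.trans e4.symm)
  have h1 := Finset.pred_card_le_card_erase (s := Y) (a := ![-R, 0])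
  have h2 := (Multiset.toFinset_card_le _).trans ((Polynomial.card_roots' _).trans (circP_deg f d R hf))
  omega

section pieces

variable {N m : ℕ} {f : MvPolynomial (Fin N) ℝ}

def piece (g : {x : Fin N → ℝ // eval x f = 0} → Fin m) (i : Fin m) : Set (Fin N → ℝ) :=
  Subtype.val '' (g ⁻¹' {i})

lemma mem_piece {g : {x : Fin N → ℝ // eval x f = 0} → Fin m} {i : Fin m} {x : Fin N → ℝ} :
    x ∈ piece g i ↔ ∃ h : eval x f = 0, g ⟨x, h⟩ = i := by
  simp [piece]

lemma piece_closed (g : {x : Fin N → ℝ // eval x f = 0} → Fin m) (hg : Continuous g) (i : Fin m) :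
    IsClosed (piece g i) := by
  have h1 : IsClosed {x : Fin N → ℝ | eval x f = 0} :=
    isClosed_eq (MvPolynomial.continuous_eval f) continuous_const
  exact h1.isClosedEmbedding_subtypeVal.isClosedMap _ ((isClosed_discrete {i}).preimage hg)

lemma piece_disj (g : {x : Fin N → ℝ // eval x f = 0} → Fin m) (i j : Fin m) (hij : i ≠ j) :
    Disjoint (piece g i) (piece g j) := by
  rw [Set.disjoint_left]
  intro x hx hx'
  rw [mem_piece] at hx hx'
  obtain ⟨h, hi⟩ := hx
  obtain ⟨h', hj⟩ := hx'
  exact hij (hi.symm.trans hj)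

lemma piece_union (g : {x : Fin N → ℝ // eval x f = 0} → Fin m) (x : Fin N → ℝ) :
    eval x f = 0 ↔ ∃ i, x ∈ piece g i := by
  simp only [mem_piece]
  constructor
  · intro h; exact ⟨_, h, rfl⟩
  · rintro ⟨_, h, _⟩; exact h

lemma piece_bound (g : {x : Fin N → ℝ // eval x f = 0} → Fin m) (hs : Function.Surjective g) :
    ∃ R0 : ℝ, 0 < R0 ∧ ∀ R, R0 ≤ R → ∀ i, ∃ p ∈ piece g i, hh p < R := by
  choose s hsg using hs
  refine ⟨1 + ∑ i, hh (s i).1, ?_, ?_⟩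
  · have : 0 ≤ ∑ i, hh (s i).1 := Finset.sum_nonneg (fun _ _ => hh_nonneg _)
    linarith
  · intro R hR i
    refine ⟨(s i).1, mem_piece.2 ⟨(s i).2, hsg i⟩, ?_⟩
    have : hh (s i).1 ≤ ∑ i, hh (s i).1 :=
      Finset.single_le_sum (f := fun i => hh (s i).1) (fun _ _ => hh_nonneg _) (Finset.mem_univ i)
    linarith

end pieces

lemma space_case {N m q : ℕ} (hN : 3 ≤ N) (hq : 2 ≤ q) {f : MvPolynomial (Fin N) ℝ} (hf0 : f ≠ 0)
    (hf : f.totalDegree ≤ q + 2) (g : {x : Fin N → ℝ // eval x f = 0} → Fin m) (hg : Continuous g)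
    (hs : Function.Surjective g) : m ≤ N * (q + 2) * (q + 1) ^ (N - 1) := by
  have : NeZero q := ⟨by omega⟩
  obtain ⟨R, hR, hb⟩ := piece_bound g hs
  have h1 := lens (⟨0, by omega⟩ : Fin N) q f hf0 hf (piece g) (piece_closed g hg) (piece_disj g)
    (piece_union g) R hR (hb R le_rfl) ∅ (by simp)
  rw [Fintype.card_fin, Finset.card_empty, add_zero] at h1
  obtain ⟨M, rfl⟩ : ∃ M, N = M + 1 := ⟨N - 1, by omega⟩
  rw [Nat.add_sub_cancel]
  have h2 : 2 * ((q + 2) * (q + 1) ^ (M + 1)) ≤ q * ((M + 1) * (q + 2) * (q + 1) ^ M) := by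
    have e1 : 2 * ((q + 2) * (q + 1) ^ (M + 1)) = (2 * (q + 1)) * ((q + 2) * (q + 1) ^ M) := by ring
    have e2 : q * ((M + 1) * (q + 2) * (q + 1) ^ M) = (q * (M + 1)) * ((q + 2) * (q + 1) ^ M) := by ring
    rw [e1, e2]
    apply Nat.mul_le_mul_right
    nlinarith
  exact Nat.le_of_mul_le_mul_left (h1.trans h2) (by omega)

lemma plane_case {m q : ℕ} (hq : 2 ≤ q) {f : MvPolynomial (Fin 2) ℝ} (hf0 : f ≠ 0)
    (hf : f.totalDegree ≤ q + 2) (g : {x : Fin 2 → ℝ // eval x f = 0} → Fin m) (hg : Continuous g)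
    (hs : Function.Surjective g) : m ≤ 2 * (q + 2) * (q + 1) := by
  classical
  have : NeZero q := ⟨by omega⟩
  obtain ⟨R0, hR0, hb⟩ := piece_bound g hs
  obtain ⟨z, hz1, hz2⟩ : ∃ z : Fin 2 → ℝ, R0 < hh z ∧ eval z (f * X 1) ≠ 0 := by
    by_contra! hcon
    have hX : (X 1 : MvPolynomial (Fin 2) ℝ) ≠ 0 := X_ne_zero 1
    apply mul_ne_zero hf0 hX
    apply eq_zero_of_open _ (fun _ => R0 + 1)
    have hop : IsOpen {y : Fin 2 → ℝ | R0 < hh y} := isOpen_lt continuous_const continuous_hh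
    filter_upwards [hop.mem_nhds (x := fun _ => R0 + 1) (by
      show R0 < hh _
      rw [hh, Fin.sum_univ_two]; nlinarith)] with y hy
    exact hcon y hy
  rw [map_mul, eval_X] at hz2
  have hfz : eval z f ≠ 0 := left_ne_zero_of_mul hz2
  have hz3 : z 1 ≠ 0 := right_ne_zero_of_mul hz2
  set R := Real.sqrt (hh z) with hRdef
  have hRR : R ^ 2 = hh z := Real.sq_sqrt (hh_nonneg z)
  have hRpos : 0 < R := Real.sqrt_pos.2 (by linarith)
  have hz0 : z 0 ≠ -R := by
    intro h
    rw [hh, Fin.sum_univ_two, h] at hRR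
    apply hz3
    have : z 1 ^ 2 = 0 := by linarith [neg_sq R]
    exact pow_eq_zero_iff (two_ne_zero) |>.1 this
  let T : Finset (Fin m) := Finset.univ.filter (fun i => ∀ x ∈ piece g i, hh x ≠ hh z)
  have h1 := lens (0 : Fin 2) q f hf0 hf (piece g) (piece_closed g hg) (piece_disj g)
    (piece_union g) (hh z) (by linarith) (hb _ hz1.le) T (by
      intro i hi
      exact (Finset.mem_filter.1 hi).2)
  rw [Fintype.card_fin] at h1
  have h2 : (Finset.univ \ T).card ≤ 2 * (q + 2) + 1 := by
    have hx : ∀ i : Fin m, i ∈ Finset.univ \ T → ∃ x ∈ piece g i, hh x = hh z := by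
      intro i hi
      by_contra! hcon
      rw [Finset.mem_sdiff] at hi
      exact hi.2 (Finset.mem_filter.2 ⟨Finset.mem_univ _, hcon⟩)
    choose! x hx1 hx2 using hx
    rw [← Finset.card_image_of_injOn (f := x)]
    · apply circle_count f (q + 2) R hf hRpos z hRR.symm hz0 hfz
      intro y hy
      rw [Finset.mem_image] at hy
      obtain ⟨i, hi, rfl⟩ := hy
      exact ⟨by rw [hx2 i hi, hRR], (piece_union g _).2 ⟨i, hx1 i hi⟩⟩
    · intro i hi j hj hij
      by_contra hne
      have := hx1 j hj
      rw [← hij] at this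
      exact Set.disjoint_left.1 (piece_disj g i j hne) (hx1 i hi) this
  have h3 : m ≤ (Finset.univ \ T).card + T.card := by
    have := Finset.card_sdiff_add_card_eq_card (Finset.subset_univ T)
    rw [Finset.card_fin] at this
    omega
  by_contra hcon
  push Not at hcon
  obtain ⟨a, rfl⟩ : ∃ a, q = a + 2 := ⟨q - 2, by omega⟩
  have h4 : 4 * (a + 4) * (a + 3) + 2 ≤ (m + T.card) + (2 * (a + 4) + 1) := by
    nlinarith
  nlinarith [Nat.mul_le_mul_left (a + 2) h4]

lemma core {N k m : ℕ} (hN : 1 ≤ N) (hk : 1 ≤ k) {f : MvPolynomial (Fin N) ℝ}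
    (hdeg : f.totalDegree = 2 * k) (g : {x : Fin N → ℝ // eval x f = 0} → Fin m)
    (hg : Continuous g) (hs : Function.Surjective g) :
    m ≤ N * (2 * k) * (2 * k - 1) ^ (N - 1) := by
  have hf0 : f ≠ 0 := by
    rintro rfl
    rw [totalDegree_zero] at hdeg
    omega
  rcases hk.eq_or_lt with rfl | hk2
  · have := quad_case hdeg.le g hg hs
    simp
    omega
  obtain ⟨q, hq⟩ : ∃ q, 2 * k = q + 2 := ⟨2 * k - 2, by omega⟩
  rw [hq] at hdeg ⊢
  have hq2 : 2 ≤ q := by omega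
  rcases hN.eq_or_lt with rfl | hN2
  · have := line_case hf0 hdeg.le g hs
    simpa using this
  rcases (Nat.succ_le_of_lt hN2).eq_or_lt with h2 | hN3
  · have h2' : N = 2 := h2.symm
    subst h2'
    have := plane_case hq2 hf0 hdeg.le g hg hs
    simpa using this
  · exact space_case hN3 hq2 hf0 hdeg.le g hg hs

end CC

theorem count_connected_components_le (N k : ℕ) (hN : 1 ≤ N) (hk : 1 ≤ k)
    (f : MvPolynomial (Fin N) ℝ) (hdeg : f.totalDegree = 2 * k) :
    Finite (ConnectedComponents
      {x : EuclideanSpace ℝ (Fin N) // eval (fun j => x j) f = 0}) ∧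
    Nat.card (ConnectedComponents
      {x : EuclideanSpace ℝ (Fin N) // eval (fun j => x j) f = 0})
      ≤ N * (2 * k) * (2 * k - 1) ^ (N - 1) := by
  by_contra hcon
  obtain ⟨g, hg, hs⟩ := CC.topo_split _ hcon
  let τ : {x : Fin N → ℝ // eval x f = 0} →
      {x : EuclideanSpace ℝ (Fin N) // eval (fun j => x j) f = 0} :=
    fun x => ⟨WithLp.toLp 2 x.1, x.2⟩
  have hτ : Continuous τ := by
    apply Continuous.subtype_mk
    exact (PiLp.continuous_toLp 2 _).comp continuous_subtype_val
  have hτs : Function.Surjective τ := by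
    intro y
    exact ⟨⟨fun j => y.1 j, y.2⟩, rfl⟩
  have := CC.core hN hk hdeg (g ∘ τ) (hg.comp hτ) (hs.comp hτs)
  omega
end

section
/- Let N ≥ 1, k ≥ 1, and let f : ℝ^N → ℝ be a polynomial of total degree 2k. Then the number of real roots of f that are isolated over ℝ, i.e., the number of isolated points of the set {x ∈ ℝ^N : f(x) = 0}, is at most K(N, 2k) := N · 2k · (2k − 1)^{N−1}. -/
open MvPolynomial

/-- Interpolation by polynomials of low degree. -/
lemma exists_interp {N : ℕ} (Y : Finset (Fin N → ℝ)) (y : Fin N → ℝ) :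
    ∃ p : MvPolynomial (Fin N) ℝ, p.totalDegree ≤ Y.card ∧ eval y p = 1 ∧
      ∀ z ∈ Y, z ≠ y → eval z p = 0 := by
  classical
  have h : ∀ z : Fin N → ℝ, ∃ q : MvPolynomial (Fin N) ℝ, q.totalDegree ≤ 1 ∧
      (z ≠ y → eval y q = 1 ∧ eval z q = 0) := by
    intro z
    by_cases hz : z = y
    · exact ⟨0, by simp, fun h => absurd hz h⟩
    · obtain ⟨j, hj⟩ := Function.ne_iff.1 hz
      refine ⟨C (y j - z j)⁻¹ * (X j - C (z j)), ?_, fun _ => ⟨?_, ?_⟩⟩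
      · refine (totalDegree_mul _ _).trans ?_
        rw [totalDegree_C, zero_add]
        refine (totalDegree_sub _ _).trans ?_
        simp
      · have : y j - z j ≠ 0 := sub_ne_zero.2 (Ne.symm hj)
        simp [this]
      · simp
  choose q hq1 hq2 using h
  refine ⟨∏ z ∈ Y.erase y, q z, ?_, ?_, ?_⟩
  · refine (totalDegree_finsetProd _ _).trans ?_
    refine (Finset.sum_le_card_nsmul _ _ 1 fun z _ => hq1 z).trans ?_
    simpa using Finset.card_le_card (Finset.erase_subset y Y)
  · rw [map_prod]
    exact Finset.prod_eq_one fun z hz => (hq2 z (Finset.ne_of_mem_erase hz)).1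
  · intro z hz hzy
    rw [map_prod]
    exact Finset.prod_eq_zero (Finset.mem_erase.2 ⟨hzy, hz⟩) (hq2 z hzy).2

/-- A Bézout type bound for a perturbed system. -/
lemma bezout_perturbed (N d M : ℕ) (g : Fin N → MvPolynomial (Fin N) ℝ)
    (hg : ∀ j, (g j).totalDegree ≤ d) :
    {t : ℝ | ¬ ∀ Y : Finset (Fin N → ℝ), Y.card ≤ M →
      (∀ y ∈ Y, ∀ j, eval y (g j + C t * X j ^ d) = 0) → Y.card ≤ d ^ N}.Finite := by
  classical
  let φ : (Fin N →₀ ℕ) → MvPolynomial (Fin N) ℝ := fun s =>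
    if h : ∃ j, d ≤ s j then
      monomial (s - Finsupp.single h.choose d) 1 * g h.choose else 0
  obtain ⟨T, hT⟩ : ∃ T : MvPolynomial (Fin N) ℝ →ₗ[ℝ] MvPolynomial (Fin N) ℝ,
      ∀ s, T (monomial s 1) = φ s := by
    refine ⟨(basisMonomials (Fin N) ℝ).constr ℝ φ, fun s => ?_⟩
    have := (basisMonomials (Fin N) ℝ).constr_basis ℝ φ s
    simpa using this
  let V := restrictTotalDegree (Fin N) ℝ M
  have hTV : ∀ p ∈ V, T p ∈ V := by
    intro p hp
    rw [p.as_sum, map_sum]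
    refine V.sum_mem fun s hs => ?_
    have h1 : (monomial s (coeff s p) : MvPolynomial (Fin N) ℝ) = coeff s p • monomial s 1 := by
      simp [smul_monomial]
    rw [h1, map_smul]
    refine V.smul_mem _ ?_
    rw [hT]
    have hsM : (s.sum fun _ e => e) ≤ M :=
      (le_totalDegree hs).trans ((mem_restrictTotalDegree _ _ _).1 hp)
    simp only [φ]
    split_ifs with h
    · refine (mem_restrictTotalDegree _ _ _).2 ?_
      refine (totalDegree_mul _ _).trans ?_
      rw [totalDegree_monomial _ one_ne_zero]
      have h2 := hg h.choose
      have h3 : Finsupp.single h.choose d ≤ s := by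
        rw [Finsupp.single_le_iff]; exact h.choose_spec
      have h4 : ((s - Finsupp.single h.choose d).sum fun _ e => e) + d = s.sum fun _ e => e := by
        conv_rhs => rw [← tsub_add_cancel_of_le h3]
        rw [Finsupp.sum_add_index' (by simp) (by simp)]
        simp
      omega
    · exact V.zero_mem
  let T' : Module.End ℝ V := T.restrict hTV
  have hfin : ({0} ∪ (fun t => -t) ⁻¹' {μ | T'.HasEigenvalue μ} : Set ℝ).Finite :=
    (Set.finite_singleton _).union
      (T'.finite_hasEigenvalue.preimage (neg_injective.injOn))
  refine hfin.subset ?_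
  intro t ht
  by_contra hbad
  apply ht
  simp only [Set.mem_union, Set.mem_singleton_iff, Set.mem_preimage, Set.mem_ofPred_eq, not_or] at hbad
  obtain ⟨ht0, hte⟩ := hbad
  intro Y hYM hY
  have hinj : Function.Injective (T' + t • (LinearMap.id : V →ₗ[ℝ] V)) := by
    rw [← LinearMap.ker_eq_bot, LinearMap.ker_eq_bot']
    intro v hv
    by_contra hv0
    apply hte
    refine Module.End.hasEigenvalue_of_hasEigenvector (x := v)
      (Module.End.hasEigenvector_iff.2 ⟨Module.End.mem_eigenspace_iff.2 ?_, hv0⟩)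
    have : T' v + t • v = 0 := by simpa using hv
    rw [neg_smul]; exact eq_neg_of_add_eq_zero_left this
  have hsurj := LinearMap.surjective_of_injective hinj
  obtain ⟨e, he⟩ : ∃ e : MvPolynomial (Fin N) ℝ →ₗ[ℝ] (Y → ℝ),
      ∀ p (y : Y), e p y = eval (y : Fin N → ℝ) p := by
    refine ⟨LinearMap.pi fun y => (aeval (R := ℝ) (y : Fin N → ℝ)).toLinearMap, fun p y => ?_⟩
    simp
  let b : (Fin N → Fin d) → (Y → ℝ) := fun a =>
    e (monomial (Finsupp.equivFunOnFinite.symm fun j => (a j : ℕ)) 1)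
  let R : Submodule ℝ (Y → ℝ) := Submodule.span ℝ (Set.range b)
  have hall : ∀ q, e (T q + t • q) ∈ R := by
    have hmon : ∀ s, e (T (monomial s 1) + t • monomial s 1) ∈ R := by
      intro s
      rw [hT]
      simp only [φ]
      split_ifs with h
      · convert R.zero_mem
        ext y
        rw [he]
        have h3 : Finsupp.single h.choose d ≤ s := by
          rw [Finsupp.single_le_iff]; exact h.choose_spec
        have h5 : (monomial s 1 : MvPolynomial (Fin N) ℝ) =
            monomial (s - Finsupp.single h.choose d) 1 * X h.choose ^ d := by
          rw [X_pow_eq_monomial, monomial_mul, tsub_add_cancel_of_le h3, one_mul]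
        have h6 := hY y y.2 h.choose
        simp only [map_add, map_mul, eval_C, map_pow, eval_X] at h6
        rw [h5]
        simp only [map_add, map_mul, map_pow, eval_X, smul_eval, Pi.zero_apply]
        linear_combination (eval (y : Fin N → ℝ) (monomial (s - Finsupp.single h.choose d) 1)) * h6
      · push Not at h
        rw [zero_add, map_smul]
        refine R.smul_mem _ (Submodule.subset_span ⟨fun j => ⟨s j, h j⟩, ?_⟩)
        have hs : (Finsupp.equivFunOnFinite.symm fun j => s j) = s := by
          ext j; simp
        simp only [b, hs]
    intro q
    induction q using MvPolynomial.induction_on' with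
    | monomial s a =>
      have h1 : (monomial s a : MvPolynomial (Fin N) ℝ) = a • monomial s 1 := by
        simp [smul_monomial]
      have h2 := R.smul_mem a (hmon s)
      rw [h1, map_smul, smul_comm t a, ← smul_add, map_smul]
      exact h2
    | add p q hp hq =>
      have h2 := R.add_mem hp hq
      rw [← map_add] at h2
      have h3 : T (p + q) + t • (p + q) = T p + t • p + (T q + t • q) := by
        rw [map_add, smul_add]; abel
      rw [h3]
      exact h2
  have hV : ∀ p ∈ V, e p ∈ R := by
    intro p hp
    obtain ⟨q, hq⟩ := hsurj ⟨p, hp⟩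
    have := hall q
    have h2 : T q + t • (q : MvPolynomial (Fin N) ℝ) = p := by
      simpa [T'] using congrArg Subtype.val hq
    rwa [h2] at this
  have hRtop : R = ⊤ := by
    rw [eq_top_iff]
    intro v _
    rw [pi_eq_sum_univ' v]
    refine R.sum_mem fun y _ => R.smul_mem _ ?_
    obtain ⟨p, hp1, hp2, hp3⟩ := exists_interp Y y
    convert hV p ((mem_restrictTotalDegree _ _ _).2 (hp1.trans hYM)) using 1
    ext z
    rw [he]
    by_cases hz : z = y
    · subst hz; simp [hp2]
    · rw [hp3 z z.2 (fun h => hz (Subtype.ext h))]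
      simp [hz]
  have h1 := finrank_range_le_card (R := ℝ) b
  have h2 : Set.finrank ℝ (Set.range b) = Y.card := by
    change Module.finrank ℝ R = _
    rw [hRtop, finrank_top]; simp
  rw [h2] at h1
  simpa using h1

lemma hasDerivAt_eval_update {N : ℕ} (y : Fin N → ℝ) (j : Fin N) (p : MvPolynomial (Fin N) ℝ) :
    HasDerivAt (fun t => eval (Function.update y j t) p) (eval y (pderiv j p)) (y j) := by
  induction p using MvPolynomial.induction_on with
  | C a => simpa using hasDerivAt_const (y j) a
  | add p q hp hq =>
    simp only [map_add]
    exact hp.add hq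
  | mul_X p i hp =>
    have hX : HasDerivAt (fun t => Function.update y j t i) (eval y (pderiv j (X i))) (y j) := by
      by_cases h : i = j
      · subst h
        simp only [Function.update_self, pderiv_X_self, map_one]
        exact hasDerivAt_id (y i)
      · simpa [h, pderiv_X_of_ne h] using hasDerivAt_const (y j) (y i)
    have := hp.mul hX
    simp only [Function.update_eq_self] at this
    simp only [map_mul, eval_X, pderiv_mul, map_add]
    exact this

lemma pderiv_eq_zero_of_extr {N : ℕ} (p : MvPolynomial (Fin N) ℝ) (y : EuclideanSpace ℝ (Fin N))
    (h : IsLocalExtr (fun x : EuclideanSpace ℝ (Fin N) => eval (fun j => x j) p) y) (j : Fin N) :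
    eval (fun j => y j) (pderiv j p) = 0 := by
  have hd := hasDerivAt_eval_update (fun j => y j) j p
  refine IsLocalExtr.hasDerivAt_eq_zero ?_ hd
  let c : ℝ → EuclideanSpace ℝ (Fin N) := fun t => WithLp.toLp 2 (Function.update (fun j => y j) j t)
  have hc : Continuous c := by
    refine (PiLp.continuous_toLp 2 _).comp ?_
    exact continuous_const.update j continuous_id
  have hcy : c (y j) = y := by
    ext i; simp [c]
  rw [← hcy] at h
  exact h.comp_continuous (g := c) (b := y j) hc.continuousAt

lemma totalDegree_pderiv_le' {N d : ℕ} (p : MvPolynomial (Fin N) ℝ) (hp : p.totalDegree ≤ d + 1)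
    (j : Fin N) : (pderiv j p).totalDegree ≤ d := by
  rw [totalDegree, Finset.sup_le_iff]
  intro s hs
  rw [mem_support_iff, coeff_pderiv] at hs
  have h1 : s + Finsupp.single j 1 ∈ p.support := by
    rw [mem_support_iff]
    intro h; rw [h] at hs; simp at hs
  have h2 := (le_totalDegree h1).trans hp
  rw [Finsupp.sum_add_index' (by simp) (by simp)] at h2
  simp at h2
  exact h2

lemma eventually_localMin {E : Type*} [MetricSpace E] [ProperSpace E] (φ g : E → ℝ)
    (hφ : Continuous φ) (hg : Continuous g) (x : E) (r : ℝ) (hr : 0 < r) 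
    (h : ∀ z ∈ Metric.sphere x r, φ x < φ z) :
    ∀ᶠ ε in nhds (0 : ℝ), ∃ y ∈ Metric.ball x r, IsLocalMin (fun z => φ z + ε * g z) y := by
  have h1 : ∀ᶠ ε in nhds (0 : ℝ), ∀ z ∈ Metric.sphere x r, φ x + ε * g x < φ z + ε * g z := by
    refine (isCompact_sphere x r).eventually_forall_of_forall_eventually ?_
    intro z hz
    have hl : Continuous fun w : ℝ × E => φ x + w.1 * g x := by fun_prop
    have hr : Continuous fun w : ℝ × E => φ w.2 + w.1 * g w.2 := by fun_prop
    exact (hl.tendsto (0, z)).eventually_lt (hr.tendsto (0, z)) (by simpa using h z hz)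
  filter_upwards [h1] with ε hε
  exact Metric.exists_isLocalMin_mem_ball (by fun_prop) (Metric.mem_closedBall_self hr.le) hε

lemma eventually_localExtr {E : Type*} [NormedAddCommGroup E] [NormedSpace ℝ E] [ProperSpace E]
    (hE : 1 < Module.rank ℝ E) (φ g : E → ℝ)
    (hφ : Continuous φ) (hg : Continuous g) (x : E) (r : ℝ) (hr : 0 < r) (hx : φ x = 0)
    (h : ∀ z ∈ Metric.sphere x r, φ z ≠ 0) :
    ∀ᶠ ε in nhds (0 : ℝ), ∃ y ∈ Metric.ball x r, IsLocalExtr (fun z => φ z + ε * g z) y := by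
  have hs : (∀ z ∈ Metric.sphere x r, 0 < φ z) ∨ (∀ z ∈ Metric.sphere x r, φ z < 0) := by
    by_contra hcon
    push Not at hcon
    obtain ⟨⟨z, hz, hz0⟩, w, hw, hw0⟩ := hcon
    obtain ⟨u, hu, hu0⟩ := (isPreconnected_sphere hE x r).intermediate_value hz hw
      hφ.continuousOn ⟨hz0, hw0⟩
    exact h u hu hu0
  rcases hs with hs | hs
  · filter_upwards [eventually_localMin φ g hφ hg x r hr (by simpa [hx] using hs)] with ε hε
    obtain ⟨y, hy, hy'⟩ := hε
    exact ⟨y, hy, Or.inl hy'⟩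
  · filter_upwards [eventually_localMin (fun z => - φ z) (fun z => - g z) hφ.neg hg.neg x r hr
      (by simpa [hx] using hs)] with ε hε
    obtain ⟨y, hy, hy'⟩ := hε
    refine ⟨y, hy, Or.inr ?_⟩
    have := hy'.neg
    refine this.congr (Filter.Eventually.of_forall fun z => ?_)
    ring

theorem key (N k : ℕ) (hN : 2 ≤ N) (hk : 1 ≤ k)
    (f : MvPolynomial (Fin N) ℝ) (hdeg : f.totalDegree = 2 * k)
    (F : Finset (EuclideanSpace ℝ (Fin N)))
    (hF : ∀ x ∈ F, eval (fun j => x j) f = 0 ∧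
        ∃ U ∈ nhds x, U ∩ {x' : EuclideanSpace ℝ (Fin N) | eval (fun j => x' j) f = 0}
          = {x}) : F.card ≤ (2 * k - 1) ^ N := by
  classical
  obtain ⟨d, hd⟩ : ∃ d, 2 * k = d + 1 := ⟨2 * k - 1, by omega⟩
  have hd' : 2 * k - 1 = d := by omega
  rw [hd']
  let P : MvPolynomial (Fin N) ℝ := ∑ j, X j ^ (d + 1)
  have hP : ∀ j, pderiv j P = C ((d : ℝ) + 1) * X j ^ d := by
    intro j
    simp only [P, map_sum]
    rw [Finset.sum_eq_single j]
    · rw [pderiv_pow]; simp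
    · intro i _ hi
      rw [pderiv_pow, pderiv_X_of_ne hi, mul_zero]
    · simp
  have hcont : ∀ p : MvPolynomial (Fin N) ℝ,
      Continuous fun x : EuclideanSpace ℝ (Fin N) => eval (fun j => x j) p := fun p => by
    exact (MvPolynomial.continuous_eval p).comp (by fun_prop)
  have hrank : 1 < Module.rank ℝ (EuclideanSpace ℝ (Fin N)) := by
    rw [← Module.finrank_eq_rank, finrank_euclideanSpace_fin]
    exact_mod_cast hN
  obtain ⟨D, hD1, hD2⟩ := F.finite_toSet.t2_separation
  have hloc : ∀ x ∈ F, ∀ᶠ ε in nhds (0 : ℝ), ∃ y ∈ D x, IsLocalExtr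
      (fun z : EuclideanSpace ℝ (Fin N) => eval (fun j => z j) f + ε * eval (fun j => z j) P) y := by
    intro x hx
    obtain ⟨hx0, U, hU, hUx⟩ := hF x hx
    obtain ⟨r, hr, hrU⟩ := Metric.nhds_basis_closedBall.mem_iff.1
      (Filter.inter_mem hU ((hD1 x).2.mem_nhds (hD1 x).1))
    have := eventually_localExtr hrank _ _ (hcont f) (hcont P) x r hr hx0 (by
      intro z hz hz0
      have h1 : z ∈ U ∩ {x' : EuclideanSpace ℝ (Fin N) | eval (fun j => x' j) f = 0} :=
        ⟨(hrU (Metric.sphere_subset_closedBall hz)).1, hz0⟩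
      rw [hUx, Set.mem_singleton_iff] at h1
      rw [h1, Metric.mem_sphere, dist_self] at hz
      exact hr.ne hz)
    filter_upwards [this] with ε hε
    obtain ⟨y, hy, hy'⟩ := hε
    exact ⟨y, (hrU (Metric.ball_subset_closedBall hy)).2, hy'⟩
  have hall := (Filter.eventually_all_finset F).2 hloc
  have hd0 : (d : ℝ) + 1 ≠ 0 := by positivity
  have hfin := bezout_perturbed N d F.card (fun j => pderiv j f)
    (fun j => totalDegree_pderiv_le' f (by omega) j)
  have hfin2 := hfin.preimage (f := fun ε : ℝ => ε * ((d : ℝ) + 1))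
    (fun a _ b _ hab => mul_right_cancel₀ hd0 hab)
  have hgood : ∀ᶠ ε in nhdsWithin (0 : ℝ) {0}ᶜ, ε ∈ ((fun ε : ℝ => ε * ((d : ℝ) + 1)) ⁻¹' _)ᶜ :=
    nhdsNE_le_cofinite _ hfin2.compl_mem_cofinite
  obtain ⟨ε, hε1, hε2⟩ := ((hall.filter_mono nhdsWithin_le_nhds).and hgood).exists
  simp only [Set.mem_compl_iff, Set.mem_preimage, Set.mem_ofPred_eq, not_not] at hε2
  choose! Y hYD hYe using hε1
  have hinj : Set.InjOn (fun x => (fun j => Y x j : Fin N → ℝ)) F := by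
    intro a ha b hb hab
    have hab' : Y a = Y b := by ext j; exact congrFun hab j
    by_contra hne
    exact Set.disjoint_left.1 (hD2 ha hb hne) (hYD a ha) (hab' ▸ hYD b hb)
  have hcard := Finset.card_image_of_injOn hinj
  rw [← hcard]
  refine hε2 _ hcard.le ?_
  intro y hy j
  obtain ⟨x, hx, rfl⟩ := Finset.mem_image.1 hy
  have := pderiv_eq_zero_of_extr (f + C ε * P) (Y x) (by simpa using hYe x hx) j
  rw [map_add, pderiv_C_mul, hP, ← mul_assoc, ← C_mul] at this
  exact this

theorem key_one (f : MvPolynomial (Fin 1) ℝ) (hf : f ≠ 0)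
    (F : Finset (EuclideanSpace ℝ (Fin 1)))
    (hF : ∀ x ∈ F, eval (fun j => x j) f = 0) : F.card ≤ f.totalDegree := by
  classical
  let S : Finset ℝ := F.image fun x => x 0
  have hinj : Function.Injective fun x : EuclideanSpace ℝ (Fin 1) => x 0 := by
    intro a b hab
    ext j
    rw [Subsingleton.elim j 0]; exact hab
  have hS : S.card = F.card := Finset.card_image_of_injective _ hinj
  rcases S.eq_empty_or_nonempty with h0 | h0
  · rw [← hS, h0]; simp
  have h := schwartz_zippel_totalDegree hf S
  have h1 : (Fintype.piFinset fun _ : Fin 1 => S).filter (fun x => eval x f = 0)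
      = Fintype.piFinset fun _ : Fin 1 => S := by
    refine Finset.filter_true_of_mem fun y hy => ?_
    obtain ⟨x, hx, hxy⟩ := Finset.mem_image.1 (Fintype.mem_piFinset.1 hy 0)
    have : y = fun j => x j := by
      ext j; rw [Subsingleton.elim j 0]; exact hxy.symm
    rw [this]; exact hF x hx
  rw [h1] at h
  have hpos : (0 : ℚ≥0) < S.card := by exact_mod_cast h0.card_pos
  simp only [Fintype.card_piFinset, Finset.prod_const, Finset.card_univ, Fintype.card_fin, pow_one] at h
  rw [div_le_div_iff_of_pos_right hpos] at h
  rw [← hS]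
  exact_mod_cast h

lemma finite_ncard_of_finset {α : Type*} (s : Set α) (n : ℕ)
    (h : ∀ F : Finset α, (∀ x ∈ F, x ∈ s) → F.card ≤ n) : s.Finite ∧ s.ncard ≤ n := by
  have hs : s.Finite := by
    by_contra hinf
    obtain ⟨t, ht, htc⟩ := Set.Infinite.exists_subset_card_eq hinf (n + 1)
    have := h t (fun x hx => ht hx)
    omega
  refine ⟨hs, ?_⟩
  rw [Set.ncard_eq_toFinset_card s hs]
  exact h _ (fun x hx => by simpa using hx)



/-- The number of real roots of a polynomial `f` of total degree `2k` in `N`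
variables that are isolated over `ℝ` (i.e., isolated points of
`Var_ℝ(f) = {x ∈ ℝ^N : f(x) = 0}`) is at most
`K(N, 2k) = N · 2k · (2k - 1)^(N-1)`. -/
theorem count_isolated_real_roots_le (N k : ℕ) (hN : 1 ≤ N) (hk : 1 ≤ k)
    (f : MvPolynomial (Fin N) ℝ) (hdeg : f.totalDegree = 2 * k) :
    {x : EuclideanSpace ℝ (Fin N) |
        eval (fun j => x j) f = 0 ∧
        ∃ U ∈ nhds x, U ∩ {x' : EuclideanSpace ℝ (Fin N) | eval (fun j => x' j) f = 0}
          = {x}}.Finite ∧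
    {x : EuclideanSpace ℝ (Fin N) |
        eval (fun j => x j) f = 0 ∧
        ∃ U ∈ nhds x, U ∩ {x' : EuclideanSpace ℝ (Fin N) | eval (fun j => x' j) f = 0}
          = {x}}.ncard
      ≤ N * (2 * k) * (2 * k - 1) ^ (N - 1) := by
  refine finite_ncard_of_finset _ _ fun F hF => ?_
  rcases Nat.lt_or_ge 1 N with h2 | h1
  · refine (key N k h2 hk f hdeg F hF).trans ?_
    obtain ⟨n, rfl⟩ : ∃ n, N = n + 1 := ⟨N - 1, by omega⟩
    rw [pow_succ, mul_comm, Nat.add_sub_cancel]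
    refine Nat.mul_le_mul_right _ ?_
    calc 2 * k - 1 ≤ 1 * (2 * k) := by omega
      _ ≤ (n + 1) * (2 * k) := Nat.mul_le_mul_right _ (by omega)
  · obtain rfl : N = 1 := by omega
    have hf : f ≠ 0 := by
      rintro rfl
      simp at hdeg
      omega
    have := key_one f hf F (fun x hx => (hF x hx).1)
    simpa [hdeg] using this
end

section
/- Let N ≥ 1, k ≥ 1, let f : ℂ^N → ℂ be a polynomial of total degree 2k, and let y ∈ ℂ^N, z, γ ∈ ℂ, and α = (α₀, α₁) ∈ ℂ². Consider the polynomial system in the variables (x, λ) ∈ ℂ^N × ℂ² given by f(x) − γz = 0, λ₀(x − y) + λ₁∇f(x) = 0, and α₀λ₀ + α₁λ₁ − 1 = 0. Then the set of isolated solutions of this system is finite and has at most K(N, 2k) := N · 2k · (2k − 1)^{N−1} elements. -/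
open MvPolynomial

lemma exists_point_over {σ : Type} [Finite σ] (P : Ideal (MvPolynomial σ ℂ)) [P.IsPrime] {d : ℕ}
    (g : MvPolynomial (Fin d) ℂ →ₐ[ℂ] (MvPolynomial σ ℂ ⧸ P)) (hinj : Function.Injective g)
    (hgi : g.IsIntegral) (h : MvPolynomial σ ℂ) :
    ∃ μ : Polynomial (MvPolynomial (Fin d) ℂ), μ.Monic ∧
      Polynomial.eval₂ (g : MvPolynomial (Fin d) ℂ →+* (MvPolynomial σ ℂ ⧸ P))
        (Ideal.Quotient.mk P h) μ = 0 ∧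
      ∀ (b : Fin d → ℂ) (τ : ℂ), (μ.map (eval b)).eval τ = 0 →
        ∃ x : σ → ℂ, (∀ f ∈ P, eval x f = 0) ∧ eval x h = τ ∧
          ∀ (c : MvPolynomial (Fin d) ℂ) (c' : MvPolynomial σ ℂ),
            g c = Ideal.Quotient.mk P c' → eval x c' = eval b c := by
  let : Algebra (MvPolynomial (Fin d) ℂ) (MvPolynomial σ ℂ ⧸ P) := g.toRingHom.toAlgebra
  have : FaithfulSMul (MvPolynomial (Fin d) ℂ) (MvPolynomial σ ℂ ⧸ P) :=
    (faithfulSMul_iff_algebraMap_injective _ _).2 hinj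
  set hb : MvPolynomial σ ℂ ⧸ P := Ideal.Quotient.mk P h with hhb
  have hI : IsIntegral (MvPolynomial (Fin d) ℂ) hb := hgi hb
  refine ⟨minpoly _ hb, minpoly.monic hI, minpoly.aeval _ hb, ?_⟩
  intro b τ hτ
  let : Algebra (Polynomial (MvPolynomial (Fin d) ℂ)) (MvPolynomial σ ℂ ⧸ P) :=
    (Polynomial.aeval hb).toRingHom.toAlgebra
  have : IsScalarTower (MvPolynomial (Fin d) ℂ) (Polynomial (MvPolynomial (Fin d) ℂ))
      (MvPolynomial σ ℂ ⧸ P) := IsScalarTower.of_algebraMap_eq (fun x => by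
        change _ = Polynomial.aeval hb (Polynomial.C x)
        simp)
  have : Algebra.IsIntegral (MvPolynomial (Fin d) ℂ) (MvPolynomial σ ℂ ⧸ P) := ⟨hgi⟩
  have : Algebra.IsIntegral (Polynomial (MvPolynomial (Fin d) ℂ)) (MvPolynomial σ ℂ ⧸ P) :=
    Algebra.IsIntegral.tower_top (MvPolynomial (Fin d) ℂ)
  let e : Polynomial (MvPolynomial (Fin d) ℂ) →+* ℂ := Polynomial.eval₂RingHom (eval b) τ
  have he : Function.Surjective e := fun z => ⟨Polynomial.C (C z), by simp [e]⟩
  have : (RingHom.ker e).IsMaximal := RingHom.ker_isMaximal_of_surjective e he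
  obtain ⟨Q, hQ, hQe⟩ := Ideal.exists_ideal_over_maximal_of_isIntegral
    (S := MvPolynomial σ ℂ ⧸ P) (RingHom.ker e) (by
      intro r hr
      have hr' : Polynomial.aeval hb r = 0 := hr
      obtain ⟨q, rfl⟩ := minpoly.isIntegrallyClosed_dvd hI hr'
      have : e (minpoly (MvPolynomial (Fin d) ℂ) hb) = 0 := by
        simpa [e, Polynomial.eval_map] using hτ
      rw [RingHom.mem_ker, map_mul, this, zero_mul])
  have := hQ
  have hQ' : (Q.comap (Ideal.Quotient.mk P)).IsMaximal :=
    Ideal.comap_isMaximal_of_surjective _ Ideal.Quotient.mk_surjective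
  obtain ⟨x, hx⟩ := (isMaximal_iff_eq_vanishingIdeal_singleton (K := ℂ)).1 hQ'
  have key : ∀ (r : Polynomial (MvPolynomial (Fin d) ℂ)) (c' : MvPolynomial σ ℂ),
      Polynomial.aeval hb r = Ideal.Quotient.mk P c' → e r = 0 → eval x c' = 0 := by
    intro r c' hr h0
    have h1 : r ∈ Q.comap (algebraMap (Polynomial (MvPolynomial (Fin d) ℂ))
      (MvPolynomial σ ℂ ⧸ P)) := by rw [hQe]; exact h0
    have h2 : Polynomial.aeval hb r ∈ Q := h1
    rw [hr] at h2
    have h3 : c' ∈ Q.comap (Ideal.Quotient.mk P) := h2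
    rw [hx, mem_vanishingIdeal_singleton_iff] at h3
    simpa using h3
  refine ⟨x, ?_, ?_, ?_⟩
  · intro f hf
    exact key 0 f (by rw [Ideal.Quotient.eq_zero_iff_mem.2 hf]; simp) (by simp)
  · have := key (Polynomial.X - Polynomial.C (C τ)) (h - C τ) (by
      rw [map_sub, map_sub, Polynomial.aeval_X, Polynomial.aeval_C]
      congr 1
      exact g.commutes τ) (by simp [e])
    simpa [sub_eq_zero] using this
  · intro c c' hc
    have := key (Polynomial.C c - Polynomial.C (C (eval b c))) (c' - C (eval b c)) (by
      rw [map_sub, map_sub, Polynomial.aeval_C, Polynomial.aeval_C, ← hc]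
      congr 1
      exact g.commutes _) (by simp [e])
    simpa [sub_eq_zero] using this

lemma height_poly {R : Type} [CommRing R] [IsNoetherianRing R] [IsJacobsonRing R]
    (M : Ideal (Polynomial R)) (hM : M.IsMaximal) :
    (M.comap Polynomial.C).IsMaximal ∧ M.height = (M.comap Polynomial.C).height + 1 := by
  refine ⟨Polynomial.isMaximal_comap_C_of_isJacobsonRing M, ?_⟩
  have : M.LiesOver (M.comap Polynomial.C) := ⟨rfl⟩
  exact Polynomial.height_eq_height_add_one _ M

lemma height_ge {ι : Type} [Finite ι] (M : Ideal (MvPolynomial ι ℂ)) (hM : M.IsMaximal) :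
    (Nat.card ι : ℕ∞) ≤ M.height := by
  induction ι using Finite.induction_empty_option with
  | of_equiv e H =>
    rw [← Nat.card_congr e]
    have h := H (M.comap (renameEquiv ℂ e).toRingEquiv)
      (Ideal.comap_isMaximal_of_surjective _ (renameEquiv ℂ e).toRingEquiv.surjective)
    rwa [RingEquiv.height_comap] at h
  | h_empty => simp
  | h_option IH =>
    rename_i ι _
    let e := (MvPolynomial.optionEquivLeft ℂ ι).toRingEquiv.symm
    have hmax : (M.comap e).IsMaximal := Ideal.comap_isMaximal_of_surjective _ e.surjective
    obtain ⟨h2, h3⟩ := height_poly _ hmax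
    rw [RingEquiv.height_comap] at h3
    rw [h3]
    have := IH _ h2
    simpa using this

lemma noether_points {σ : Type} [Finite σ] (P : Ideal (MvPolynomial σ ℂ)) [P.IsPrime]
    (hmax : ¬ P.IsMaximal) :
    ∃ d : ℕ, d ≠ 0 ∧ ∃ Y : Fin d → MvPolynomial σ ℂ, ∀ h : MvPolynomial σ ℂ,
      ∃ μ : Polynomial (MvPolynomial (Fin d) ℂ), μ.Monic ∧
        (∀ x : σ → ℂ, (∀ f ∈ P, eval x f = 0) →
          (μ.map (eval (fun i => eval x (Y i)))).eval (eval x h) = 0) ∧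
        (∀ (b : Fin d → ℂ) (τ : ℂ), (μ.map (eval b)).eval τ = 0 →
          ∃ x : σ → ℂ, (∀ f ∈ P, eval x f = 0) ∧ eval x h = τ ∧
            ∀ i, eval x (Y i) = b i) := by
  obtain ⟨d, g, hinj, hgi⟩ := exists_integral_inj_algHom_of_fg ℂ (MvPolynomial σ ℂ ⧸ P)
  refine ⟨d, ?_, ?_⟩
  · rintro rfl
    apply hmax
    rw [Ideal.Quotient.maximal_ideal_iff_isField_quotient]
    have hf : IsField (MvPolynomial (Fin 0) ℂ) :=
      MulEquiv.isField (Field.toIsField ℂ) (isEmptyAlgEquiv ℂ (Fin 0)).toMulEquiv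
    let : Algebra (MvPolynomial (Fin 0) ℂ) (MvPolynomial σ ℂ ⧸ P) := g.toRingHom.toAlgebra
    have : Algebra.IsIntegral (MvPolynomial (Fin 0) ℂ) (MvPolynomial σ ℂ ⧸ P) := ⟨hgi⟩
    exact isField_of_isIntegral_of_isField' hf
  · choose Y hY using fun i : Fin d => Ideal.Quotient.mk_surjective (g (X i))
    refine ⟨Y, fun h => ?_⟩
    obtain ⟨μ, hμ, h0, hpt⟩ := exists_point_over P g hinj hgi h
    refine ⟨μ, hμ, ?_, ?_⟩
    · intro x hx
      let ev : (MvPolynomial σ ℂ ⧸ P) →+* ℂ := Ideal.Quotient.lift P (eval x) hx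
      have h1 := congrArg ev h0
      rw [Polynomial.hom_eval₂, map_zero] at h1
      have h2 : ev.comp (g : MvPolynomial (Fin d) ℂ →+* (MvPolynomial σ ℂ ⧸ P))
          = eval (fun i => eval x (Y i)) := by
        apply MvPolynomial.ringHom_ext
        · intro r
          have : g (C r) = Ideal.Quotient.mk P (C r) := g.commutes r
          simp [this, ev]
        · intro i
          simp [← hY, ev]
      rw [h2] at h1
      rw [Polynomial.eval_map]
      simpa [ev] using h1
    · intro b τ hτ
      obtain ⟨x, hx, hxh, hc⟩ := hpt b τ hτ
      exact ⟨x, hx, hxh, fun i => by simpa using hc (X i) (Y i) (hY i).symm⟩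

lemma monic_root_bound (p : Polynomial ℂ) (hp : p.Monic) (n : ℕ) (hn : p.natDegree = n) (τ : ℂ)
    (h : p.eval τ = 0) : ‖τ‖ ≤ 1 + ∑ i ∈ Finset.range n, ‖p.coeff i‖ := by
  have hs : 0 ≤ ∑ i ∈ Finset.range n, ‖p.coeff i‖ := Finset.sum_nonneg fun _ _ => norm_nonneg _
  by_cases hτ : ‖τ‖ ≤ 1
  · linarith
  push Not at hτ
  have hn0 : n ≠ 0 := by
    rintro rfl
    rw [hp.natDegree_eq_zero.1 hn] at h
    simp at h
  obtain ⟨m, rfl⟩ := Nat.exists_eq_succ_of_ne_zero hn0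
  have h1 : τ ^ (m+1) = - ∑ i ∈ Finset.range (m+1), p.coeff i * τ ^ i := by
    rw [Polynomial.eval_eq_sum_range, hn, Finset.sum_range_succ] at h
    have : p.coeff (m+1) = 1 := by rw [← Nat.succ_eq_add_one, ← hn]; exact hp
    rw [this, one_mul] at h
    linear_combination h
  have h2 : ‖τ‖ ^ (m+1) ≤ (∑ i ∈ Finset.range (m+1), ‖p.coeff i‖) * ‖τ‖ ^ m := by
    rw [← norm_pow, h1, norm_neg, Finset.sum_mul]
    refine (norm_sum_le _ _).trans (Finset.sum_le_sum fun i hi => ?_)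
    rw [norm_mul, norm_pow]
    gcongr
    · exact hτ.le
    · have := Finset.mem_range.1 hi; omega
  rw [pow_succ, mul_comm] at h2
  have := le_of_mul_le_mul_right h2 (by positivity)
  simp only [Nat.succ_eq_add_one]
  linarith

lemma monic_small_root (p : Polynomial ℂ) (hp : p.Monic) (n : ℕ) (hn : p.natDegree = n)
    (hn0 : n ≠ 0) : ∃ τ, p.eval τ = 0 ∧ ‖τ‖ ^ n ≤ ‖p.coeff 0‖ := by
  by_contra! hcon
  have hsp : p.Splits := IsAlgClosed.splits p
  have hcard : p.roots.card = n := by rw [← hn]; exact hsp.natDegree_eq_card_roots.symm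
  have hc : ‖p.coeff 0‖ = (p.roots.map (fun τ => ‖τ‖)).prod := by
    rw [hsp.coeff_zero_eq_prod_roots_of_monic hp, norm_mul, norm_pow, norm_neg, norm_one, one_pow,
      one_mul]
    exact map_multiset_prod (normHom : ℂ →*₀ ℝ) _
  set c := ‖p.coeff 0‖ with hcdef
  have hc0 : 0 ≤ c := norm_nonneg _
  -- every root has norm larger than the n-th root of c
  let r : ℝ := c ^ ((1:ℝ)/n)
  have hr0 : 0 ≤ r := Real.rpow_nonneg hc0 _
  have hrn : r ^ n = c := by
    rw [← Real.rpow_natCast, ← Real.rpow_mul hc0, one_div, inv_mul_cancel₀ (by exact_mod_cast hn0),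
      Real.rpow_one]
  have hlt : ∀ τ ∈ p.roots, r < ‖τ‖ := by
    intro τ hτ
    have := hcon τ (Polynomial.isRoot_of_mem_roots hτ)
    rw [← hrn] at this
    exact lt_of_pow_lt_pow_left₀ n (norm_nonneg _) this
  have hlt2 : ∀ s : Multiset ℂ, (∀ τ ∈ s, r < ‖τ‖) → s ≠ 0 →
      r ^ s.card < (s.map (fun τ => ‖τ‖)).prod := by
    intro s
    induction s using Multiset.induction_on with
    | empty => intro _ h; exact absurd rfl h
    | cons a s ih =>
      intro h _
      rw [Multiset.card_cons, Multiset.map_cons, Multiset.prod_cons, pow_succ, mul_comm]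
      have ha : r < ‖a‖ := h a (Multiset.mem_cons_self _ _)
      by_cases hs : s = 0
      · subst hs; simpa using ha
      · have := ih (fun τ hτ => h τ (Multiset.mem_cons_of_mem hτ)) hs
        exact mul_lt_mul'' ha this hr0 (by positivity)
  have := hlt2 p.roots hlt (by intro h; rw [h] at hcard; exact hn0 hcard.symm)
  rw [hcard, hrn, ← hc] at this
  exact lt_irrefl _ this

lemma exists_sep {σ : Type} (T : Finset (σ → ℂ)) (p : σ → ℂ) (hp : p ∉ T) :
    ∃ h : MvPolynomial σ ℂ, eval p h = 1 ∧ ∀ x ∈ T, eval x h = 0 := by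
  classical
  have : ∀ x : σ → ℂ, x ≠ p → ∃ h : MvPolynomial σ ℂ, eval p h = 1 ∧ eval x h = 0 := by
    intro x hx
    obtain ⟨i, hi⟩ := Function.ne_iff.1 hx
    have hi' : p i - x i ≠ 0 := sub_ne_zero.2 (Ne.symm hi)
    refine ⟨C (p i - x i)⁻¹ * (X i - C (x i)), ?_, ?_⟩
    · simp [inv_mul_cancel₀ hi']
    · simp
  choose! h h1 h2 using this
  refine ⟨∏ x ∈ T, h x, ?_, ?_⟩
  · rw [map_prod]
    exact Finset.prod_eq_one fun x hx => h1 x (fun e => hp (e ▸ hx))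
  · intro x hx
    rw [map_prod]
    exact Finset.prod_eq_zero hx (h2 x (fun e => hp (e ▸ hx)))

lemma not_isolated {σ : Type} [Fintype σ] (P : Ideal (MvPolynomial σ ℂ)) [P.IsPrime]
    (hmax : ¬ P.IsMaximal) (p : σ → ℂ) (hp : ∀ f ∈ P, eval p f = 0) (U : Set (σ → ℂ))
    (hU : U ∈ nhds p) : ∃ q ∈ U, q ≠ p ∧ ∀ f ∈ P, eval q f = 0 := by
  classical
  obtain ⟨d, hd, Y, hY⟩ := noether_points P hmax
  choose m hm hmroot _ using fun i : σ => hY (X i)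
  let π : (σ → ℂ) → Fin d → ℂ := fun x i => eval x (Y i)
  have hbound : ∀ x : σ → ℂ, (∀ f ∈ P, eval x f = 0) → ∀ i,
      ‖x i‖ ≤ 1 + ∑ j ∈ Finset.range (m i).natDegree, ‖eval (π x) ((m i).coeff j)‖ := by
    intro x hx i
    have h1 := hmroot i x hx
    rw [eval_X] at h1
    have h2 := monic_root_bound _ ((hm i).map (eval (π x))) _ rfl (x i) h1
    rw [(hm i).natDegree_map] at h2
    simpa using h2
  -- the fibre is finite
  have hfib : {x : σ → ℂ | (∀ f ∈ P, eval x f = 0) ∧ π x = π p}.Finite := by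
    refine Set.Finite.subset (Set.Finite.pi (t := fun i => {τ : ℂ | τ ∈ ((m i).map (eval (π p))).roots})
      (fun i => (((m i).map (eval (π p))).roots.toFinset.finite_toSet).subset (by
        intro τ hτ; simpa using hτ))) ?_
    rintro x ⟨hx, hxp⟩ i -
    have h1 := hmroot i x hx
    rw [eval_X] at h1
    change ((m i).map (eval (π x))).eval (x i) = 0 at h1
    rw [hxp] at h1
    exact (Polynomial.mem_roots ((hm i).map _).ne_zero).2 h1
  obtain ⟨h', hh1, hh2⟩ := exists_sep (hfib.toFinset.erase p) p (by simp)
  obtain ⟨μ, hμ, hμroot, hμpt⟩ := hY (1 - h')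
  have hq0 : (μ.map (eval (π p))).coeff 0 = 0 := by
    have := hμroot p hp
    rw [map_sub, hh1, map_one, sub_self] at this
    rw [Polynomial.coeff_zero_eq_eval_zero]
    exact this
  have hμd : μ.natDegree ≠ 0 := by
    intro h0
    rw [hμ.natDegree_eq_zero.1 h0] at hq0
    simp at hq0
  let b : ℕ → Fin d → ℂ := fun k i => π p i + 1 / ((k : ℂ) + 1)
  have hb : Filter.Tendsto b Filter.atTop (nhds (π p)) := by
    rw [tendsto_pi_nhds]
    intro i
    have := (tendsto_one_div_add_atTop_nhds_zero_nat (𝕜 := ℂ)).const_add (π p i)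
    simpa [b] using this
  have hroot : ∀ k, ∃ τ, (μ.map (eval (b k))).eval τ = 0 ∧
      ‖τ‖ ^ μ.natDegree ≤ ‖eval (b k) (μ.coeff 0)‖ := by
    intro k
    have := monic_small_root _ (hμ.map (eval (b k))) μ.natDegree (hμ.natDegree_map _) hμd
    simpa using this
  choose τ hτ hτs using hroot
  choose x hxP hxh hxY using fun k => hμpt (b k) (τ k) (hτ k)
  have hπx : ∀ k, π (x k) = b k := fun k => funext (hxY k)
  have hτ0 : Filter.Tendsto τ Filter.atTop (nhds 0) := by
    have h1 : Filter.Tendsto (fun k => ‖eval (b k) (μ.coeff 0)‖) Filter.atTop (nhds 0) := by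
      have : Filter.Tendsto (fun k => ‖eval (b k) (μ.coeff 0)‖) Filter.atTop
          (nhds ‖eval (π p) (μ.coeff 0)‖) :=
        (((MvPolynomial.continuous_eval (μ.coeff 0)).norm.tendsto (π p))).comp hb
      rw [Polynomial.coeff_map] at hq0
      rwa [hq0, norm_zero] at this
    have h2 : Filter.Tendsto (fun k => ‖τ k‖ ^ μ.natDegree) Filter.atTop (nhds 0) :=
      squeeze_zero (fun k => by positivity) hτs h1
    rw [tendsto_zero_iff_norm_tendsto_zero]
    rw [Metric.tendsto_atTop] at h2 ⊢
    intro ε hε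
    obtain ⟨K, hK⟩ := h2 (ε ^ μ.natDegree) (by positivity)
    refine ⟨K, fun n hn => ?_⟩
    have := hK n hn
    rw [Real.dist_eq, sub_zero, abs_of_nonneg (by positivity)] at this ⊢
    exact lt_of_pow_lt_pow_left₀ _ hε.le this
  -- boundedness
  have hbd : ∀ i, ∃ R : ℝ, ∀ k, ‖x k i‖ ≤ R := by
    intro i
    have hc : Continuous fun v : Fin d → ℂ =>
        1 + ∑ j ∈ Finset.range (m i).natDegree, ‖eval v ((m i).coeff j)‖ :=
      continuous_const.add (continuous_finsetSum _ fun j _ =>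
        (MvPolynomial.continuous_eval _).norm)
    obtain ⟨R, hR⟩ := ((hc.tendsto (π p)).comp hb).bddAbove_range
    refine ⟨R, fun k => (hbound (x k) (hxP k) i).trans ?_⟩
    rw [hπx k]
    exact hR ⟨k, rfl⟩
  choose R hR using hbd
  have hcomp : IsCompact (Set.pi Set.univ fun i => Metric.closedBall (0 : ℂ) (R i)) :=
    isCompact_univ_pi fun i => isCompact_closedBall _ _
  obtain ⟨xs, -, φ, hφ, hlim⟩ := hcomp.tendsto_subseq (x := x) (by
    intro k i _
    simpa using hR i k)
  have hev : ∀ f : MvPolynomial σ ℂ, Filter.Tendsto (fun k => eval (x (φ k)) f) Filter.atTop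
      (nhds (eval xs f)) := fun f =>
    ((MvPolynomial.continuous_eval f).tendsto xs).comp hlim
  have hxsP : ∀ f ∈ P, eval xs f = 0 := by
    intro f hf
    refine tendsto_nhds_unique (hev f) ?_
    simp [hxP _ f hf]
  have hxsπ : π xs = π p := by
    funext i
    refine tendsto_nhds_unique (hev (Y i)) ?_
    have := ((tendsto_pi_nhds.1 hb) i).comp hφ.tendsto_atTop
    refine this.congr fun k => ?_
    exact (hxY (φ k) i).symm
  have hxsh : eval xs (1 - h') = 0 := by
    refine tendsto_nhds_unique (hev _) ?_
    refine (hτ0.comp hφ.tendsto_atTop).congr fun k => ?_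
    exact (hxh (φ k)).symm
  have hxsp : xs = p := by
    by_contra hne
    have := hh2 xs (by simpa [hne] using ⟨hxsP, hxsπ⟩)
    rw [map_sub, this] at hxsh
    simp at hxsh
  subst hxsp
  obtain ⟨k, hk⟩ := (hlim.eventually hU).exists
  refine ⟨x (φ k), hk, ?_, hxP _⟩
  intro heq
  have h1 := hπx (φ k)
  rw [heq] at h1
  have h2 := congrFun h1 ⟨0, Nat.pos_of_ne_zero hd⟩
  have h3 : (1 : ℂ) / ((φ k : ℂ) + 1) = 0 := by
    have : b (φ k) ⟨0, Nat.pos_of_ne_zero hd⟩ = π xs ⟨0, Nat.pos_of_ne_zero hd⟩ + 1 / ((φ k : ℂ) + 1) := rfl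
    rw [this] at h2
    linear_combination -h2
  exact one_div_ne_zero (Nat.cast_add_one_ne_zero (φ k)) h3

lemma exists_prime_curve {σ : Type} [Fintype σ] (F G : σ → MvPolynomial σ ℂ) (p : σ → ℂ)
    (hF : ∀ i, eval p (F i) = 0)
    (hiso : ∃ U ∈ nhds p, ∀ q ∈ U, (∀ i, eval q (F i) = 0) → q = p) :
    ∃ P : Ideal (Polynomial (MvPolynomial σ ℂ)), P.IsPrime ∧
      (∀ i, Polynomial.C (F i) + Polynomial.X * Polynomial.C (G i) ∈ P) ∧
      Polynomial.X ∉ P ∧ ∀ h ∈ P, eval p (h.coeff 0) = 0 := by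
  classical
  let ev : Polynomial (MvPolynomial σ ℂ) →+* ℂ := (eval p).comp Polynomial.constantCoeff
  have hev : ∀ h, ev h = eval p (h.coeff 0) := fun h => rfl
  have hsurj : Function.Surjective ev := fun z => ⟨Polynomial.C (C z), by simp [hev]⟩
  have hmax : (RingHom.ker ev).IsMaximal := RingHom.ker_isMaximal_of_surjective ev hsurj
  let S : Set (Polynomial (MvPolynomial σ ℂ)) :=
    Set.range fun i => Polynomial.C (F i) + Polynomial.X * Polynomial.C (G i)
  have hSfin : S.Finite := Set.finite_range _
  have hle : Ideal.span S ≤ RingHom.ker ev := by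
    rw [Ideal.span_le]
    rintro _ ⟨i, rfl⟩
    simp [hev, hF]
  have := hmax.isPrime
  obtain ⟨P, hP, hPle⟩ := Ideal.exists_minimalPrimes_le hle
  have hPprime : P.IsPrime := hP.1.1
  have hht : P.height ≤ (Fintype.card σ : ℕ∞) := by
    refine (Ideal.height_le_card_of_mem_minimalPrimes_span hSfin hP).trans ?_
    norm_cast
    have := Finset.card_image_le (s := Finset.univ)
      (f := fun i => Polynomial.C (F i) + Polynomial.X * Polynomial.C (G i))
    rw [← Set.ncard_coe_finset] at this
    simpa [S] using this
  have hne : P ≠ RingHom.ker ev := by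
    rintro rfl
    obtain ⟨h1, h2⟩ := height_poly _ hmax
    have h3 := height_ge _ h1
    rw [h2] at hht
    rw [Nat.card_eq_fintype_card] at h3
    have h4 := (add_le_add_left h3 1).trans hht
    norm_cast at h4
    omega
  have hmem : ∀ i, Polynomial.C (F i) + Polynomial.X * Polynomial.C (G i) ∈ P := fun i =>
    hP.1.2 (Ideal.subset_span ⟨i, rfl⟩)
  refine ⟨P, hPprime, hmem, ?_, fun h hh => hPle hh⟩
  intro hX
  let P0 : Ideal (MvPolynomial σ ℂ) := P.comap Polynomial.C
  have hP0 : P0.IsPrime := Ideal.comap_isPrime _ _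
  have hFP0 : ∀ i, F i ∈ P0 := by
    intro i
    have h1 : Polynomial.X * Polynomial.C (G i) ∈ P := Ideal.mul_mem_right _ _ hX
    have := Ideal.sub_mem _ (hmem i) h1
    rw [add_sub_cancel_right] at this
    exact this
  have hP0p : ∀ f ∈ P0, eval p f = 0 := by
    intro f hf
    have : Polynomial.C f ∈ RingHom.ker ev := hPle hf
    simpa [hev, RingHom.mem_ker] using this
  have hP0max : ¬ P0.IsMaximal := by
    intro hm
    apply hne
    have h1 : P0 = RingHom.ker (eval p) :=
      hm.eq_of_le (RingHom.ker_ne_top _) (fun f hf => hP0p f hf)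
    refine le_antisymm hPle fun h hh => ?_
    have h2 : h.coeff 0 ∈ P0 := by rw [h1]; exact hh
    have h3 : Polynomial.C (h.coeff 0) ∈ P := h2
    rw [← Polynomial.divX_mul_X_add h]
    exact Ideal.add_mem _ (Ideal.mul_mem_left _ _ hX) h3
  obtain ⟨U, hU, hiso⟩ := hiso
  obtain ⟨q, hqU, hqp, hq⟩ := not_isolated P0 hP0max p hP0p U hU
  exact hqp (hiso q hqU fun i => hq _ (hFP0 i))

lemma lin_indep_pencil {D r : ℕ} (u v : Fin r → Fin D → ℂ) (hu : LinearIndependent ℂ u)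
    (a : Fin r → Polynomial ℂ)
    (h : ∀ t, ∑ i, a i * (Polynomial.C (v i t) + Polynomial.X * Polynomial.C (u i t)) = 0) :
    a = 0 := by
  by_contra hne
  obtain ⟨i0, hi0⟩ := Function.ne_iff.1 hne
  obtain ⟨j, -, hj⟩ := Finset.exists_max_image Finset.univ (fun i => (a i).degree)
    ⟨i0, Finset.mem_univ _⟩
  have hj0 : a j ≠ 0 := by
    intro h0
    have := hj i0 (Finset.mem_univ _)
    rw [h0, Polynomial.degree_zero, le_bot_iff, Polynomial.degree_eq_bot] at this
    exact hi0 this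
  set n := (a j).natDegree with hn
  have hle : ∀ i, (a i).natDegree ≤ n := fun i =>
    Polynomial.natDegree_le_natDegree (hj i (Finset.mem_univ _))
  have hz : ∀ i, (a i).coeff (n+1) = 0 := fun i =>
    Polynomial.coeff_eq_zero_of_natDegree_lt (by have := hle i; omega)
  have hs : ∑ i, (a i).coeff n • u i = 0 := by
    funext t
    have := congrArg (fun q => Polynomial.coeff q (n+1)) (h t)
    simp only [Polynomial.finsetSum_coeff, mul_add, Polynomial.coeff_add, ← mul_assoc,
      Polynomial.coeff_mul_C, Polynomial.coeff_mul_X, hz, zero_mul, zero_add,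
      Polynomial.coeff_zero] at this
    simpa using this
  have := Fintype.linearIndependent_iff.1 hu _ hs j
  exact hj0 (Polynomial.leadingCoeff_eq_zero.1 this)

lemma exists_normalized {κ : Type} [Fintype κ] (c : κ → Polynomial ℂ) (hc : c ≠ 0) :
    ∃ (e : ℕ) (c' : κ → Polynomial ℂ), (∀ k, c k = Polynomial.X ^ e * c' k) ∧
      ∃ k, (c' k).coeff 0 ≠ 0 := by
  classical
  obtain ⟨k0, hk0⟩ := Function.ne_iff.1 hc
  obtain ⟨j, hjm, hj⟩ := Finset.exists_min_image (Finset.univ.filter fun k => c k ≠ 0)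
    (fun k => (c k).natTrailingDegree) ⟨k0, by simpa using hk0⟩
  have hj0 : c j ≠ 0 := (Finset.mem_filter.1 hjm).2
  have hdvd : ∀ k, Polynomial.X ^ (c j).natTrailingDegree ∣ c k := by
    intro k
    by_cases hk : c k = 0
    · rw [hk]; exact dvd_zero _
    rw [Polynomial.X_pow_dvd_iff]
    intro d hd
    exact Polynomial.coeff_eq_zero_of_lt_natTrailingDegree
      (hd.trans_le (hj k (by simpa using hk)))
  choose c' hc' using hdvd
  refine ⟨_, c', hc', j, ?_⟩
  have h1 : (c j).coeff (c j).natTrailingDegree ≠ 0 := by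
    simpa [Polynomial.trailingCoeff] using Polynomial.trailingCoeff_nonzero_iff_nonzero.2 hj0
  intro h0
  apply h1
  nth_rewrite 1 [hc' j]
  rw [Polynomial.coeff_X_pow_mul', if_pos le_rfl, Nat.sub_self, h0]

lemma pencil_relation {M : Type} [CommRing M] [Algebra ℂ M] (V W : Submodule ℂ M)
    [FiniteDimensional ℂ V] (J : Ideal (Polynomial M)) (K : ℕ) (hWV : W ≤ V)
    (hW : ∀ u ∈ W, ∃ v ∈ V, Polynomial.C v + Polynomial.X * Polynomial.C u ∈ J)
    (hfr : Module.finrank ℂ V ≤ Module.finrank ℂ W + K)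
    {κ : Type} [Fintype κ] (L : κ → M) (hL : ∀ k, L k ∈ V) (hκ : K < Fintype.card κ) :
    ∃ c : κ → Polynomial ℂ, (∃ k, (c k).coeff 0 ≠ 0) ∧ ∃ e : ℕ,
      Polynomial.X ^ e * ∑ k, (c k).map (algebraMap ℂ M) * Polynomial.C (L k) ∈ J := by
  classical
  have : FiniteDimensional ℂ W := Submodule.finiteDimensional_of_le hWV
  set D := Module.finrank ℂ V with hD
  set r := Module.finrank ℂ W with hr
  let bV := Module.finBasis ℂ V
  let bW := Module.finBasis ℂ W
  choose v hv hJ using fun i : Fin r => hW (bW i) (bW i).2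
  let co : M → Fin D → ℂ := fun m t => if h : m ∈ V then bV.repr ⟨m, h⟩ t else 0
  have hco : ∀ m ∈ V, m = ∑ t, co m t • (bV t : M) := by
    intro m hm
    have h1 := congrArg (fun z : V => (z : M)) (bV.sum_repr ⟨m, hm⟩)
    simp only [AddSubmonoidClass.coe_finsetSum, Submodule.coe_smul] at h1
    simp only [co, hm, dif_pos]
    exact h1.symm
  have hcoC : ∀ m ∈ V, Polynomial.C m =
      ∑ t, (Polynomial.C (co m t)).map (algebraMap ℂ M) * Polynomial.C (bV t : M) := by
    intro m hm
    conv_lhs => rw [hco m hm]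
    rw [map_sum]
    refine Finset.sum_congr rfl fun t _ => ?_
    rw [Polynomial.map_C, Algebra.smul_def, map_mul]
  have hu : LinearIndependent ℂ fun i : Fin r => co (bW i) := by
    rw [Fintype.linearIndependent_iff]
    intro g hg
    have h1 : ∑ i, g i • bW i = 0 := by
      apply Subtype.ext
      rw [AddSubmonoidClass.coe_finsetSum]
      simp only [Submodule.coe_smul, ZeroMemClass.coe_zero]
      calc ∑ i, g i • (bW i : M) = ∑ i, g i • ∑ t, co (bW i) t • (bV t : M) :=
            Finset.sum_congr rfl fun i _ => by rw [← hco _ (hWV (bW i).2)]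
        _ = ∑ t, (∑ i, g i • co (bW i)) t • (bV t : M) := by
            simp_rw [Finset.smul_sum, Finset.sum_apply, Finset.sum_smul]
            rw [Finset.sum_comm]
            simp [smul_smul]
        _ = 0 := by rw [hg]; simp
    exact Fintype.linearIndependent_iff.1 bW.linearIndependent g h1
  let vec : Fin r ⊕ κ → Fin D → Polynomial ℂ := Sum.elim
    (fun i t => Polynomial.C (co (v i) t) + Polynomial.X * Polynomial.C (co (bW i) t))
    (fun k t => Polynomial.C (co (L k) t))
  have hdep : ¬ LinearIndependent (Polynomial ℂ) vec := by
    intro hli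
    have := hli.fintype_card_le_finrank
    simp at this
    omega
  obtain ⟨g, hg, i0, hi0⟩ := Fintype.not_linearIndependent_iff.1 hdep
  let a : Fin r → Polynomial ℂ := fun i => g (Sum.inl i)
  let c : κ → Polynomial ℂ := fun k => g (Sum.inr k)
  have hrel : ∀ t, ∑ i, a i * (Polynomial.C (co (v i) t) + Polynomial.X * Polynomial.C (co (bW i) t))
      + ∑ k, c k * Polynomial.C (co (L k) t) = 0 := by
    intro t
    have := congrFun hg t
    simpa [Fintype.sum_sum_type, vec, a, c] using this
  have hc : c ≠ 0 := by
    intro hc0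
    have ha : a = 0 := by
      refine lin_indep_pencil (fun i => co (bW i)) (fun i => co (v i)) hu a fun t => ?_
      have := hrel t
      simpa [hc0] using this
    rcases i0 with i | k
    · exact hi0 (congrFun ha i)
    · exact hi0 (congrFun hc0 k)
  obtain ⟨e, c', hc', hk⟩ := exists_normalized c hc
  refine ⟨c', hk, e, ?_⟩
  have hsum : ∑ i, (a i).map (algebraMap ℂ M) *
        (Polynomial.C (v i) + Polynomial.X * Polynomial.C (bW i : M))
      + ∑ k, (c k).map (algebraMap ℂ M) * Polynomial.C (L k) = 0 := by
    let φ := Polynomial.mapRingHom (algebraMap ℂ M)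
    have hφ : ∀ q : Polynomial ℂ, q.map (algebraMap ℂ M) = φ q := fun _ => rfl
    calc _ = ∑ t, φ (∑ i, a i * (Polynomial.C (co (v i) t) +
              Polynomial.X * Polynomial.C (co (bW i) t))
            + ∑ k, c k * Polynomial.C (co (L k) t)) * Polynomial.C (bV t : M) := by
          simp only [map_add, map_sum, map_mul, add_mul, Finset.sum_mul, Finset.sum_add_distrib]
          congr 1
          · rw [Finset.sum_comm]
            refine Finset.sum_congr rfl fun i _ => ?_
            conv_lhs => rw [hcoC _ (hv i), hcoC _ (hWV (bW i).2)]
            rw [Finset.mul_sum, ← Finset.sum_add_distrib, Finset.mul_sum]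
            refine Finset.sum_congr rfl fun t _ => ?_
            have : φ Polynomial.X = Polynomial.X := Polynomial.map_X _
            rw [this, hφ, hφ, hφ]
            ring
          · rw [Finset.sum_comm]
            refine Finset.sum_congr rfl fun k _ => ?_
            conv_lhs => rw [hcoC _ (hL k)]
            rw [Finset.mul_sum]
            refine Finset.sum_congr rfl fun t _ => ?_
            rw [hφ, hφ]
            ring
      _ = 0 := Finset.sum_eq_zero fun t _ => by rw [hrel t, map_zero, zero_mul]
  have hmemJ : ∑ i, (a i).map (algebraMap ℂ M) *
        (Polynomial.C (v i) + Polynomial.X * Polynomial.C (bW i : M)) ∈ J :=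
    Ideal.sum_mem _ fun i _ => Ideal.mul_mem_left _ _ (hJ i)
  have h2 : ∑ k, (c k).map (algebraMap ℂ M) * Polynomial.C (L k) ∈ J := by
    rw [eq_neg_of_add_eq_zero_right hsum]
    exact J.neg_mem hmemJ
  have h3 : Polynomial.X ^ e * ∑ k, (c' k).map (algebraMap ℂ M) * Polynomial.C (L k)
      = ∑ k, (c k).map (algebraMap ℂ M) * Polynomial.C (L k) := by
    rw [Finset.mul_sum]
    refine Finset.sum_congr rfl fun k _ => ?_
    rw [hc' k]
    simp [mul_assoc]
  rw [h3]
  exact h2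

/-- Counting isolated zeros through a pencil. -/
lemma card_le_of_pencil {σ : Type} [Fintype σ] (F G : σ → MvPolynomial σ ℂ)
    (T : Finset (σ → ℂ)) (hT : ∀ p ∈ T, (∀ i, eval p (F i) = 0) ∧
      ∃ U ∈ nhds p, ∀ q ∈ U, (∀ i, eval q (F i) = 0) → q = p) (K : ℕ)
    (hV : ∀ n : ℕ, ∃ V W : Submodule ℂ (MvPolynomial σ ℂ), FiniteDimensional ℂ V ∧ W ≤ V ∧
      (∀ h : MvPolynomial σ ℂ, h.totalDegree ≤ n → h ∈ V) ∧
      (∀ u ∈ W, ∃ v ∈ V, Polynomial.C v + Polynomial.X * Polynomial.C u ∈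
        Ideal.span (Set.range fun i => Polynomial.C (F i) + Polynomial.X * Polynomial.C (G i))) ∧
      Module.finrank ℂ V ≤ Module.finrank ℂ W + K) : T.card ≤ K := by
  classical
  by_contra! hcon
  choose L hL1 hL2 using fun p : T => exists_sep (T.erase p) p.1 (by simp)
  obtain ⟨V, W, hfd, hWV, hdeg, hW, hfr⟩ := hV (∑ p, (L p).totalDegree)
  obtain ⟨c, ⟨k, hk⟩, e, hmem⟩ := pencil_relation V W _ K hWV hW hfr L
    (fun p => hdeg _ (Finset.single_le_sum (f := fun p => (L p).totalDegree)
      (fun _ _ => Nat.zero_le _) (Finset.mem_univ p))) (by simpa using hcon)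
  obtain ⟨P, hP, hFP, hX, hPp⟩ := exists_prime_curve F G k.1 (hT k.1 k.2).1 (hT k.1 k.2).2
  have hle : Ideal.span (Set.range fun i =>
      Polynomial.C (F i) + Polynomial.X * Polynomial.C (G i)) ≤ P := by
    rw [Ideal.span_le]
    rintro _ ⟨i, rfl⟩
    exact hFP i
  have h1 := (hP.mem_or_mem (hle hmem)).resolve_left fun h => hX (hP.mem_of_pow_mem _ h)
  have h2 := hPp _ h1
  apply hk
  rw [Polynomial.finsetSum_coeff, map_sum, Finset.sum_eq_single k] at h2
  · simpa [hL1] using h2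
  · intro j _ hj
    have : eval k.1 (L j) = 0 := hL2 j k.1 (by
      rw [Finset.mem_erase]
      exact ⟨fun h => hj (Subtype.ext h.symm), k.2⟩)
    simp [this]
  · simp

/-- Exponents with `x`-degree at most `a` and `t`-degree at most `b`. -/
def bdSet (N a b : ℕ) : Set (Option (Fin N) →₀ ℕ) :=
  {m | ∑ j, m (some j) ≤ a ∧ m none ≤ b}

/-- Polynomials with `x`-degree at most `a` and `t`-degree at most `b`. -/
noncomputable def bdV (N a b : ℕ) : Submodule ℂ (MvPolynomial (Option (Fin N)) ℂ) :=
  restrictSupport ℂ (bdSet N a b)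

lemma bdSet_finite (N a b : ℕ) : (bdSet N a b).Finite := by
  refine (Set.finite_Iic (Finsupp.equivFunOnFinite.symm
    (fun _ : Option (Fin N) => a + b))).subset ?_
  rintro m ⟨h1, h2⟩ i
  rcases i with _ | j
  · simp; omega
  · have := Finset.single_le_sum (f := fun j => m (some j)) (fun _ _ => Nat.zero_le _)
      (Finset.mem_univ j)
    simp at this ⊢
    omega

lemma bdV_finite (N a b : ℕ) : FiniteDimensional ℂ (bdV N a b) := by
  have := (bdSet_finite N a b).to_subtype
  exact Module.Finite.of_basis (basisRestrictSupport ℂ (bdSet N a b))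

lemma mem_bdV {N a b : ℕ} {p : MvPolynomial (Option (Fin N)) ℂ} :
    p ∈ bdV N a b ↔ ∀ m ∈ p.support, ∑ j, m (some j) ≤ a ∧ m none ≤ b := by
  rw [bdV, mem_restrictSupport_iff]
  rfl

lemma bdV_mono {N a b a' b' : ℕ} (ha : a ≤ a') (hb : b ≤ b') : bdV N a b ≤ bdV N a' b' :=
  restrictSupport_mono _ fun _ hm => ⟨hm.1.trans ha, hm.2.trans hb⟩

lemma bdV_mul {N a b a' b' : ℕ} {p q : MvPolynomial (Option (Fin N)) ℂ} (hp : p ∈ bdV N a b)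
    (hq : q ∈ bdV N a' b') : p * q ∈ bdV N (a + a') (b + b') := by
  classical
  rw [mem_bdV] at *
  intro m hm
  obtain ⟨m1, h1, m2, h2, rfl⟩ := Finset.mem_add.1 (support_mul p q hm)
  have := hp m1 h1
  have := hq m2 h2
  simp only [Finsupp.add_apply, Finset.sum_add_distrib]
  omega

lemma monomial_mem_bdV {N a b : ℕ} (m : Option (Fin N) →₀ ℕ) (c : ℂ)
    (h1 : ∑ j, m (some j) ≤ a) (h2 : m none ≤ b) : monomial m c ∈ bdV N a b := by
  rw [bdV, monomial_mem_restrictSupport]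
  exact Or.inl ⟨h1, h2⟩

lemma mem_bdV_of_totalDegree {N n a b : ℕ} (p : MvPolynomial (Option (Fin N)) ℂ)
    (hp : p.totalDegree ≤ n) (ha : n ≤ a) (hb : n ≤ b) : p ∈ bdV N a b := by
  rw [mem_bdV]
  intro m hm
  have h1 := (le_totalDegree hm).trans hp
  rw [Finsupp.sum_fintype _ _ (fun _ => rfl), Fintype.sum_option] at h1
  omega

/-- The start system. -/
noncomputable def startG (N δ : ℕ) : Option (Fin N) → MvPolynomial (Option (Fin N)) ℂ
  | none => 1
  | some j => monomial (Finsupp.single (some j) δ) 1 * (X none - C ((j : ℕ) : ℂ))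

lemma startG_some_mem (N δ : ℕ) (j : Fin N) : startG N δ (some j) ∈ bdV N δ 1 := by
  have h1 : (monomial (Finsupp.single (some j) δ) 1 : MvPolynomial (Option (Fin N)) ℂ)
      ∈ bdV N δ 0 := by
    refine monomial_mem_bdV _ _ ?_ (by simp)
    simp [Finsupp.single_apply]
  have h2 : (X none - C ((j : ℕ) : ℂ) : MvPolynomial (Option (Fin N)) ℂ) ∈ bdV N 0 1 := by
    refine Submodule.sub_mem _ ?_ ?_
    · exact monomial_mem_bdV _ _ (by simp [Finsupp.single_apply]) (by simp)
    · exact monomial_mem_bdV _ _ (by simp) (by simp)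
  have h3 := bdV_mul h1 h2
  rw [Nat.add_zero, Nat.zero_add] at h3
  exact h3

/-- Index type for the complementary monomials. -/
abbrev ExcIdx (N δ : ℕ) : Type := Σ j : Fin N, ({i : Fin N // i ≠ j} → Fin δ) × Fin (δ + 1)

lemma card_ExcIdx (N δ : ℕ) : Fintype.card (ExcIdx N δ) = N * (δ + 1) * δ ^ (N - 1) := by
  simp [ExcIdx, Fintype.card_subtype_compl]
  ring

/-- The complementary exponents. -/
noncomputable def excExp (N δ a : ℕ) (e : ExcIdx N δ) : Option (Fin N) →₀ ℕ :=
  Finsupp.equivFunOnFinite.symm fun i => match i with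
    | none => 0
    | some i => if h : i = e.1 then a - e.2.2 - ∑ l, (e.2.1 l : ℕ) else (e.2.1 ⟨i, h⟩ : ℕ)

lemma exists_excExp (N δ a : ℕ) (e : Option (Fin N) →₀ ℕ) (h0 : e none = 0)
    (ha : ∑ j, e (some j) ≤ a) (ha' : a ≤ ∑ j, e (some j) + δ) (j : Fin N)
    (hj : ∀ l, l ≠ j → e (some l) < δ) : ∃ x, excExp N δ a x = e := by
  classical
  refine ⟨⟨j, fun l => ⟨e (some l.1), hj l.1 l.2⟩, ⟨a - ∑ j, e (some j), by omega⟩⟩, ?_⟩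
  ext i
  rcases i with _ | i
  · simp [excExp, h0]
  · by_cases h : i = j
    · subst h
      simp only [excExp, Finsupp.equivFunOnFinite_symm_apply_apply, dif_pos]
      have hs : ∑ j, e (some j) = e (some i) + ∑ l : {l : Fin N // l ≠ i}, e (some l.1) := by
        rw [← Finset.add_sum_erase _ _ (Finset.mem_univ i)]
        congr 1
        exact (Finset.sum_subtype _ (by simp) _)
      omega
    · simp [excExp, h]

lemma pencil_space (N δ : ℕ) (F : Option (Fin N) → MvPolynomial (Option (Fin N)) ℂ)
    (hF0 : F none ∈ bdV N (δ + 1) 0) (hFj : ∀ j, F (some j) ∈ bdV N δ 1) (n : ℕ) :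
    ∃ V W : Submodule ℂ (MvPolynomial (Option (Fin N)) ℂ), FiniteDimensional ℂ V ∧ W ≤ V ∧
      (∀ h : MvPolynomial (Option (Fin N)) ℂ, h.totalDegree ≤ n → h ∈ V) ∧
      (∀ u ∈ W, ∃ v ∈ V, Polynomial.C v + Polynomial.X * Polynomial.C u ∈
        Ideal.span (Set.range fun i => Polynomial.C (F i) +
          Polynomial.X * Polynomial.C (startG N δ i))) ∧
      Module.finrank ℂ V ≤ Module.finrank ℂ W + N * (δ + 1) * δ ^ (N - 1) := by
  classical
  set J := Ideal.span (Set.range fun i => Polynomial.C (F i) +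
          Polynomial.X * Polynomial.C (startG N δ i)) with hJ
  obtain ⟨a, ha⟩ : ∃ a, a = N * δ + δ + 1 + n := ⟨_, rfl⟩
  obtain ⟨b, hb⟩ : ∃ b, b = n + 1 := ⟨_, rfl⟩
  let W : Submodule ℂ (MvPolynomial (Option (Fin N)) ℂ) :=
    { carrier := {u | u ∈ bdV N a b ∧ ∃ v ∈ bdV N a b,
        Polynomial.C v + Polynomial.X * Polynomial.C u ∈ J}
      zero_mem' := ⟨zero_mem _, 0, zero_mem _, by simp⟩
      add_mem' := by
        rintro u u' ⟨hu, v, hv, h⟩ ⟨hu', v', hv', h'⟩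
        refine ⟨add_mem hu hu', v + v', add_mem hv hv', ?_⟩
        have := J.add_mem h h'
        convert this using 1
        simp only [map_add]
        ring
      smul_mem' := by
        rintro c u ⟨hu, v, hv, h⟩
        refine ⟨Submodule.smul_mem _ _ hu, c • v, Submodule.smul_mem _ _ hv, ?_⟩
        have := J.mul_mem_left (Polynomial.C (C c)) h
        convert this using 1
        rw [MvPolynomial.smul_eq_C_mul, MvPolynomial.smul_eq_C_mul, map_mul, map_mul]
        ring }
  have hWmem : ∀ u, u ∈ W ↔ u ∈ bdV N a b ∧ ∃ v ∈ bdV N a b,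
        Polynomial.C v + Polynomial.X * Polynomial.C u ∈ J := fun _ => Iff.rfl
  have hqW : ∀ q i, q * startG N δ i ∈ bdV N a b → q * F i ∈ bdV N a b →
      q * startG N δ i ∈ W := by
    intro q i h1 h2
    refine ⟨h1, _, h2, ?_⟩
    have : Polynomial.C (F i) + Polynomial.X * Polynomial.C (startG N δ i) ∈ J :=
      Ideal.subset_span ⟨i, rfl⟩
    have := J.mul_mem_left (Polynomial.C q) this
    convert this using 1
    simp only [map_mul]
    ring
  have hq0 : ∀ q ∈ bdV N (N * δ + n) b, q ∈ W := by
    intro q hq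
    have h1 : q * startG N δ none = q := by simp [startG]
    rw [← h1]
    refine hqW q none ?_ ?_
    · rw [h1]; exact bdV_mono (by omega) le_rfl hq
    · exact bdV_mono (by omega) (by omega) (bdV_mul hq hF0)
  have hqj : ∀ q ∈ bdV N (N * δ + 1 + n) n, ∀ j, q * startG N δ (some j) ∈ W := by
    intro q hq j
    refine hqW q (some j) ?_ ?_
    · exact bdV_mono (by omega) (by omega) (bdV_mul hq (startG_some_mem N δ j))
    · exact bdV_mono (by omega) (by omega) (bdV_mul hq (hFj j))
  -- claim B
  have hB : ∀ (e : Option (Fin N) →₀ ℕ) (i : ℕ) (j : Fin N), e none = 0 →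
      ∑ l, e (some l) ≤ a → i ≤ n → δ ≤ e (some j) →
      monomial (e + Finsupp.single none (i + 1)) (1 : ℂ) -
        ((j : ℕ) : ℂ) • monomial (e + Finsupp.single none i) (1 : ℂ) ∈ W := by
    intro e i j h0 hs hi hδ
    have hsub : Finsupp.single (some j) δ ≤ e := by
      rw [Finsupp.single_le_iff]; exact hδ
    obtain ⟨e', he'⟩ : ∃ e', e = e' + Finsupp.single (some j) δ :=
      ⟨e - Finsupp.single (some j) δ, (tsub_add_cancel_of_le hsub).symm⟩
    have hsum : ∑ l, e (some l) = ∑ l, e' (some l) + δ := by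
      rw [he']
      simp [Finset.sum_add_distrib, Finsupp.single_apply]
    have he0 : e' none = 0 := by rw [he'] at h0; simpa using h0
    have := hqj (monomial (e' + Finsupp.single none i) 1) (by
      refine monomial_mem_bdV _ _ ?_ ?_
      · simp [Finset.sum_add_distrib, Finsupp.single_apply]; omega
      · simp [he0]; omega) j
    convert this using 1
    rw [startG, he', ← mul_assoc, monomial_mul, mul_sub, X, monomial_mul, mul_comm _ (C _),
      C_mul_monomial, smul_monomial]
    simp only [mul_one, smul_eq_mul]
    congr 2
    · rw [Finsupp.single_add]; abel_nf
    · congr 1; abel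
  have hspan : bdV N a b ≤ W ⊔ Submodule.span ℂ (Set.range fun x : ExcIdx N δ =>
      (monomial (excExp N δ a x) 1 : MvPolynomial (Option (Fin N)) ℂ)) := by
    set Z := W ⊔ Submodule.span ℂ (Set.range fun x : ExcIdx N δ =>
      (monomial (excExp N δ a x) 1 : MvPolynomial (Option (Fin N)) ℂ)) with hZ
    have hWZ : W ≤ Z := le_sup_left
    have main : ∀ (e : Option (Fin N) →₀ ℕ) (i : ℕ), e none = 0 →
        ∑ l, e (some l) ≤ a → i ≤ b → monomial (e + Finsupp.single none i) (1 : ℂ) ∈ Z := by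
      intro e i h0 hs hi
      by_cases hlow : ∑ l, e (some l) ≤ N * δ + n
      · refine hWZ (hq0 _ (monomial_mem_bdV _ _ ?_ ?_))
        · simpa [Finset.sum_add_distrib, Finsupp.single_apply] using hlow
        · simpa [h0] using hi
      have hex : ∃ j, δ ≤ e (some j) := by
        by_contra! hcon
        have : ∑ l, e (some l) ≤ ∑ l : Fin N, δ := Finset.sum_le_sum fun l _ => (hcon l).le
        simp at this
        omega
      obtain ⟨j, hj⟩ := hex
      have hbase : monomial e (1 : ℂ) ∈ Z := by
        by_cases h2 : ∃ l, l ≠ j ∧ δ ≤ e (some l)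
        · obtain ⟨l, hlj, hl⟩ := h2
          have hB1 := hB e 0 j h0 hs (Nat.zero_le _) hj
          have hB2 := hB e 0 l h0 hs (Nat.zero_le _) hl
          have h3 := W.sub_mem hB1 hB2
          have hne : (((l : ℕ) : ℂ) - ((j : ℕ) : ℂ)) ≠ 0 := by
            rw [sub_ne_zero]
            intro h
            exact hlj (Fin.ext (by exact_mod_cast h))
          have h4 := W.smul_mem ((((l : ℕ) : ℂ) - ((j : ℕ) : ℂ))⁻¹) h3
          apply hWZ
          convert h4 using 1
          rw [Finsupp.single_zero, add_zero, sub_sub_sub_cancel_left, ← sub_smul, smul_smul,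
            inv_mul_cancel₀ hne, one_smul]
        · push Not at h2
          obtain ⟨x, hx⟩ := exists_excExp N δ a e h0 hs (by omega) j h2
          refine (le_sup_right : _ ≤ Z) (Submodule.subset_span ⟨x, ?_⟩)
          simp only [hx]
      clear hlow
      induction i with
      | zero => simpa using hbase
      | succ i ih =>
        have h1 := hWZ (hB e i j h0 hs (by omega) hj)
        have h2 := Z.smul_mem ((j : ℕ) : ℂ) (ih (by omega))
        have := Z.add_mem h1 h2
        rwa [sub_add_cancel] at this
    rw [bdV, restrictSupport_eq_span, Submodule.span_le]
    rintro _ ⟨m, ⟨hm1, hm2⟩, rfl⟩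
    have hm : m = m.erase none + Finsupp.single none (m none) :=
      (Finsupp.erase_add_single none m).symm
    have := main (m.erase none) (m none) (by simp) (by simpa using hm1) hm2
    rw [← hm] at this
    exact this
  have hfdV := bdV_finite N a b
  have hWV : W ≤ bdV N a b := fun u hu => hu.1
  refine ⟨bdV N a b, W, hfdV, hWV, fun h hh => mem_bdV_of_totalDegree h hh (by omega) (by omega),
    fun u hu => hu.2, ?_⟩
  have : FiniteDimensional ℂ W := Submodule.finiteDimensional_of_le hWV
  have hfs : FiniteDimensional ℂ (Submodule.span ℂ (Set.range fun x : ExcIdx N δ =>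
      (monomial (excExp N δ a x) 1 : MvPolynomial (Option (Fin N)) ℂ))) :=
    FiniteDimensional.span_of_finite ℂ (Set.finite_range _)
  have h1 := Submodule.finrank_mono hspan
  have h2 := Submodule.finrank_add_le_finrank_add_finrank W
    (Submodule.span ℂ (Set.range fun x : ExcIdx N δ =>
      (monomial (excExp N δ a x) 1 : MvPolynomial (Option (Fin N)) ℂ)))
  have h3 := finrank_range_le_card (R := ℂ) (fun x : ExcIdx N δ =>
      (monomial (excExp N δ a x) 1 : MvPolynomial (Option (Fin N)) ℂ))
  rw [card_ExcIdx] at h3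
  unfold Set.finrank at h3
  omega

lemma rename_mem_bdV {N a : ℕ} (g : MvPolynomial (Fin N) ℂ)
    (hg : ∀ m ∈ g.support, ∑ j, m j ≤ a) : rename some g ∈ bdV N a 0 := by
  classical
  rw [mem_bdV, support_rename_of_injective (Option.some_injective _)]
  intro m hm
  obtain ⟨m', hm', rfl⟩ := Finset.mem_image.1 hm
  refine ⟨?_, ?_⟩
  · simp only [Finsupp.mapDomain_apply (Option.some_injective _)]
    exact hg m' hm'
  · rw [Finsupp.mapDomain_notin_range]
    simp

lemma support_sum_le {N a : ℕ} (g : MvPolynomial (Fin N) ℂ) (hg : g.totalDegree ≤ a) :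
    ∀ m ∈ g.support, ∑ j, m j ≤ a := by
  intro m hm
  have h1 := (le_totalDegree hm).trans hg
  rwa [Finsupp.sum_fintype _ _ (fun _ => rfl)] at h1

lemma support_pderiv_sum_le {N a : ℕ} (g : MvPolynomial (Fin N) ℂ)
    (hg : g.totalDegree ≤ a + 1) (i : Fin N) :
    ∀ m ∈ (pderiv i g).support, ∑ j, m j ≤ a := by
  intro m hm
  have hc : coeff (m + Finsupp.single i 1) g ≠ 0 := by
    intro h
    rw [mem_support_iff, coeff_pderiv, h] at hm
    simp at hm
  have := support_sum_le g hg _ (mem_support_iff.2 hc)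
  simp [Finset.sum_add_distrib, Finsupp.single_apply] at this
  exact this

/-- The affine line of multipliers. -/
lemma exists_line (α : Fin 2 → ℂ) (hα : α 0 ≠ 0 ∨ α 1 ≠ 0) :
    ∃ l μ : Fin 2 → ℂ, (∃ i, μ i ≠ 0) ∧
      ∀ v : Fin 2 → ℂ, α 0 * v 0 + α 1 * v 1 - 1 = 0 ↔ ∃ t : ℂ, v = fun i => l i + t * μ i := by
  rcases hα with h | h
  · refine ⟨![1 / α 0, 0], ![-α 1 / α 0, 1], ⟨1, by simp⟩, fun v => ⟨fun hv => ⟨v 1, ?_⟩, ?_⟩⟩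
    · funext i
      fin_cases i
      · simp
        field_simp
        linear_combination hv
      · simp
    · rintro ⟨t, rfl⟩
      simp
      field_simp
      ring
  · refine ⟨![0, 1 / α 1], ![1, -α 0 / α 1], ⟨0, by simp⟩, fun v => ⟨fun hv => ⟨v 0, ?_⟩, ?_⟩⟩
    · funext i
      fin_cases i
      · simp
      · simp
        field_simp
        linear_combination hv
    · rintro ⟨t, rfl⟩
      simp
      field_simp
      ring

/-- The system after parametrizing the line of multipliers. -/
noncomputable def redF (N : ℕ) (f : MvPolynomial (Fin N) ℂ) (y : Fin N → ℂ) (c : ℂ)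
    (l μ : Fin 2 → ℂ) : Option (Fin N) → MvPolynomial (Option (Fin N)) ℂ
  | none => rename some f - C c
  | some j => (C (l 0) + C (μ 0) * X none) * (X (some j) - C (y j)) +
      (C (l 1) + C (μ 1) * X none) * rename some (pderiv j f)

lemma C_mem_bdV {N a b : ℕ} (c : ℂ) : (C c : MvPolynomial (Option (Fin N)) ℂ) ∈ bdV N a b :=
  monomial_mem_bdV _ _ (by simp) (by simp)

lemma lin_mem_bdV {N : ℕ} (a b : ℂ) :
    (C a + C b * X none : MvPolynomial (Option (Fin N)) ℂ) ∈ bdV N 0 1 := by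
  refine Submodule.add_mem _ (C_mem_bdV a) ?_
  rw [← smul_eq_C_mul]
  refine Submodule.smul_mem _ _ ?_
  exact monomial_mem_bdV _ _ (by simp [Finsupp.single_apply]) (by simp)

lemma redF_some_mem (N δ : ℕ) (hδ : 1 ≤ δ) (f : MvPolynomial (Fin N) ℂ)
    (hf : f.totalDegree ≤ δ + 1) (y : Fin N → ℂ) (c : ℂ) (l μ : Fin 2 → ℂ) (j : Fin N) :
    redF N f y c l μ (some j) ∈ bdV N δ 1 := by
  refine Submodule.add_mem _ ?_ ?_
  · have h : (X (some j) - C (y j) : MvPolynomial (Option (Fin N)) ℂ) ∈ bdV N 1 0 := by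
      refine Submodule.sub_mem _ ?_ (C_mem_bdV _)
      exact monomial_mem_bdV _ _ (by simp [Finsupp.single_apply]) (by simp)
    exact bdV_mono (by omega) (by omega) (bdV_mul (lin_mem_bdV (l 0) (μ 0)) h)
  · exact bdV_mono (by omega) (by omega) (bdV_mul (lin_mem_bdV (l 1) (μ 1))
      (rename_mem_bdV _ (support_pderiv_sum_le f hf j)))

lemma redF_none_mem (N δ : ℕ) (f : MvPolynomial (Fin N) ℂ)
    (hf : f.totalDegree ≤ δ + 1) (y : Fin N → ℂ) (c : ℂ) (l μ : Fin 2 → ℂ) :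
    redF N f y c l μ none ∈ bdV N (δ + 1) 0 :=
  Submodule.sub_mem _ (rename_mem_bdV _ (support_sum_le f hf)) (C_mem_bdV _)

/-- The parametrization of the hyperplane of multipliers. -/
def redPhi (N : ℕ) (l μ : Fin 2 → ℂ) (w : Option (Fin N) → ℂ) : (Fin N → ℂ) × (Fin 2 → ℂ) :=
  (fun j => w (some j), fun i => l i + w none * μ i)

lemma redPhi_continuous (N : ℕ) (l μ : Fin 2 → ℂ) : Continuous (redPhi N l μ) := by
  unfold redPhi
  fun_prop

lemma redPhi_injective (N : ℕ) (l μ : Fin 2 → ℂ) (hμ : ∃ i, μ i ≠ 0) :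
    Function.Injective (redPhi N l μ) := by
  obtain ⟨i, hi⟩ := hμ
  intro w w' h
  have h1 := congrArg Prod.fst h
  have h2 := congrFun (congrArg Prod.snd h) i
  funext o
  rcases o with _ | j
  · simpa [redPhi, hi] using h2
  · exact congrFun h1 j

lemma redF_eval (N : ℕ) (f : MvPolynomial (Fin N) ℂ) (y : Fin N → ℂ) (c : ℂ)
    (l μ : Fin 2 → ℂ) (w : Option (Fin N) → ℂ) :
    (∀ i, eval w (redF N f y c l μ i) = 0) ↔
      (eval (redPhi N l μ w).1 f - c = 0 ∧
        ∀ j : Fin N, (redPhi N l μ w).2 0 * ((redPhi N l μ w).1 j - y j) +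
          (redPhi N l μ w).2 1 * eval (redPhi N l μ w).1 (pderiv j f) = 0) := by
  have hw : w ∘ some = fun j => w (some j) := rfl
  rw [Option.forall]
  simp [redF, redPhi, eval_rename, hw, mul_comm]

lemma finite_ncard_of_finset_s5 {A : Type*} (S : Set A) (K : ℕ)
    (h : ∀ T : Finset A, (T : Set A) ⊆ S → T.card ≤ K) : S.Finite ∧ S.ncard ≤ K := by
  have hfin : S.Finite := by
    by_contra hS
    obtain ⟨T, hT, hc⟩ := Set.Infinite.exists_subset_card_eq hS (K + 1)
    have := h T hT
    omega
  refine ⟨hfin, ?_⟩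
  rw [Set.ncard_eq_toFinset_card S hfin]
  exact h _ (by simp)


/-- For a polynomial `f : ℂ^N → ℂ` of total degree `2k`, `y ∈ ℂ^N`, `z, γ ∈ ℂ`, and
`α ∈ ℂ²`, the set of isolated solutions `(x, λ) ∈ ℂ^N × ℂ²` of the system
`f(x) - γz = 0`, `λ₀(x - y) + λ₁∇f(x) = 0`, `α₀λ₀ + α₁λ₁ - 1 = 0` is finite and
has at most `K(N, 2k) = N · 2k · (2k - 1)^(N-1)` elements. -/
theorem isolated_solutions_two_homogeneous_bound (N k : ℕ) (hN : 1 ≤ N) (hk : 1 ≤ k)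
    (f : MvPolynomial (Fin N) ℂ) (hdeg : f.totalDegree = 2 * k)
    (y : Fin N → ℂ) (z γ : ℂ) (α : Fin 2 → ℂ) :
    {p : (Fin N → ℂ) × (Fin 2 → ℂ) |
        (eval p.1 f - γ * z = 0 ∧
         (∀ j : Fin N, p.2 0 * (p.1 j - y j) + p.2 1 * eval p.1 (pderiv j f) = 0) ∧
         α 0 * p.2 0 + α 1 * p.2 1 - 1 = 0) ∧
        ∃ U ∈ nhds p, U ∩
          {q : (Fin N → ℂ) × (Fin 2 → ℂ) |
            eval q.1 f - γ * z = 0 ∧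
            (∀ j : Fin N, q.2 0 * (q.1 j - y j) + q.2 1 * eval q.1 (pderiv j f) = 0) ∧
            α 0 * q.2 0 + α 1 * q.2 1 - 1 = 0} = {p}}.Finite ∧
    {p : (Fin N → ℂ) × (Fin 2 → ℂ) |
        (eval p.1 f - γ * z = 0 ∧
         (∀ j : Fin N, p.2 0 * (p.1 j - y j) + p.2 1 * eval p.1 (pderiv j f) = 0) ∧
         α 0 * p.2 0 + α 1 * p.2 1 - 1 = 0) ∧
        ∃ U ∈ nhds p, U ∩
          {q : (Fin N → ℂ) × (Fin 2 → ℂ) |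
            eval q.1 f - γ * z = 0 ∧
            (∀ j : Fin N, q.2 0 * (q.1 j - y j) + q.2 1 * eval q.1 (pderiv j f) = 0) ∧
            α 0 * q.2 0 + α 1 * q.2 1 - 1 = 0} = {p}}.ncard
      ≤ N * (2 * k) * (2 * k - 1) ^ (N - 1) := by
  apply finite_ncard_of_finset_s5
  intro T hT
  classical
  obtain ⟨δ, hδ⟩ : ∃ δ, 2 * k = δ + 1 := ⟨2 * k - 1, by omega⟩
  rw [hδ] at hdeg ⊢
  rw [Nat.add_sub_cancel]
  by_cases hα : α 0 ≠ 0 ∨ α 1 ≠ 0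
  swap
  · push Not at hα
    rcases T.eq_empty_or_nonempty with rfl | ⟨p, hp⟩
    · simp
    · have := (hT hp).1.2.2
      simp [hα.1, hα.2] at this
  obtain ⟨l, μ, hμ, hline⟩ := exists_line α hα
  have hinj := redPhi_injective N l μ hμ
  have hsol : ∀ w, (∀ i, eval w (redF N f y (γ * z) l μ i) = 0) ↔
      redPhi N l μ w ∈ {q : (Fin N → ℂ) × (Fin 2 → ℂ) |
            eval q.1 f - γ * z = 0 ∧
            (∀ j : Fin N, q.2 0 * (q.1 j - y j) + q.2 1 * eval q.1 (pderiv j f) = 0) ∧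
            α 0 * q.2 0 + α 1 * q.2 1 - 1 = 0} := by
    intro w
    rw [redF_eval]
    constructor
    · rintro ⟨h1, h2⟩
      exact ⟨h1, h2, (hline _).2 ⟨w none, rfl⟩⟩
    · rintro ⟨h1, h2, -⟩
      exact ⟨h1, h2⟩
  have hsurj : ∀ p ∈ T, ∃ w, redPhi N l μ w = p := by
    intro p hp
    obtain ⟨t, ht⟩ := (hline _).1 (hT hp).1.2.2
    refine ⟨fun o => o.elim t p.1, ?_⟩
    refine Prod.ext ?_ ?_
    · rfl
    · rw [ht]
      rfl
  have hcard : (T.preimage (redPhi N l μ) hinj.injOn).card = T.card := by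
    rw [Finset.card_preimage]
    congr 1
    refine Finset.filter_true_of_mem ?_
    intro p hp
    exact hsurj p hp
  rw [← hcard]
  refine card_le_of_pencil (redF N f y (γ * z) l μ) (startG N δ) _ ?_ _
    (pencil_space N δ _ (redF_none_mem N δ f hdeg.le _ _ _ _)
      (redF_some_mem N δ (by omega) f hdeg.le _ _ _ _))
  intro w hw
  rw [Finset.mem_preimage] at hw
  obtain ⟨hs, U, hU, hUeq⟩ := hT hw
  refine ⟨(hsol w).2 hs, redPhi N l μ ⁻¹' U, (redPhi_continuous N l μ).continuousAt hU, ?_⟩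
  intro q hq hq0
  have hmem : redPhi N l μ q ∈ ({redPhi N l μ w} : Set _) := by
    rw [← hUeq]
    exact ⟨hq, (hsol q).1 hq0⟩
  exact hinj hmem
end
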